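/- arXiv:2306.11328 — 3 statements merged into one kernel-verified Lean document; each statement's English description precedes it below -/
import Mathlib

section
/- Let n and r be integers with 2 ≤ r ≤ n−3, and let T be a tree of order n with exactly one pendent path of length r that has the minimum Mostar index among all such trees. Then T is isomorphic to A^1_{n,1,2}. -/
open Finset SimpleGraph

open scoped Classical

/-- ψ(uv) = |n_u - n_v| for an edge, as a symmetric function on `Sym2 V`. -/
noncomputable def mostarPsi {V : Type*} [Fintype V] (G : SimpleGraph V) : Sym2 V → ℕ :=
  Sym2.lift ⟨fun u v =>
    (((Finset.univ.filter fun w => G.dist w u < G.dist w v).card : ℤ) -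
      ((Finset.univ.filter fun w => G.dist w v < G.dist w u).card : ℤ)).natAbs,
    fun u v => by dsimp only; omega⟩

/-- The Mostar index of a graph. -/
noncomputable def mostar {V : Type*} [Fintype V] (G : SimpleGraph V) : ℕ :=
  ∑ e ∈ G.edgeFinset, mostarPsi G e

/-- The graph on `Fin n` determined by a parent function. -/
def parentGraph (n : ℕ) (p : ℕ → ℕ) : SimpleGraph (Fin n) :=
  SimpleGraph.fromRel (fun u v => p u.val = v.val)

/-- S_{n,r}: r pendent paths of almost equal lengths at a common vertex. -/
def spiderS (n r : ℕ) : SimpleGraph (Fin n) :=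
  parentGraph n (fun v => if v ≤ r then 0 else v - r)

/-- The star on n vertices. -/
def starG (n : ℕ) : SimpleGraph (Fin n) :=
  parentGraph n (fun _ => 0)

/-- C_{n,a,b}. -/
def catC (n a b : ℕ) : SimpleGraph (Fin n) :=
  parentGraph n (fun v =>
    if v < n - a - b then v - 1
    else if v < n - b then v - (n - a - b) + 1
    else v - a - b - 1)

/-- F_{n,a,b}. -/
def catF (n a b : ℕ) : SimpleGraph (Fin n) :=
  parentGraph n (fun v =>
    if v < n - a - b - 2 then v - 1
    else if v = n - a - b - 2 then 1
    else if v < n - b then v - (n - a - b - 2)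
    else v - a - b - 3)

/-- A^r_{n,a,b}. -/
def treeA (n r a b : ℕ) : SimpleGraph (Fin n) :=
  parentGraph n (fun v =>
    if v < n - (a + b) * r then v - 1
    else if v < n - b * r then (if (v - (n - (a + b) * r)) % r = 0 then 0 else v - 1)
    else (if (v - (n - b * r)) % r = 0 then n - (a + b) * r - 1 else v - 1))

/-- S^r_{n,k}: k pendent paths of length r and n - k*r - 1 pendent edges at a common vertex. -/
def treeSrk (n r k : ℕ) : SimpleGraph (Fin n) :=
  parentGraph n (fun v =>
    if v < n - k * r then 0
    else if (v - (n - k * r)) % r = 0 then 0 else v - 1)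

/-- Number of vertices of odd degree. -/
noncomputable def oddDegreeCount {V : Type*} [Fintype V] (G : SimpleGraph V) : ℕ :=
  (Finset.univ.filter fun v => Odd (G.degree v)).card

/-- Number of vertices of degree two. -/
noncomputable def degreeTwoCount {V : Type*} [Fintype V] (G : SimpleGraph V) : ℕ :=
  (Finset.univ.filter fun v => G.degree v = 2).card

/-- Number of branch vertices (degree at least three). -/
noncomputable def branchCount {V : Type*} [Fintype V] (G : SimpleGraph V) : ℕ :=
  (Finset.univ.filter fun v => 3 ≤ G.degree v).card

/-- Number of pendent paths of length r in G. -/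
noncomputable def pendentPathCount {V : Type*} [Fintype V] (G : SimpleGraph V) (r : ℕ) : ℕ :=
  Nat.card { u : Fin (r + 1) → V //
    Function.Injective u ∧
    (∀ i : Fin r, G.Adj (u i.castSucc) (u i.succ)) ∧
    G.degree (u 0) = 1 ∧ 2 ≤ G.degree (u (Fin.last r)) ∧
    ∀ i : Fin (r + 1), i ≠ 0 → i ≠ Fin.last r → G.degree (u i) = 2 }


set_option linter.unusedSectionVars false

section TreeFacts
variable {V : Type*} [Fintype V] {T : SimpleGraph V}

lemma tree_closer_unique (hT : T.IsTree) {w x y z : V} (hy : T.Adj x y) (hz : T.Adj x z)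
    (h1 : T.dist w y < T.dist w x) (h2 : T.dist w z < T.dist w x) : y = z := by
  have key : ∀ y, T.Adj x y → T.dist w y < T.dist w x →
      ∃ q : T.Walk x w, q.IsPath ∧ q.snd = y := by
    intro y hy h1
    obtain ⟨q, hq⟩ := hT.connected.exists_walk_length_eq_dist y w
    refine ⟨Walk.cons hy q, ?_, by simp⟩
    apply Walk.isPath_of_length_eq_dist
    have h3 := T.dist_le (Walk.cons hy q)
    rw [Walk.length_cons, hq] at *
    rw [dist_comm (u := w), dist_comm (u := w)] at h1
    omega
  obtain ⟨p, hp, rfl⟩ := key y hy h1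
  obtain ⟨q, hq, rfl⟩ := key z hz h2
  rw [(hT.existsUnique_path x w).unique hp hq]

lemma exists_closer (hT : T.Connected) {c v : V} (h : v ≠ c) :
    ∃ y, T.Adj v y ∧ T.dist c v = T.dist c y + 1 := by
  obtain ⟨q, hq⟩ := hT.exists_walk_length_eq_dist v c
  cases q with
  | nil => exact absurd rfl h
  | @cons _ y _ hy q =>
    refine ⟨y, hy, ?_⟩
    have h1 := T.dist_le q
    have h2 := hT.dist_triangle (u := v) (v := y) (w := c)
    have h3 : T.dist v y = 1 := dist_eq_one_iff_adj.2 hy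
    rw [Walk.length_cons] at hq
    rw [dist_comm (u := c), dist_comm (u := c)]
    omega

lemma tree_adj_dist (hT : T.IsTree) (w : V) {x y : V} (h : T.Adj x y) :
    T.dist w x = T.dist w y + 1 ∨ T.dist w y = T.dist w x + 1 := by
  have h1 := hT.dist_ne_of_adj w h
  have h2 := hT.connected.dist_triangle (u := w) (v := y) (w := x)
  have h3 := hT.connected.dist_triangle (u := w) (v := x) (w := y)
  have h4 : T.dist x y = 1 := dist_eq_one_iff_adj.2 h
  have h5 : T.dist y x = 1 := dist_eq_one_iff_adj.2 h.symm
  omega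

/-- moving along an edge other than `uv` cannot change the side. -/
lemma tree_side (hT : T.IsTree) {u v x y : V} (huv : T.Adj u v) (hxy : T.Adj x y)
    (h1 : T.dist x u < T.dist x v) (h2 : T.dist y v < T.dist y u) : x = u ∧ y = v := by
  have e1 := tree_adj_dist hT x huv
  have e2 := tree_adj_dist hT y huv
  have e3 := tree_adj_dist hT u hxy
  have e4 := tree_adj_dist hT v hxy
  rw [dist_comm (u := u), dist_comm (u := u)] at e3
  rw [dist_comm (u := v), dist_comm (u := v)] at e4
  by_cases hy : y = v
  · subst hy
    refine ⟨?_, rfl⟩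
    have : T.dist y y = 0 := dist_self
    exact hT.connected.dist_eq_zero_iff.1 (by omega)
  · exfalso
    obtain ⟨z, hz, hz'⟩ := exists_closer hT.connected hy
    have h3 := hT.connected.dist_triangle (u := u) (v := v) (w := z)
    have h4 : T.dist u v = 1 := dist_eq_one_iff_adj.2 huv
    have hzx : z = x := by
      apply tree_closer_unique hT (w := u) hz hxy.symm
      · rw [dist_comm (u := u) (v := y)]
        rw [dist_comm (u := v) (v := y)] at hz'
        omega
      · rw [dist_comm (u := u), dist_comm (u := u)]
        omega
    subst hzx
    rw [dist_comm (u := v), dist_comm (u := v)] at hz'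
    omega

/-- Sum over edges as a sum over nonroot vertices. -/
lemma tree_sum_edges [DecidableEq V] (hT : T.IsTree) (c : V) (par : V → V)
    (hpar : ∀ v, v ≠ c → T.Adj v (par v) ∧ T.dist c v = T.dist c (par v) + 1)
    (F : Sym2 V → ℕ) :
    ∑ e ∈ T.edgeFinset, F e = ∑ v ∈ univ.erase c, F s(v, par v) := by
  have himg : T.edgeFinset = (univ.erase c).image (fun v => s(v, par v)) := by
    ext e
    induction e with
    | _ x y =>
    simp only [mem_edgeFinset, mem_edgeSet, Finset.mem_image, Finset.mem_erase, Finset.mem_univ,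
      and_true]
    constructor
    · intro h
      have key : ∀ x y, T.Adj x y → T.dist c x = T.dist c y + 1 → x ≠ c ∧ par x = y := by
        intro x y h h1
        have hx : x ≠ c := by
          rintro rfl
          rw [dist_self] at h1
          omega
        refine ⟨hx, ?_⟩
        obtain ⟨h2, h3⟩ := hpar x hx
        exact tree_closer_unique hT (w := c) h2 h (by omega) (by omega)
      rcases tree_adj_dist hT c h with h1 | h1
      · obtain ⟨h2, h3⟩ := key x y h h1
        exact ⟨x, h2, by rw [h3]⟩
      · obtain ⟨h2, h3⟩ := key y x h.symm h1
        exact ⟨y, h2, by rw [h3, Sym2.eq_swap]⟩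
    · rintro ⟨v, hv, he⟩
      have := (hpar v hv).1
      rw [← mem_edgeSet, he] at this
      exact this
  rw [himg, Finset.sum_image]
  intro a ha b hb hab
  simp only [Finset.coe_erase, Set.mem_sdiff, Set.mem_singleton_iff] at ha hb
  have h1 := hpar a ha.2
  have h2 := hpar b hb.2
  rcases Sym2.eq_iff.1 hab with h | h
  · exact h.1
  · obtain ⟨h3, h4⟩ := h
    rw [h4] at h1
    rw [← h3] at h2
    omega

lemma tree_psi (hT : T.IsTree) {u v : V} (h : T.Adj u v) :
    (mostarPsi T s(u, v) : ℤ) =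
      |(Fintype.card V : ℤ) - 2 * ((univ.filter fun w => T.dist w u < T.dist w v).card : ℤ)| := by
  have h1 : (univ.filter fun w => T.dist w v < T.dist w u) =
      univ.filter fun w => ¬ (T.dist w u < T.dist w v) := by
    ext w
    have := tree_adj_dist hT w h
    simp
    omega
  have h2 := Finset.card_filter_add_card_filter_not (s := (univ : Finset V))
    (fun w => T.dist w u < T.dist w v)
  rw [Finset.card_univ] at h2
  simp only [mostarPsi, Sym2.lift_mk, h1]
  rw [Int.natCast_natAbs, abs_sub_comm]
  congr 1
  rw [← h2]
  push_cast
  ring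

lemma tree_mostar_lower (hT : T.IsTree) (c : V) :
    (Fintype.card V : ℤ) * (Fintype.card V - 1) ≤
      mostar T + 2 * ((∑ w, T.dist c w : ℕ) : ℤ) := by
  have hex : ∀ v, ∃ y, v ≠ c → T.Adj v y ∧ T.dist c v = T.dist c y + 1 := by
    intro v
    by_cases hv : v = c
    · exact ⟨v, fun h => absurd hv h⟩
    · obtain ⟨y, hy⟩ := exists_closer hT.connected hv
      exact ⟨y, fun _ => hy⟩
  choose par hpar using hex
  have hm : mostar T = ∑ v ∈ univ.erase c, mostarPsi T s(v, par v) :=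
    tree_sum_edges hT c par hpar _
  -- counting ancestors
  have hanc : ∀ k w, T.dist c w = k →
      ((univ.erase c).filter fun v => T.dist w v < T.dist w (par v)).card ≤ k := by
    intro k
    induction k with
    | zero =>
      intro w hw
      have : c = w := hT.connected.dist_eq_zero_iff.1 hw
      subst this
      rw [Nat.le_zero, Finset.card_eq_zero, Finset.filter_eq_empty_iff]
      intro v hv
      have := (hpar v (Finset.ne_of_mem_erase hv)).2
      omega
    | succ k ih =>
      intro w hw
      have hwc : w ≠ c := by
        rintro rfl
        rw [dist_self] at hw
        omega
      obtain ⟨h1, h2⟩ := hpar w hwc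
      have h3 := ih (par w) (by omega)
      refine le_trans (Finset.card_le_card (t := insert w ((univ.erase c).filter
        fun v => T.dist (par w) v < T.dist (par w) (par v))) ?_) 
        (le_trans (Finset.card_insert_le _ _) (by omega))
      intro v hv
      rw [Finset.mem_filter] at hv
      obtain ⟨hv, hv2⟩ := hv
      rw [Finset.mem_insert, Finset.mem_filter]
      by_contra! hcon
      obtain ⟨hc1, hc2⟩ := hcon
      have hv3 := hc2 hv
      obtain ⟨h4, h5⟩ := hpar v (Finset.ne_of_mem_erase hv)
      have h6 := tree_adj_dist hT (par w) h4
      have := tree_side hT h4 h1 hv2 (by omega)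
      exact hc1 this.1.symm
  have hcount : ∑ v ∈ univ.erase c, (univ.filter fun w => T.dist w v < T.dist w (par v)).card ≤
      ∑ w, T.dist c w := by
    simp_rw [Finset.card_filter]
    rw [Finset.sum_comm]
    apply Finset.sum_le_sum
    intro w _
    rw [← Finset.card_filter]
    exact hanc _ w rfl
  have hsum : ∑ v ∈ univ.erase c, ((Fintype.card V : ℤ) -
      2 * ((univ.filter fun w => T.dist w v < T.dist w (par v)).card : ℤ)) ≤
      ∑ v ∈ univ.erase c, (mostarPsi T s(v, par v) : ℤ) := by
    apply Finset.sum_le_sum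
    intro v hv
    rw [tree_psi hT (hpar v (Finset.ne_of_mem_erase hv)).1]
    exact le_abs_self _
  rw [Finset.sum_sub_distrib, ← Finset.mul_sum, Finset.sum_const,
    Finset.card_erase_of_mem (Finset.mem_univ c), Finset.card_univ, nsmul_eq_mul] at hsum
  have hpos : 1 ≤ Fintype.card V := Fintype.card_pos_iff.2 ⟨c⟩
  rw [hm]
  push_cast [hpos] at hsum ⊢
  have : ((∑ v ∈ univ.erase c, (univ.filter fun w => T.dist w v < T.dist w (par v)).card : ℕ) : ℤ)
     ≤ ((∑ w, T.dist c w : ℕ) : ℤ) := by exact_mod_cast hcount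
  push_cast at this
  linarith

/-- Cut lemma. -/
lemma cut_dist {G : SimpleGraph V} (hG : G.Connected) (S : V → Prop) {u v : V} (hv : ¬ S v)
    (hcross : ∀ x y, G.Adj x y → S x → ¬ S y → x = u) {w : V} (hw : S w) :
    G.dist w u < G.dist w v := by
  have key : ∀ (a b : V) (q : G.Walk a b), S a → ¬ S b → G.dist a u < q.length := by
    intro a b q
    induction q with
    | nil => intro h1 h2; exact absurd h1 h2
    | @cons a x b h q ih =>
      intro h1 h2
      rw [Walk.length_cons]
      by_cases hx : S x
      · have h3 := ih hx h2
        have h4 := hG.dist_triangle (u := a) (v := x) (w := u)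
        have h5 : G.dist a x = 1 := dist_eq_one_iff_adj.2 h
        omega
      · rw [hcross a x h h1 hx, dist_self]
        omega
  obtain ⟨q, hq⟩ := hG.exists_walk_length_eq_dist w v
  rw [← hq]
  exact key w v q hw hv

end TreeFacts

/-- The fork: the path `0, 1, ..., n - 2` with an extra vertex `n - 1` attached to `n - 3`. -/
def forkG (n : ℕ) : SimpleGraph (Fin n) where
  Adj u v := min u.val (n - 2) + 1 = min v.val (n - 2) ∨ min v.val (n - 2) + 1 = min u.val (n - 2)
  symm := ⟨fun _ _ h => h.symm⟩
  loopless := ⟨fun _ h => by omega⟩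

lemma forkG_adj (n : ℕ) (u v : Fin n) : (forkG n).Adj u v ↔
    (min u.val (n - 2) + 1 = min v.val (n - 2) ∨ min v.val (n - 2) + 1 = min u.val (n - 2)) :=
  Iff.rfl

/-- Parent function of the fork. -/
def forkPar (n : ℕ) (v : Fin n) : Fin n :=
  ⟨if v.val = n - 1 then n - 3 else v.val - 1, by split <;> omega⟩

/-- Descendant relation of the fork. -/
def forkSub (n : ℕ) (v w : Fin n) : Prop :=
  (v.val ≤ n - 3 ∧ v.val ≤ w.val) ∨ v = w

lemma forkPar_val (n : ℕ) (v : Fin n) :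
    (forkPar n v).val = if v.val = n - 1 then n - 3 else v.val - 1 := rfl

lemma forkPar_adj (n : ℕ) (hn : 5 ≤ n) (v : Fin n) (hv : v.val ≠ 0) :
    (forkG n).Adj v (forkPar n v) := by
  rw [forkG_adj, forkPar_val]
  split <;> omega

lemma forkG_connected (n : ℕ) (hn : 5 ≤ n) : (forkG n).Connected := by
  have key : ∀ k (v : Fin n), v.val = k → (forkG n).Reachable v ⟨0, by omega⟩ := by
    intro k
    induction k using Nat.strong_induction_on with
    | _ k ih =>
      intro v hv
      by_cases h0 : v.val = 0
      · have : v = ⟨0, by omega⟩ := Fin.ext h0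
        rw [this]
      · refine (forkPar_adj n hn v h0).reachable.trans (ih _ ?_ (forkPar n v) rfl)
        rw [forkPar_val]
        split <;> omega
  have : Nonempty (Fin n) := ⟨⟨0, by omega⟩⟩
  exact ⟨fun u v => (key _ u rfl).trans (key _ v rfl).symm⟩

lemma forkG_isTree (n : ℕ) (hn : 5 ≤ n) : (forkG n).IsTree := by
  rw [isTree_iff_connected_and_card]
  refine ⟨forkG_connected n hn, ?_⟩
  have h1 := (forkG_connected n hn).card_vert_le_card_edgeSet_add_one
  have h2 : (forkG n).edgeFinset ⊆ (univ.erase (⟨0, by omega⟩ : Fin n)).image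
      (fun v => s(v, forkPar n v)) := by
    intro e
    induction e with
    | _ x y =>
    simp only [mem_edgeFinset, mem_edgeSet, Finset.mem_image, Finset.mem_erase, Finset.mem_univ,
      and_true]
    intro h
    rw [forkG_adj] at h
    rcases h with h | h
    · refine ⟨y, ?_, ?_⟩
      · rw [Ne, Fin.ext_iff]
        dsimp only
        omega
      · rw [Sym2.eq_swap]
        congr 2
        rw [Fin.ext_iff, forkPar_val]
        split <;> omega
    · refine ⟨x, ?_, ?_⟩
      · rw [Ne, Fin.ext_iff]
        dsimp only
        omega
      · congr 2
        rw [Fin.ext_iff, forkPar_val]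
        split <;> omega
  have h3 := (Finset.card_le_card h2).trans Finset.card_image_le
  rw [Finset.card_erase_of_mem (Finset.mem_univ _), Finset.card_univ, Fintype.card_fin] at h3
  have h4 : (forkG n).edgeFinset.card = Nat.card (forkG n).edgeSet := by
    rw [Nat.card_eq_fintype_card, edgeFinset_card]
  rw [Nat.card_eq_fintype_card (α := Fin n), Fintype.card_fin] at *
  omega

lemma forkSub_iff (n : ℕ) (hn : 5 ≤ n) (v w : Fin n) (hv : v.val ≠ 0) :
    (forkG n).dist w v < (forkG n).dist w (forkPar n v) ↔ forkSub n v w := by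
  constructor
  · intro h
    by_contra hw
    have := cut_dist (forkG_connected n hn) (fun x => ¬ forkSub n v x) (u := forkPar n v) (v := v)
      (by simp [forkSub]) ?_ hw
    · omega
    · intro x y hxy hx hy
      rw [forkG_adj] at hxy
      simp only [forkSub, Fin.ext_iff, not_not] at hx hy
      rw [Fin.ext_iff, forkPar_val]
      split <;> omega
  · intro hw
    apply cut_dist (forkG_connected n hn) (forkSub n v) _ _ hw
    · simp only [forkSub, Fin.ext_iff, forkPar_val]
      split <;> omega
    · intro x y hxy hx hy
      rw [forkG_adj] at hxy
      simp only [forkSub, Fin.ext_iff] at hx hy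
      rw [Fin.ext_iff]
      omega

lemma sum_abs_fork (n : ℕ) :
    2 * ∑ k ∈ range n, |2 * (k : ℤ) - n| = (n : ℤ) ^ 2 + (n % 2 : ℕ) := by
  induction n using Nat.twoStepInduction with
  | zero => simp
  | one => simp
  | more n ih _ =>
    rw [Finset.sum_range_succ', Finset.sum_range_succ]
    have h1 : ∀ k ∈ range n, |2 * ((k + 1 : ℕ) : ℤ) - ((n + 2 : ℕ) : ℤ)| = |2 * (k : ℤ) - n| := by
      intro k _
      congr 1
      push_cast
      ring
    rw [Finset.sum_congr rfl h1]
    have h2 : |2 * ((n + 1 : ℕ) : ℤ) - ((n + 2 : ℕ) : ℤ)| = n := by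
      rw [abs_of_nonneg] <;> push_cast <;> linarith
    have h3 : |2 * ((0 : ℕ) : ℤ) - ((n + 2 : ℕ) : ℤ)| = n + 2 := by
      rw [abs_of_nonpos] <;> push_cast <;> linarith
    rw [h2, h3, Nat.add_mod_right]
    push_cast at ih ⊢
    linarith

lemma forkG_mostar (n : ℕ) (hn : 5 ≤ n) :
    2 * (mostar (forkG n) : ℤ) = (n : ℤ) ^ 2 + (n % 2 : ℕ) - 2 * n + 4 := by
  have hT := forkG_isTree n hn
  have hz : ∀ v : Fin n, v ≠ ⟨0, by omega⟩ → v.val ≠ 0 := by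
    intro v hv h
    exact hv (Fin.ext h)
  have hm : mostar (forkG n) = ∑ v ∈ univ.erase (⟨0, by omega⟩ : Fin n),
      mostarPsi (forkG n) s(v, forkPar n v) := by
    apply tree_sum_edges hT _ (forkPar n)
    intro v hv
    have hv0 := hz v hv
    refine ⟨forkPar_adj n hn v hv0, ?_⟩
    have h1 := tree_adj_dist hT ⟨0, by omega⟩ (forkPar_adj n hn v hv0)
    have h2 := (forkSub_iff n hn v ⟨0, by omega⟩ hv0).not.2 (by
      simp only [forkSub, Fin.ext_iff]
      omega)
    omega
  set g : ℕ → ℤ := fun k => if k ≤ n - 3 then |2 * (k : ℤ) - n| else n - 2 with hg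
  have hpsi : ∀ v ∈ univ.erase (⟨0, by omega⟩ : Fin n),
      (mostarPsi (forkG n) s(v, forkPar n v) : ℤ) = g v.val := by
    intro v hv
    have hv0 := hz v (Finset.ne_of_mem_erase hv)
    rw [tree_psi hT (forkPar_adj n hn v hv0), Fintype.card_fin]
    by_cases h : v.val ≤ n - 3
    · have h1 : (univ.filter fun w => (forkG n).dist w v < (forkG n).dist w (forkPar n v)) =
          Finset.Ici v := by
        ext w
        rw [Finset.mem_filter, forkSub_iff n hn v w hv0, Finset.mem_Ici, Fin.le_def]
        simp only [forkSub, Fin.ext_iff, Finset.mem_univ, true_and]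
        omega
      rw [h1, Fin.card_Ici, hg]
      simp only [h, if_true]
      congr 1
      have := v.isLt
      push_cast [this.le]
      ring
    · have h1 : (univ.filter fun w => (forkG n).dist w v < (forkG n).dist w (forkPar n v)) =
          {v} := by
        ext w
        rw [Finset.mem_filter, forkSub_iff n hn v w hv0, Finset.mem_singleton]
        simp only [forkSub, Fin.ext_iff, Finset.mem_univ, true_and]
        omega
      rw [h1, hg]
      simp only [h, if_false, Finset.card_singleton]
      rw [abs_of_nonneg] <;> push_cast <;> omega
  have h1 : (mostar (forkG n) : ℤ) = ∑ v ∈ univ.erase (⟨0, by omega⟩ : Fin n), g v.val := by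
    rw [hm]
    push_cast
    exact Finset.sum_congr rfl hpsi
  have h2 := Finset.sum_erase_add univ (fun v : Fin n => g v.val)
    (Finset.mem_univ (⟨0, by omega⟩ : Fin n))
  rw [Fin.sum_univ_eq_sum_range g n, ← h1] at h2
  obtain ⟨m, rfl⟩ : ∃ m, n = m + 2 := ⟨n - 2, by omega⟩
  have h3 := sum_abs_fork (m + 2)
  rw [Finset.sum_range_succ, Finset.sum_range_succ] at h2 h3
  have h4 : ∑ k ∈ range m, g k = ∑ k ∈ range m, |2 * (k : ℤ) - ((m + 2 : ℕ) : ℤ)| := by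
    apply Finset.sum_congr rfl
    intro k hk
    rw [Finset.mem_range] at hk
    simp only [hg]
    rw [if_pos (by omega)]
  have h5 : g m = m := by
    simp only [hg]
    rw [if_neg (by omega)]
    push_cast
    ring
  have h6 : g (m + 1) = m := by
    simp only [hg]
    rw [if_neg (by omega)]
    push_cast
    ring
  have h7 : g 0 = m + 2 := by
    simp only [hg]
    rw [if_pos (by omega), abs_of_nonpos] <;> push_cast <;> omega
  have h8 : |2 * (m : ℤ) - ((m + 2 : ℕ) : ℤ)| = m - 2 := by
    rw [abs_of_nonneg] <;> push_cast <;> omega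
  have h9 : |2 * ((m + 1 : ℕ) : ℤ) - ((m + 2 : ℕ) : ℤ)| = m := by
    rw [abs_of_nonneg] <;> push_cast <;> omega
  rw [h4, h5, h6] at h2
  simp only [h7] at h2
  rw [h8, h9] at h3
  push_cast at *
  linarith

lemma forkG_pendent (n r : ℕ) (hr : 2 ≤ r) (hrn : r ≤ n - 3) (hn : 5 ≤ n) :
    pendentPathCount (forkG n) r = 1 := by
  have hdeg1 : (forkG n).degree ⟨0, by omega⟩ = 1 := by
    rw [← card_neighborFinset_eq_degree, Finset.card_eq_one]
    refine ⟨⟨1, by omega⟩, ?_⟩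
    ext w
    rw [mem_neighborFinset, forkG_adj, Finset.mem_singleton, Fin.ext_iff]
    dsimp only
    omega
  have hdeg2 : ∀ v : Fin n, 1 ≤ v.val → v.val ≤ n - 4 → (forkG n).degree v = 2 := by
    intro v h1 h2
    rw [← card_neighborFinset_eq_degree, Finset.card_eq_two]
    refine ⟨⟨v.val - 1, by omega⟩, ⟨v.val + 1, by omega⟩, ?_, ?_⟩
    · rw [Ne, Fin.ext_iff]
      dsimp only
      omega
    ext w
    rw [mem_neighborFinset, forkG_adj, Finset.mem_insert, Finset.mem_singleton, Fin.ext_iff,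
      Fin.ext_iff]
    dsimp only
    omega
  have hdeg3 : ∀ v : Fin n, v.val = n - 3 → 3 ≤ (forkG n).degree v := by
    intro v h1
    rw [← card_neighborFinset_eq_degree]
    have hs : ({⟨n - 4, by omega⟩, ⟨n - 2, by omega⟩, ⟨n - 1, by omega⟩} : Finset (Fin n)) ⊆
        (forkG n).neighborFinset v := by
      intro w
      rw [mem_neighborFinset, forkG_adj, Finset.mem_insert, Finset.mem_insert,
        Finset.mem_singleton, Fin.ext_iff, Fin.ext_iff, Fin.ext_iff]
      dsimp only
      omega
    refine le_trans ?_ (Finset.card_le_card hs)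
    rw [Finset.card_insert_of_notMem, Finset.card_insert_of_notMem, Finset.card_singleton]
    · rw [Finset.mem_singleton, Fin.ext_iff]
      dsimp only
      omega
    · rw [Finset.mem_insert, Finset.mem_singleton, Fin.ext_iff, Fin.ext_iff]
      dsimp only
      omega
  have hdeg : ∀ v : Fin n, 1 ≤ v.val → v.val ≤ n - 3 → 2 ≤ (forkG n).degree v := by
    intro v h1 h2
    by_cases h : v.val = n - 3
    · have := hdeg3 v h
      omega
    · exact (hdeg2 v h1 (by omega)).ge
  unfold pendentPathCount
  rw [Nat.card_eq_one_iff_unique]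
  constructor
  · constructor
    have key : ∀ u : Fin (r + 1) → Fin n, (Function.Injective u ∧
        (∀ i : Fin r, (forkG n).Adj (u i.castSucc) (u i.succ)) ∧
        (forkG n).degree (u 0) = 1 ∧ 2 ≤ (forkG n).degree (u (Fin.last r)) ∧
        ∀ i : Fin (r + 1), i ≠ 0 → i ≠ Fin.last r → (forkG n).degree (u i) = 2) →
        ∀ i, (u i).val = i.val := by
      rintro u ⟨hinj, hadj, h0, -, hmid⟩
      have h1 : (u 0).val = 0 := by
        by_contra hne
        have h2 := hadj ⟨0, by omega⟩
        have h3 := hmid (Fin.succ ⟨0, by omega⟩) (Fin.succ_ne_zero _) (by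
          rw [Ne, Fin.ext_iff]
          simp
          omega)
        have h4 : ¬ (u 0).val ≤ n - 3 := by
          intro h5
          have := hdeg (u 0) (by omega) h5
          omega
        have h6 : (Fin.castSucc ⟨0, by omega⟩ : Fin (r + 1)) = 0 := rfl
        rw [forkG_adj, h6] at h2
        have h7 := hdeg3 (u (Fin.succ ⟨0, by omega⟩)) (by omega)
        omega
      have hi : ∀ k (hk : k < r + 1), ∀ j (hj : j < r + 1), j ≤ k → (u ⟨j, hj⟩).val = j := by
        intro k
        induction k with
        | zero =>
          intro _ j hj hjk
          have : j = 0 := by omega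
          subst this
          exact h1
        | succ k ih =>
          intro hk j hj hjk
          by_cases hjk2 : j ≤ k
          · exact ih (by omega) j hj hjk2
          have : j = k + 1 := by omega
          subst this
          have h2 := hadj ⟨k, by omega⟩
          have h3 : (Fin.castSucc ⟨k, by omega⟩ : Fin (r + 1)) = ⟨k, by omega⟩ := rfl
          have h4 : (Fin.succ ⟨k, by omega⟩ : Fin (r + 1)) = ⟨k + 1, hk⟩ := rfl
          rw [forkG_adj, h3, h4, ih (by omega) k (by omega) le_rfl] at h2
          rcases Nat.eq_zero_or_pos k with hk0 | hk0
          · omega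
          · have h5 := ih (by omega) (k - 1) (by omega) (by omega)
            have h6 : (u ⟨k + 1, hk⟩).val ≠ k - 1 := by
              intro h
              have := hinj (Fin.ext (h.trans h5.symm))
              rw [Fin.ext_iff] at this
              dsimp only at this
              omega
            omega
      intro i
      exact hi i.val i.isLt i.val i.isLt le_rfl
    rintro ⟨u, hu⟩ ⟨u', hu'⟩
    rw [Subtype.mk.injEq]
    funext i
    exact Fin.ext ((key u hu i).trans (key u' hu' i).symm)
  · refine ⟨⟨fun i => ⟨i.val, by omega⟩, ?_, ?_, hdeg1, ?_, ?_⟩⟩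
    · intro i j hij
      rw [Fin.ext_iff] at hij ⊢
      exact hij
    · intro i
      rw [forkG_adj]
      simp only [Fin.val_castSucc, Fin.val_succ]
      omega
    · exact hdeg _ (by simp; omega) (by simp; omega)
    · intro i h1 h2
      rw [Ne, Fin.ext_iff] at h1 h2
      simp only [Fin.val_zero, Fin.val_last] at h1 h2
      exact hdeg2 _ (by dsimp only; omega) (by dsimp only; omega)

section Diam
variable {V : Type*} [Fintype V] {T : SimpleGraph V}

/-- `p 0, ..., p d` is a geodesic. -/
def GeoPath (T : SimpleGraph V) (d : ℕ) (p : ℕ → V) : Prop :=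
  ∀ i j, i ≤ d → j ≤ d → T.dist (p i) (p j) = (i - j) + (j - i)

lemma GeoPath.rev {d : ℕ} {p : ℕ → V} (h : GeoPath T d p) : GeoPath T d (fun i => p (d - i)) := by
  intro i j hi hj
  dsimp only
  rw [h _ _ (by omega) (by omega)]
  omega

lemma GeoPath.adj {d : ℕ} {p : ℕ → V} (h : GeoPath T d p) {i j : ℕ} (hi : i ≤ d) (hj : j ≤ d) :
    T.Adj (p i) (p j) ↔ (i + 1 = j ∨ j + 1 = i) := by
  rw [← dist_eq_one_iff_adj, h i j hi hj]
  omega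

lemma GeoPath.inj {d : ℕ} {p : ℕ → V} (h : GeoPath T d p) {i j : ℕ} (hi : i ≤ d) (hj : j ≤ d)
    (hij : p i = p j) : i = j := by
  have := h i j hi hj
  rw [hij, dist_self] at this
  omega

lemma exists_diam_path (hT : T.Connected) :
    ∃ (d : ℕ) (p : ℕ → V), GeoPath T d p ∧ ∀ x y, T.dist x y ≤ d := by
  have := hT.nonempty
  obtain ⟨⟨a, b⟩, hab⟩ := Finite.exists_max (fun q : V × V => T.dist q.1 q.2)
  obtain ⟨q, hq⟩ := hT.exists_walk_length_eq_dist a b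
  refine ⟨T.dist a b, q.getVert, ?_, fun x y => hab (x, y)⟩
  have hle : ∀ i t, T.dist (q.getVert i) (q.getVert (i + t)) ≤ t := by
    intro i t
    induction t with
    | zero => simp
    | succ t ih =>
      have h1 := hT.dist_triangle (u := q.getVert i) (v := q.getVert (i + t))
        (w := q.getVert (i + (t + 1)))
      have h2 : T.dist (q.getVert (i + t)) (q.getVert (i + (t + 1))) ≤ 1 := by
        by_cases h : i + t < q.length
        · exact (dist_eq_one_iff_adj.2 (q.adj_getVert_succ h)).le
        · rw [q.getVert_of_length_le (by omega), q.getVert_of_length_le (by omega), dist_self]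
          omega
      omega
  have hmain : ∀ i j, i ≤ j → j ≤ T.dist a b → T.dist (q.getVert i) (q.getVert j) = j - i := by
    intro i j hij hj
    have h1 := hle 0 i
    have h2 := hle i (j - i)
    have h3 := hle j (T.dist a b - j)
    rw [show i + (j - i) = j by omega] at h2
    rw [show j + (T.dist a b - j) = q.length by omega, q.getVert_length] at h3
    rw [Nat.zero_add, q.getVert_zero] at h1
    have h4 := hT.dist_triangle (u := a) (v := q.getVert i) (w := b)
    have h5 := hT.dist_triangle (u := q.getVert i) (v := q.getVert j) (w := b)
    omega
  intro i j hi hj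
  rcases le_total i j with h | h
  · rw [hmain i j h hj]
    omega
  · rw [dist_comm, hmain j i h hi]
    omega

lemma geo_up (hT : T.IsTree) {d : ℕ} {p : ℕ → V} (h : GeoPath T d p) (w : V) {k : ℕ}
    (hmin : ∀ i, i ≤ d → T.dist w (p k) ≤ T.dist w (p i)) (t : ℕ) :
    k + t ≤ d → T.dist w (p (k + t)) = T.dist w (p k) + t := by
  induction t using Nat.strong_induction_on with
  | _ t ih =>
    intro ht
    match t, ih, ht with
    | 0, _, _ => rfl
    | 1, _, ht =>
      have h1 := tree_adj_dist hT w ((h.adj (i := k) (j := k + 1) (by omega) (by omega)).2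
        (Or.inl rfl))
      have h2 := hmin (k + 1) ht
      omega
    | t + 2, ih, ht =>
      have h0 := ih t (by omega) (by omega)
      have h1 := ih (t + 1) (by omega) (by omega)
      have ha := (h.adj (i := k + (t + 1)) (j := k + (t + 2)) (by omega) (by omega)).2 (by omega)
      have hb := (h.adj (i := k + (t + 1)) (j := k + t) (by omega) (by omega)).2 (by omega)
      have h2 := tree_adj_dist hT w ha
      rcases h2 with h2 | h2
      · exfalso
        have h3 := tree_closer_unique hT (w := w) ha hb (by omega) (by omega)
        have h4 := h.inj (by omega) (by omega) h3
        omega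
      · omega

lemma geo_proj (hT : T.IsTree) {d : ℕ} {p : ℕ → V} (h : GeoPath T d p) (w : V) :
    ∃ k m, k ≤ d ∧ ∀ i, i ≤ d → T.dist w (p i) = m + ((k - i) + (i - k)) := by
  obtain ⟨k, hk, hmin⟩ := Finset.exists_min_image (range (d + 1)) (fun i => T.dist w (p i))
    ⟨0, by simp⟩
  rw [Finset.mem_range] at hk
  have hmin' : ∀ i, i ≤ d → T.dist w (p k) ≤ T.dist w (p i) := by
    intro i hi
    exact hmin i (by rw [Finset.mem_range]; omega)
  refine ⟨k, T.dist w (p k), by omega, ?_⟩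
  intro i hi
  rcases le_total k i with hki | hki
  · have := geo_up hT h w hmin' (i - k) (by omega)
    rw [show k + (i - k) = i by omega] at this
    omega
  · have := geo_up hT h.rev w (k := d - k) (by
      intro j hj
      rw [show d - (d - k) = k by omega]
      exact hmin' _ (by omega)) (k - i) (by omega)
    rw [show d - (d - k) = k by omega, show d - (d - k + (k - i)) = i by omega] at this
    omega

lemma sum_center (d : ℕ) :
    4 * ∑ i ∈ range (d + 1), ((d / 2 - i) + (i - d / 2)) + (d + 1) % 2 = (d + 1) ^ 2 := by
  induction d using Nat.twoStepInduction with
  | zero => simp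
  | one => simp [Finset.sum_range_succ]
  | more d ih _ =>
    rw [Finset.sum_range_succ', Finset.sum_range_succ]
    have h1 : ∀ i ∈ range (d + 1), (((d + 2) / 2 - (i + 1)) + ((i + 1) - (d + 2) / 2)) =
        ((d / 2 - i) + (i - d / 2)) := by
      intro i _
      omega
    rw [Finset.sum_congr rfl h1]
    have h2 : ((d + 2) / 2 - (d + 1 + 1)) + ((d + 1 + 1) - (d + 2) / 2) + 
        (((d + 2) / 2 - 0) + (0 - (d + 2) / 2)) = d + 2 := by omega
    have h3 : (d + 2 + 1) % 2 = (d + 1) % 2 := by omega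
    rw [h3]
    nlinarith

lemma geo_card [DecidableEq V] {d : ℕ} {p : ℕ → V} (h : GeoPath T d p) :
    ((range (d + 1)).image p).card = d + 1 := by
  rw [Finset.card_image_of_injOn, Finset.card_range]
  intro i hi j hj hij
  simp only [Finset.coe_range, Set.mem_Iio] at hi hj
  exact h.inj (by omega) (by omega) hij

lemma center_bound [DecidableEq V] (hT : T.IsTree) {d : ℕ} {p : ℕ → V} (h : GeoPath T d p)
    (hmax : ∀ x y, T.dist x y ≤ d) (w0 : V) (hw0 : w0 ∉ (range (d + 1)).image p) (s : ℕ)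
    (hs : T.dist (p (d / 2)) w0 ≤ s) :
    ∑ w, T.dist (p (d / 2)) w ≤ ∑ i ∈ range (d + 1), ((d / 2 - i) + (i - d / 2)) + s +
      (Fintype.card V - (d + 2)) * ((d + 1) / 2) := by
  have hfar : ∀ w, T.dist (p (d / 2)) w ≤ (d + 1) / 2 := by
    intro w
    obtain ⟨k, m, hk, hw⟩ := geo_proj hT h w
    have h0 := hw 0 (by omega)
    have h1 := hw d le_rfl
    have h2 := hw (d / 2) (by omega)
    have h3 := hmax w (p 0)
    have h4 := hmax w (p d)
    rw [dist_comm]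
    omega
  have h1 : ∑ w ∈ (range (d + 1)).image p, T.dist (p (d / 2)) w =
      ∑ i ∈ range (d + 1), ((d / 2 - i) + (i - d / 2)) := by
    rw [Finset.sum_image]
    · apply Finset.sum_congr rfl
      intro i hi
      rw [Finset.mem_range] at hi
      exact h _ _ (by omega) (by omega)
    · intro i hi j hj hij
      simp only [Finset.coe_range, Set.mem_Iio] at hi hj
      exact h.inj (by omega) (by omega) hij
  have hw0' : w0 ∈ ((range (d + 1)).image p)ᶜ := by rwa [Finset.mem_compl]
  rw [← Finset.sum_add_sum_compl ((range (d + 1)).image p), h1,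
    ← Finset.sum_erase_add _ _ hw0']
  have h2 : ∑ w ∈ (((range (d + 1)).image p)ᶜ).erase w0, T.dist (p (d / 2)) w ≤
      (Fintype.card V - (d + 2)) * ((d + 1) / 2) := by
    refine (Finset.sum_le_card_nsmul _ _ ((d + 1) / 2) (fun w _ => hfar w)).trans ?_
    rw [Finset.card_erase_of_mem hw0', Finset.card_compl, geo_card h, smul_eq_mul]
    rfl
  omega

lemma arith_small (n d S : ℕ) (hS : 4 * S + (d + 1) % 2 = (d + 1) ^ 2) (hd : d + 3 ≤ n) :
    4 * (S + d / 2 + (n - (d + 2)) * ((d + 1) / 2)) + n % 2 + 8 ≤ n ^ 2 := by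
  obtain ⟨t, rfl⟩ : ∃ t, n = d + 3 + t := ⟨n - (d + 3), by omega⟩
  rw [show d + 3 + t - (d + 2) = t + 1 by omega]
  rcases Nat.even_or_odd' d with ⟨m, rfl | rfl⟩
  · rw [show 2 * m / 2 = m by omega, show (2 * m + 1) / 2 = m by omega]
    rw [show (2 * m + 1) % 2 = 1 by omega] at hS
    rcases Nat.even_or_odd' t with ⟨a, rfl | rfl⟩
    · rw [show (2 * m + 3 + 2 * a) % 2 = 1 by omega]
      nlinarith
    · rw [show (2 * m + 3 + (2 * a + 1)) % 2 = 0 by omega]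
      nlinarith
  · rw [show (2 * m + 1) / 2 = m by omega, show (2 * m + 1 + 1) / 2 = m + 1 by omega]
    rw [show (2 * m + 1 + 1) % 2 = 0 by omega] at hS
    rcases Nat.even_or_odd' t with ⟨a, rfl | rfl⟩
    · rw [show (2 * m + 1 + 3 + 2 * a) % 2 = 0 by omega]
      nlinarith
    · rw [show (2 * m + 1 + 3 + (2 * a + 1)) % 2 = 1 by omega]
      nlinarith

lemma arith_near (d S s : ℕ) (hS : 4 * S + (d + 1) % 2 = (d + 1) ^ 2) (hs : s + 1 ≤ d / 2) :
    4 * (S + s + (d + 2 - (d + 2)) * ((d + 1) / 2)) + (d + 2) % 2 + 8 ≤ (d + 2) ^ 2 := by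
  rw [Nat.sub_self, Nat.zero_mul, Nat.add_zero]
  rcases Nat.even_or_odd' d with ⟨m, rfl | rfl⟩
  · rw [show (2 * m + 1) % 2 = 1 by omega] at hS
    rw [show (2 * m + 2) % 2 = 0 by omega]
    have : s + 1 ≤ m := by omega
    nlinarith
  · rw [show (2 * m + 1 + 1) % 2 = 0 by omega] at hS
    rw [show (2 * m + 1 + 2) % 2 = 1 by omega]
    have : s + 1 ≤ m := by omega
    nlinarith

lemma oriented_main [DecidableEq V] (hT : T.IsTree) {d : ℕ} {p : ℕ → V} (h : GeoPath T d p)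
    (hmax : ∀ x y, T.dist x y ≤ d) (w0 : V) (hw0 : w0 ∉ (range (d + 1)).image p)
    (k m : ℕ) (hk : k ≤ d / 2)
    (hw : ∀ i, i ≤ d → T.dist w0 (p i) = m + ((k - i) + (i - k))) :
    (∃ c, 4 * (∑ w, T.dist c w) + Fintype.card V % 2 + 8 ≤ Fintype.card V ^ 2) ∨
    (Fintype.card V = d + 2 ∧ ∀ i, i ≤ d → T.dist w0 (p i) = 1 + ((1 - i) + (i - 1))) := by
  have hcard : d + 2 ≤ Fintype.card V := by
    have h1 := Finset.card_le_univ (insert w0 ((range (d + 1)).image p))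
    rw [Finset.card_insert_of_notMem hw0, geo_card h] at h1
    exact h1
  have hmem : ∀ i, i ≤ d → p i ∈ (range (d + 1)).image p := by
    intro i hi
    exact Finset.mem_image_of_mem p (by rw [Finset.mem_range]; omega)
  have hm : m ≠ 0 := by
    rintro rfl
    have h1 := hw k (by omega)
    have h2 : w0 = p k := hT.connected.dist_eq_zero_iff.1 (by omega)
    exact hw0 (h2 ▸ hmem k (by omega))
  have hc := hw (d / 2) (by omega)
  have hdd := hw d le_rfl
  have hlast := hmax w0 (p d)
  rw [dist_comm] at hc
  by_cases hd : d + 3 ≤ Fintype.card V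
  · left
    refine ⟨p (d / 2), ?_⟩
    have h1 := center_bound hT h hmax w0 hw0 (d / 2) (by omega)
    have h2 := arith_small (Fintype.card V) d _ (sum_center d) hd
    omega
  · have hV : Fintype.card V = d + 2 := by omega
    -- `w0` is the only vertex off the path, so it is adjacent to the path
    have hall : ∀ w, w ≠ w0 → ∃ i, i ≤ d ∧ p i = w := by
      intro w hne
      by_contra hcon
      have hwn : w ∉ insert w0 ((range (d + 1)).image p) := by
        rw [Finset.mem_insert, Finset.mem_image]
        rintro (h1 | ⟨i, hi, h1⟩)
        · exact hne h1
        · rw [Finset.mem_range] at hi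
          exact hcon ⟨i, by omega, h1⟩
      have h1 := Finset.card_le_univ (insert w (insert w0 ((range (d + 1)).image p)))
      rw [Finset.card_insert_of_notMem hwn, Finset.card_insert_of_notMem hw0, geo_card h] at h1
      omega
    have hne : w0 ≠ p 0 := by
      intro he
      exact hw0 (he ▸ hmem 0 (by omega))
    obtain ⟨y, hy, -⟩ := exists_closer hT.connected hne
    obtain ⟨i, hi, rfl⟩ := hall y hy.ne'
    have h1 := dist_eq_one_iff_adj.2 hy
    rw [hw i hi] at h1
    have hm1 : m = 1 := by omega
    by_cases hk1 : k = 1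
    · right
      subst hm1 hk1
      exact ⟨hV, hw⟩
    · left
      refine ⟨p (d / 2), ?_⟩
      have h2 := center_bound hT h hmax w0 hw0 (d / 2 - 1) (by omega)
      have h3 := arith_near d _ (d / 2 - 1) (sum_center d) (by omega)
      rw [hV] at h2 ⊢
      omega

lemma geo_pendent {d r : ℕ} {p : ℕ → V} (h : GeoPath T d p) (hall : ∀ w, ∃ i, i ≤ d ∧ p i = w)
    (hr : 2 ≤ r) (hrd : r + 1 ≤ d) (u : Fin (r + 1) → V) (hu : ∀ i, u i = p i.val) :
    Function.Injective u ∧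
    (∀ i : Fin r, T.Adj (u i.castSucc) (u i.succ)) ∧
    T.degree (u 0) = 1 ∧ 2 ≤ T.degree (u (Fin.last r)) ∧
    ∀ i : Fin (r + 1), i ≠ 0 → i ≠ Fin.last r → T.degree (u i) = 2 := by
  have hdeg2 : ∀ i, 1 ≤ i → i + 1 ≤ d → T.degree (p i) = 2 := by
    intro i h1 h2
    rw [← card_neighborFinset_eq_degree, Finset.card_eq_two]
    refine ⟨p (i - 1), p (i + 1), ?_, ?_⟩
    · intro he
      have := h.inj (by omega) (by omega) he
      omega
    · ext w
      obtain ⟨j, hj, rfl⟩ := hall w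
      rw [mem_neighborFinset, h.adj (by omega) hj, Finset.mem_insert, Finset.mem_singleton]
      constructor
      · rintro (rfl | rfl)
        · right; rfl
        · left; rfl
      · rintro (he | he)
        · have := h.inj (by omega) (by omega) he
          omega
        · have := h.inj (by omega) (by omega) he
          omega
  refine ⟨?_, ?_, ?_, ?_, ?_⟩
  · intro i j hij
    rw [hu, hu] at hij
    exact Fin.ext (h.inj (by omega) (by omega) hij)
  · intro i
    rw [hu, hu]
    exact (h.adj (by simp only [Fin.val_castSucc]; omega) (by simp only [Fin.val_succ]; omega)).2
      (Or.inl (by simp only [Fin.val_castSucc, Fin.val_succ]))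
  · rw [hu, Fin.val_zero, ← card_neighborFinset_eq_degree, Finset.card_eq_one]
    refine ⟨p 1, ?_⟩
    ext w
    obtain ⟨j, hj, rfl⟩ := hall w
    rw [mem_neighborFinset, h.adj (by omega) hj, Finset.mem_singleton]
    constructor
    · rintro (rfl | he)
      · rfl
      · omega
    · intro he
      have := h.inj (by omega) (by omega) he
      omega
  · rw [hu, Fin.val_last, hdeg2 r (by omega) (by omega)]
  · intro i h1 h2
    rw [Ne, Fin.ext_iff] at h1 h2
    simp only [Fin.val_zero, Fin.val_last] at h1 h2
    rw [hu, hdeg2 _ (by omega) (by omega)]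

lemma path_not_one {d r : ℕ} {p : ℕ → V} (h : GeoPath T d p) (hall : ∀ w, ∃ i, i ≤ d ∧ p i = w)
    (hr : 2 ≤ r) (hrd : r + 1 ≤ d) : pendentPathCount T r ≠ 1 := by
  intro hc
  unfold pendentPathCount at hc
  rw [Nat.card_eq_one_iff_unique] at hc
  obtain ⟨hs, -⟩ := hc
  have h1 := geo_pendent h hall hr hrd (fun i => p i.val) (fun _ => rfl)
  have h2 := geo_pendent h.rev (by
    intro w
    obtain ⟨i, hi, he⟩ := hall w
    refine ⟨d - i, by omega, ?_⟩
    rw [show d - (d - i) = i by omega, he]) hr hrd (fun i => p (d - i.val)) (fun _ => rfl)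
  have h3 := Subtype.mk.inj (hs.elim ⟨_, h1⟩ ⟨_, h2⟩)
  have h4 := congrFun h3 0
  have := h.inj (by simp) (by simp) h4
  simp at this
  omega

end Diam

lemma treeA_adj (n : ℕ) (hn : 5 ≤ n) (u v : Fin n) : (treeA n 1 1 2).Adj u v ↔
    u ≠ v ∧ ((if u.val < n - 3 then u.val - 1 else if u.val < n - 2 then 0 else n - 4) = v.val ∨
      (if v.val < n - 3 then v.val - 1 else if v.val < n - 2 then 0 else n - 4) = u.val) := by
  unfold treeA parentGraph
  rw [SimpleGraph.fromRel_adj]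
  simp only [Nat.mod_one, if_true, Nat.mul_one, Nat.reduceAdd]
  rw [show n - 3 - 1 = n - 4 by omega]

lemma fork_iso {n : ℕ} (hn : 5 ≤ n) {T : SimpleGraph (Fin n)} {d : ℕ}
    {p : ℕ → Fin n} (h : GeoPath T d p) (w0 : Fin n) (hw0 : w0 ∉ (range (d + 1)).image p)
    (hd : n = d + 2)
    (hw : ∀ i, i ≤ d → T.dist w0 (p i) = 1 + ((1 - i) + (i - 1))) :
    Nonempty (T ≃g treeA n 1 1 2) := by
  set f : Fin n → Fin n := fun v => if v.val = n - 1 then w0 else if v.val = n - 2 then p 0 else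
    if v.val = n - 3 then p d else p (n - 3 - v.val) with hf
  set q : Fin n → ℕ := fun v => if v.val = n - 2 then 0 else
    if v.val = n - 3 then d else n - 3 - v.val with hq
  have hqd : ∀ v, q v ≤ d := by
    intro v
    simp only [hq]
    split_ifs <;> omega
  have hf1 : ∀ v, v.val = n - 1 → f v = w0 := by
    intro v hv
    simp only [hf]
    rw [if_pos hv]
  have hf2 : ∀ v, v.val ≠ n - 1 → f v = p (q v) := by
    intro v hv
    simp only [hf, hq]
    rw [if_neg hv]
    split_ifs <;> rfl
  have hne : ∀ i, i ≤ d → w0 ≠ p i := by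
    intro i hi he
    exact hw0 (he ▸ Finset.mem_image_of_mem p (by rw [Finset.mem_range]; omega))
  have hqinj : ∀ a b : Fin n, a.val ≠ n - 1 → b.val ≠ n - 1 → q a = q b → a = b := by
    intro a b ha hb hab
    rw [Fin.ext_iff]
    simp only [hq] at hab
    split_ifs at hab <;> omega
  have hinj : Function.Injective f := by
    intro a b hab
    by_cases ha : a.val = n - 1 <;> by_cases hb : b.val = n - 1
    · exact Fin.ext (ha.trans hb.symm)
    · rw [hf1 a ha, hf2 b hb] at hab
      exact absurd hab (hne _ (hqd b))
    · rw [hf2 a ha, hf1 b hb] at hab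
      exact absurd hab.symm (hne _ (hqd a))
    · rw [hf2 a ha, hf2 b hb] at hab
      exact hqinj a b ha hb (h.inj (hqd a) (hqd b) hab)
  have hwadj : ∀ i, i ≤ d → (T.Adj w0 (p i) ↔ i = 1) := by
    intro i hi
    rw [← dist_eq_one_iff_adj, hw i hi]
    omega
  have hadj : ∀ a b, T.Adj (f a) (f b) ↔ (treeA n 1 1 2).Adj a b := by
    intro a b
    have hla := a.isLt
    have hlb := b.isLt
    rw [treeA_adj n hn, Ne, Fin.ext_iff]
    by_cases ha : a.val = n - 1 <;> by_cases hb : b.val = n - 1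
    · rw [hf1 a ha, hf1 b hb]
      constructor
      · intro hc
        exact absurd rfl hc.ne
      · intro hc
        omega
    · rw [hf1 a ha, hf2 b hb, hwadj _ (hqd b)]
      simp only [hq]
      split_ifs <;> first | omega | 
        (simp only [false_iff, or_false, false_or]; omega)
    · rw [hf1 b hb, hf2 a ha, T.adj_comm, hwadj _ (hqd a)]
      simp only [hq]
      split_ifs <;> first | omega | 
        (simp only [false_iff, or_false, false_or]; omega)
    · rw [hf2 a ha, hf2 b hb, h.adj (hqd a) (hqd b)]
      simp only [hq]
      split_ifs <;> first | omega | 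
        (simp only [false_iff, or_false, false_or]; omega)
  have hbij : Function.Bijective f := Finite.injective_iff_bijective.1 hinj
  have e : treeA n 1 1 2 ≃g T := ⟨Equiv.ofBijective f hbij, by
    intro a b
    exact hadj a b⟩
  exact ⟨e.symm⟩

/-- the tree minimizing the Mostar index among trees of order n with exactly
one pendent path of length r (2 ≤ r ≤ n-3) is A^1_{n,1,2}. -/
theorem min_mostar_one_pendent_path (n r : ℕ) (hr : 2 ≤ r) (hrn : r ≤ n - 3) (hn : 3 ≤ n)
    (T : SimpleGraph (Fin n)) (hT : T.IsTree) (hpp : pendentPathCount T r = 1)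
    (hmin : ∀ T' : SimpleGraph (Fin n), T'.IsTree → pendentPathCount T' r = 1 →
      mostar T ≤ mostar T') :
    Nonempty (T ≃g treeA n 1 1 2) := by
  have hn5 : 5 ≤ n := by omega
  obtain ⟨d, p, hp, hmax⟩ := exists_diam_path hT.connected
  by_cases hall : ∀ w, ∃ i, i ≤ d ∧ p i = w
  · exfalso
    have hle : n ≤ d + 1 := by
      have h1 : (univ : Finset (Fin n)) ⊆ (range (d + 1)).image p := by
        intro w _
        obtain ⟨i, hi, rfl⟩ := hall w
        exact Finset.mem_image_of_mem p (by rw [Finset.mem_range]; omega)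
      have h2 := Finset.card_le_card h1
      rw [geo_card hp, Finset.card_univ, Fintype.card_fin] at h2
      exact h2
    exact path_not_one hp hall hr (by omega) hpp
  · push Not at hall
    obtain ⟨w0, hw0⟩ := hall
    have hnot : ∀ c, ¬ (4 * (∑ w, T.dist c w) + n % 2 + 8 ≤ n ^ 2) := by
      intro c hc
      have h1 := tree_mostar_lower hT c
      have h2 := forkG_mostar n hn5
      have h3 := hmin (forkG n) (forkG_isTree n hn5) (forkG_pendent n r hr hrn hn5)
      rw [Fintype.card_fin] at h1
      have h4 : (mostar T : ℤ) ≤ mostar (forkG n) := by exact_mod_cast h3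
      have h5 : 4 * ((∑ w, T.dist c w : ℕ) : ℤ) + ((n % 2 : ℕ) : ℤ) + 8 ≤ (n : ℤ) ^ 2 := by
        exact_mod_cast hc
      nlinarith
    have hfin : ∀ p : ℕ → Fin n, GeoPath T d p → (∀ i, i ≤ d → p i ≠ w0) →
        ∀ k m, k ≤ d / 2 → (∀ i, i ≤ d → T.dist w0 (p i) = m + ((k - i) + (i - k))) →
        Nonempty (T ≃g treeA n 1 1 2) := by
      intro p hp hw0 k m hk hw
      have hw0' : w0 ∉ (range (d + 1)).image p := by
        rw [Finset.mem_image]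
        rintro ⟨i, hi, he⟩
        rw [Finset.mem_range] at hi
        exact hw0 i (by omega) he
      rcases oriented_main hT hp hmax w0 hw0' k m hk hw with ⟨c, hc⟩ | ⟨h1, h2⟩
      · rw [Fintype.card_fin] at hc
        exact absurd hc (hnot c)
      · rw [Fintype.card_fin] at h1
        exact fork_iso hn5 hp w0 hw0' h1 h2
    obtain ⟨k, m, hk, hw⟩ := geo_proj hT hp w0
    by_cases hk2 : k ≤ d / 2
    · exact hfin p hp hw0 k m hk2 hw
    · refine hfin (fun i => p (d - i)) hp.rev (fun i hi => hw0 _ (by omega)) (d - k) m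
        (by omega) ?_
      intro i hi
      rw [hw _ (by omega)]
      omega
end

section
/- Let n and r be integers with 1 ≤ r ≤ n−2, and let T be a tree of order n with exactly two pendent paths of length r that has the minimum Mostar index among all such trees. Then T is isomorphic to the path P_n. -/
open Finset SimpleGraph

open scoped Classical

section TreeLemmas

variable {V : Type*} {G : SimpleGraph V}

lemma geod_avoid {w u v : V} (hne : u ≠ v) (h : G.dist w u ≤ G.dist w v)
    (p : G.Walk w u) (hp : p.length = G.dist w u) : s(u, v) ∉ p.edges := by
  intro he
  have hv : v ∈ p.support := p.snd_mem_support_of_mem_edges he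
  have h1 := p.length_takeUntil_lt_length hv hne.symm
  have h2 := G.dist_le (p.takeUntil v hv)
  omega

lemma cross_edge (hT : G.IsTree) {a b w v : V} (hab : G.Adj a b)
    (hw : G.dist w a ≤ G.dist w b) (hv : G.dist v b ≤ G.dist v a) (q : G.Walk w v) :
    s(a, b) ∈ q.edges := by
  obtain ⟨p1, h1⟩ := hT.connected.exists_walk_length_eq_dist w a
  obtain ⟨p2, h2⟩ := hT.connected.exists_walk_length_eq_dist v b
  have e1 := geod_avoid hab.ne hw p1 h1
  have e2 := geod_avoid hab.ne.symm hv p2 h2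
  rw [Sym2.eq_swap] at e2
  have hb := (isAcyclic_iff_forall_adj_isBridge.mp hT.isAcyclic) hab
  have := (isBridge_iff_forall_walk_mem_edges.mp hb) ((p1.reverse.append q).append p2)
  simp only [Walk.edges_append, Walk.edges_reverse, List.mem_append, List.mem_reverse] at this
  tauto

lemma dist_ne (hT : G.IsTree) {a b : V} (hab : G.Adj a b) (w : V) :
    G.dist w a ≠ G.dist w b := by
  intro h
  have := cross_edge hT hab h.le h.ge (Walk.nil : G.Walk w w)
  simp at this

lemma dist_cases (hT : G.IsTree) {a b : V} (hab : G.Adj a b) (w : V) :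
    G.dist w b = G.dist w a + 1 ∨ G.dist w a = G.dist w b + 1 := by
  have h0 := dist_ne hT hab w
  have h1 : G.dist a b = 1 := dist_eq_one_iff_adj.mpr hab
  have h2 : G.dist w b ≤ G.dist w a + G.dist a b := hT.connected.dist_triangle
  have h3 : G.dist w a ≤ G.dist w b + G.dist b a := hT.connected.dist_triangle
  rw [G.dist_comm (u := b)] at h3
  omega

lemma dist_across (hT : G.IsTree) {a b w v : V} (hab : G.Adj a b)
    (hw : G.dist w a < G.dist w b) (hv : G.dist v b < G.dist v a) :
    G.dist w a + 1 + G.dist v b ≤ G.dist w v := by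
  obtain ⟨q, hq⟩ := hT.connected.exists_walk_length_eq_dist w v
  have he := cross_edge hT hab hw.le hv.le q
  have ha : a ∈ q.support := q.fst_mem_support_of_mem_edges he
  have h1 := G.dist_le (q.takeUntil a ha)
  have h2 := G.dist_le (q.dropUntil a ha)
  have h3 : (q.takeUntil a ha).length + (q.dropUntil a ha).length = q.length := by
    rw [← Walk.length_append, Walk.take_spec]
  rw [G.dist_comm (u := a)] at h2
  omega

lemma mostar_lower [Fintype V] (hT : G.IsTree) (c : V) :
    Fintype.card V * (Fintype.card V - 1) ≤ mostar G + 2 * ∑ w, G.dist w c := by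
  choose P hP using fun w => hT.connected.exists_walk_length_eq_dist w c
  have key : ∀ e ∈ G.edgeFinset, Fintype.card V ≤
      mostarPsi G e + 2 * (Finset.univ.filter fun w => e ∈ (P w).edges).card := by
    intro e
    induction e using Sym2.ind with
    | _ u v =>
    intro he
    have huv : G.Adj u v := by simpa using he
    have hsplit : (Finset.univ.filter fun w => G.dist w u < G.dist w v).card +
        (Finset.univ.filter fun w => G.dist w v < G.dist w u).card = Fintype.card V := by
      rw [← Finset.card_union_of_disjoint, ← Finset.card_univ]
      · congr 1
        ext w
        have := dist_ne hT huv w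
        simp
        omega
      · rw [Finset.disjoint_filter]
        intros
        omega
    simp only [mostarPsi, Sym2.lift_mk]
    rcases lt_or_gt_of_ne (dist_ne hT huv c) with h | h
    · have : (Finset.univ.filter fun w => G.dist w v < G.dist w u).card ≤
        (Finset.univ.filter fun w => s(u, v) ∈ (P w).edges).card := by
        apply Finset.card_le_card
        intro w
        simp only [Finset.mem_filter, Finset.mem_univ, true_and]
        intro hw
        rw [Sym2.eq_swap]
        exact cross_edge hT huv.symm hw.le h.le (P w)
      omega
    · have : (Finset.univ.filter fun w => G.dist w u < G.dist w v).card ≤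
        (Finset.univ.filter fun w => s(u, v) ∈ (P w).edges).card := by
        apply Finset.card_le_card
        intro w
        simp only [Finset.mem_filter, Finset.mem_univ, true_and]
        intro hw
        exact cross_edge hT huv hw.le h.le (P w)
      omega
  have h1 := Finset.sum_le_sum key
  rw [Finset.sum_add_distrib, ← Finset.mul_sum, Finset.sum_const, smul_eq_mul] at h1
  have h2 : ∑ e ∈ G.edgeFinset, (Finset.univ.filter fun w => e ∈ (P w).edges).card
      ≤ ∑ w, G.dist w c := by
    simp_rw [Finset.card_filter]
    rw [Finset.sum_comm]
    apply Finset.sum_le_sum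
    intro w _
    rw [← Finset.card_filter, ← hP w, ← Walk.length_edges]
    refine le_trans (Finset.card_le_card ?_) (List.toFinset_card_le _)
    intro e
    simp
  have h3 := hT.card_edgeFinset
  have h4 : Fintype.card V - 1 = G.edgeFinset.card := by omega
  rw [h4, mul_comm]
  unfold mostar
  omega

/-- The sum of `|m - 2 j|` for `0 ≤ j ≤ m`. -/
def gSum (m : ℕ) : ℕ := ∑ j ∈ Finset.range (m + 1), ((m : ℤ) - 2 * j).natAbs

lemma gSum_step (m : ℕ) : gSum (m + 2) = gSum m + 2 * (m + 2) := by
  unfold gSum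
  rw [Finset.sum_range_succ, Finset.sum_range_succ']
  have : ∀ j, (((m + 2 : ℕ) : ℤ) - 2 * ((j + 1 : ℕ) : ℤ)).natAbs = ((m : ℤ) - 2 * j).natAbs := by
    intro j; congr 1; push_cast; ring
  simp_rw [this]
  push_cast
  omega

lemma gSum_le (m : ℕ) : 2 * gSum m ≤ (m + 1) ^ 2 := by
  induction m using Nat.twoStepInduction with
  | zero => simp [gSum]
  | one => simp [gSum, Finset.sum_range_succ]
  | more m ih _ => rw [gSum_step]; nlinarith

lemma getVert_dist_le {u v : V} (p : G.Walk u v) (hG : G.Connected) (i k : ℕ)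
    (h : i + k ≤ p.length) : G.dist (p.getVert i) (p.getVert (i + k)) ≤ k := by
  induction k with
  | zero => simp
  | succ k ih =>
    have h1 := ih (by omega)
    have h2 : G.dist (p.getVert i) (p.getVert (i + (k + 1))) ≤ _ :=
      hG.dist_triangle (v := p.getVert (i + k))
    have h3 := dist_eq_one_iff_adj.mpr (p.adj_getVert_succ (i := i + k) (by omega))
    rw [← add_assoc] at *
    omega

lemma getVert_dist {u v : V} (p : G.Walk u v) (hG : G.Connected) (hp : p.length = G.dist u v)
    (i k : ℕ) (h : i + k ≤ p.length) : G.dist (p.getVert i) (p.getVert (i + k)) = k := by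
  have h1 := getVert_dist_le p hG i k h
  have h2 := getVert_dist_le p hG 0 i (by omega)
  have h3 := getVert_dist_le p hG (i + k) (p.length - (i + k)) (by omega)
  have h4 : i + k + (p.length - (i + k)) = p.length := by omega
  rw [h4, Walk.getVert_length] at h3
  rw [zero_add, Walk.getVert_zero] at h2
  have h5 : G.dist u v ≤ G.dist u (p.getVert i) + G.dist (p.getVert i) v := hG.dist_triangle
  have h6 : G.dist (p.getVert i) v ≤ G.dist (p.getVert i) (p.getVert (i + k)) +
    G.dist (p.getVert (i + k)) v := hG.dist_triangle
  omega

lemma getVert_dist_abs {u v : V} (p : G.Walk u v) (hG : G.Connected) (hp : p.length = G.dist u v)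
    (i j : ℕ) (hi : i ≤ p.length) (hj : j ≤ p.length) :
    G.dist (p.getVert i) (p.getVert j) = ((i : ℤ) - j).natAbs := by
  rcases le_total i j with h | h
  · have := getVert_dist p hG hp i (j - i) (by omega)
    rw [show i + (j - i) = j by omega] at this
    omega
  · have := getVert_dist p hG hp j (i - j) (by omega)
    rw [show j + (i - j) = i by omega, G.dist_comm] at this
    omega

lemma center_bound_s18 (hT : G.IsTree) {u v : V} (p : G.Walk u v) (hp : p.length = G.dist u v)
    (hd : 1 ≤ p.length)
    (hmax : ∀ x y, G.dist x y ≤ p.length) (w : V) :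
    G.dist w (p.getVert (p.length / 2)) + G.dist w (p.getVert (p.length - p.length / 2))
      ≤ p.length := by
  set i := p.length / 2 with hi
  set d := p.length with hdd
  have hA := getVert_dist_abs p hT.connected hp
  have e0 : p.getVert 0 = u := p.getVert_zero
  have e1 : p.getVert d = v := p.getVert_length
  have hadj := p.adj_getVert_succ (i := i) (by omega)
  have u1 := hA 0 i (by omega) (by omega)
  have u2 := hA 0 (i+1) (by omega) (by omega)
  have v1 := hA d i (by omega) (by omega)
  have v2 := hA d (i+1) (by omega) (by omega)
  rw [e0] at u1 u2
  rw [e1] at v1 v2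
  have m1 := hmax w u
  have m2 := hmax w v
  have hc := dist_cases hT hadj w
  have hpar : d - i = i ∨ (d - i = i + 1 ∧ d = 2 * i + 1) := by omega
  have h1 : G.dist w (p.getVert i) < G.dist w (p.getVert (i+1)) →
      G.dist w (p.getVert i) ≤ i := by
    intro h
    have := dist_across hT hadj h (v := v) (by omega)
    omega
  have h2 : G.dist w (p.getVert (i+1)) < G.dist w (p.getVert i) →
      G.dist w (p.getVert (i+1)) + 1 + i ≤ d := by
    intro h
    have := dist_across hT hadj.symm h (v := u) (by omega)
    omega
  rcases hpar with h | ⟨h, h'⟩ <;> rw [h] <;> omega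

lemma tree_bound [Fintype V] (hT : G.IsTree) {u v : V} (p : G.Walk u v)
    (hp : p.length = G.dist u v) (hd : 1 ≤ p.length)
    (hmax : ∀ x y, G.dist x y ≤ p.length) :
    Fintype.card V * (Fintype.card V - 1) ≤
      mostar G + (gSum p.length + (Fintype.card V - (p.length + 1)) * p.length) ∧
    p.length + 1 ≤ Fintype.card V := by
  set d := p.length with hdd
  have l1 := mostar_lower hT (p.getVert (d / 2))
  have l2 := mostar_lower hT (p.getVert (d - d / 2))
  have hinj : Set.InjOn p.getVert (Finset.range (d + 1)) := by
    intro a ha b hb h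
    simp only [Finset.coe_range, Set.mem_Iio] at ha hb
    have := getVert_dist_abs p hT.connected hp a b (by omega) (by omega)
    rw [h] at this
    simp at this
    omega
  set S := (Finset.range (d + 1)).image p.getVert with hS
  have hcard : S.card = d + 1 := by rw [Finset.card_image_of_injOn hinj, Finset.card_range]
  have hsum : ∑ w, (G.dist w (p.getVert (d / 2)) + G.dist w (p.getVert (d - d / 2)))
      ≤ gSum d + (Fintype.card V - (d + 1)) * d := by
    rw [← Finset.sum_add_sum_compl S]
    apply add_le_add
    · rw [hS, Finset.sum_image hinj]
      unfold gSum
      apply Finset.sum_le_sum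
      intro j hj
      rw [Finset.mem_range] at hj
      rw [getVert_dist_abs p hT.connected hp _ _ (by omega) (by omega),
        getVert_dist_abs p hT.connected hp _ _ (by omega) (by omega)]
      omega
    · rw [← hcard, ← Finset.card_compl, ← smul_eq_mul]
      apply Finset.sum_le_card_nsmul
      intro w _
      exact center_bound_s18 hT p hp hd hmax w
  rw [Finset.sum_add_distrib] at hsum
  refine ⟨by omega, ?_⟩
  rw [← hcard]
  exact Finset.card_le_univ S

end TreeLemmas

lemma path_dist (m : ℕ) (i j : Fin (m + 1)) :
    (pathGraph (m + 1)).dist i j = ((i : ℤ) - j).natAbs := by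
  apply le_antisymm
  · have h : ∀ k : ℕ, ∀ i j : Fin (m + 1), (i : ℕ) + k = j → (pathGraph (m + 1)).dist i j ≤ k := by
      intro k
      induction k with
      | zero =>
        intro i j h
        have : i = j := Fin.ext (by omega)
        simp [this]
      | succ k ih =>
        intro i j h
        have h1 := ih i ⟨i + k, by omega⟩ rfl
        have h2 : (pathGraph (m + 1)).dist (⟨i + k, by omega⟩ : Fin (m + 1)) j = 1 :=
          dist_eq_one_iff_adj.mpr (by rw [pathGraph_adj]; left; simp; omega)
        have h3 : (pathGraph (m + 1)).dist i j ≤ _ :=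
          (pathGraph_connected m).dist_triangle (v := ⟨i + k, by omega⟩)
        omega
    rcases le_total (i : ℕ) j with hij | hij
    · have := h (j - i) i j (by omega)
      omega
    · have := h (i - j) j i (by omega)
      rw [dist_comm] at this
      omega
  · obtain ⟨p, hp⟩ := (pathGraph_connected m).exists_walk_length_eq_dist i j
    rw [← hp]
    clear hp
    induction p with
    | nil => simp
    | cons h p ih =>
      rw [pathGraph_adj] at h
      rw [Walk.length_cons]
      omega

lemma path_edges (m : ℕ) : (pathGraph (m + 2)).edgeFinset ⊆
    (Finset.univ : Finset (Fin (m + 1))).image (fun i => s(i.castSucc, i.succ)) := by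
  intro e
  induction e using Sym2.ind with
  | _ u v =>
  intro h
  have h : (pathGraph (m + 2)).Adj u v := by simpa using h
  rw [pathGraph_adj] at h
  rw [Finset.mem_image]
  rcases h with h | h
  · refine ⟨⟨u, by omega⟩, Finset.mem_univ _, ?_⟩
    congr 2
    exact Fin.ext (by simpa using h)
  · refine ⟨⟨v, by omega⟩, Finset.mem_univ _, ?_⟩
    rw [Sym2.eq_swap]
    congr 2
    exact Fin.ext (by simpa using h)

lemma path_isTree (m : ℕ) : (pathGraph (m + 2)).IsTree := by
  have hc : (pathGraph (m + 2)).Connected := pathGraph_connected (m + 1)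
  rw [isTree_iff_connected_and_card]
  refine ⟨hc, ?_⟩
  have h1 := hc.card_vert_le_card_edgeSet_add_one
  have h2 := Finset.card_le_card (path_edges m)
  have h3 := h2.trans Finset.card_image_le
  simp only [Finset.card_univ, Fintype.card_fin] at h3
  have h4 : Nat.card (pathGraph (m + 2)).edgeSet = (pathGraph (m + 2)).edgeFinset.card := by
    rw [Nat.card_eq_fintype_card, edgeFinset_card]
  simp only [Nat.card_eq_fintype_card (α := Fin (m + 2)), Fintype.card_fin] at *
  omega

lemma path_mostar (m : ℕ) : mostar (pathGraph (m + 2)) ≤ gSum m := by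
  unfold mostar
  refine (Finset.sum_le_sum_of_subset (path_edges m)).trans ?_
  refine (Finset.sum_image_le_of_nonneg (by simp)).trans ?_
  unfold gSum
  rw [Finset.sum_range]
  apply Finset.sum_le_sum
  intro i _
  have hpd := path_dist (m + 1)
  simp only [mostarPsi, Sym2.lift_mk]
  have e1 : (Finset.univ.filter fun w => (pathGraph (m + 2)).dist w i.castSucc <
      (pathGraph (m + 2)).dist w i.succ) = Finset.Iic i.castSucc := by
    ext w
    simp only [Finset.mem_filter, Finset.mem_univ, true_and, Finset.mem_Iic, hpd,
      Fin.le_def, Fin.val_castSucc, Fin.val_succ]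
    omega
  have e2 : (Finset.univ.filter fun w => (pathGraph (m + 2)).dist w i.succ <
      (pathGraph (m + 2)).dist w i.castSucc) = Finset.Ici i.succ := by
    ext w
    simp only [Finset.mem_filter, Finset.mem_univ, true_and, Finset.mem_Ici, hpd,
      Fin.le_def, Fin.val_castSucc, Fin.val_succ]
    omega
  rw [e1, e2, Fin.card_Iic, Fin.card_Ici]
  simp only [Fin.val_castSucc, Fin.val_succ]
  omega

lemma path_degree (m : ℕ) (v : Fin (m + 2)) : (pathGraph (m + 2)).degree v =
    (if (v : ℕ) = 0 then 0 else 1) + (if (v : ℕ) = m + 1 then 0 else 1) := by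
  have hv := v.2
  rw [← card_neighborFinset_eq_degree]
  by_cases h0 : (v : ℕ) = 0
  · have : (pathGraph (m + 2)).neighborFinset v = {⟨1, by omega⟩} := by
      ext w
      simp only [mem_neighborFinset, pathGraph_adj, Finset.mem_singleton, Fin.ext_iff]
      omega
    rw [this, Finset.card_singleton, if_pos h0, if_neg (by omega)]
  · by_cases h1 : (v : ℕ) = m + 1
    · have : (pathGraph (m + 2)).neighborFinset v = {⟨m, by omega⟩} := by
        ext w
        simp only [mem_neighborFinset, pathGraph_adj, Finset.mem_singleton, Fin.ext_iff]
        omega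
      rw [this, Finset.card_singleton, if_pos h1, if_neg (by omega)]
    · have : (pathGraph (m + 2)).neighborFinset v = {⟨v - 1, by omega⟩, ⟨v + 1, by omega⟩} := by
        ext w
        simp only [mem_neighborFinset, pathGraph_adj, Finset.mem_singleton, Finset.mem_insert,
          Fin.ext_iff]
        omega
      rw [this, Finset.card_pair (by simp [Fin.ext_iff]), if_neg h1, if_neg h0]

lemma path_count (m r : ℕ) (hr : 1 ≤ r) (hrm : r ≤ m) :
    pendentPathCount (pathGraph (m + 2)) r = 2 := by
  unfold pendentPathCount
  rw [Nat.card_eq_two_iff]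
  refine ⟨⟨fun i => ⟨i, by omega⟩, ?_, ?_, ?_, ?_, ?_⟩,
    ⟨fun i => ⟨m + 1 - i, by omega⟩, ?_, ?_, ?_, ?_, ?_⟩, ?_, ?_⟩
  · intro a b h
    simpa [Fin.ext_iff] using h
  · intro i
    simp [pathGraph_adj]
  · rw [path_degree]; simp
  · rw [path_degree]
    simp only [Fin.val_last]
    rw [if_neg (by omega), if_neg (by omega)]
  · intro i h0 h1
    have hi := i.2
    simp only [ne_eq, Fin.ext_iff, Fin.val_zero, Fin.val_last] at h0 h1
    rw [path_degree]
    simp only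
    rw [if_neg (by omega), if_neg (by omega)]
  · intro a b h
    have ha := a.2
    have hb := b.2
    simp only [Fin.ext_iff] at h ⊢
    omega
  · intro i
    have hi := i.2
    simp only [pathGraph_adj, Fin.val_castSucc, Fin.val_succ]
    omega
  · rw [path_degree]; simp
  · rw [path_degree]
    simp only [Fin.val_last]
    rw [if_neg (by omega), if_neg (by omega)]
  · intro i h0 h1
    have hi := i.2
    simp only [ne_eq, Fin.ext_iff, Fin.val_zero, Fin.val_last] at h0 h1
    rw [path_degree]
    simp only
    rw [if_neg (by omega), if_neg (by omega)]
  · intro h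
    have := congrArg (fun f => ((f.1 0 : Fin (m + 2)) : ℕ)) h
    simp at this
  · rw [Set.eq_univ_iff_forall]
    rintro ⟨f, hinj, hadj, hdeg, -, -⟩
    have hadj' : ∀ k (hk : k < r), (f ⟨k, by omega⟩ : ℕ) + 1 = f ⟨k + 1, by omega⟩ ∨
        (f ⟨k + 1, by omega⟩ : ℕ) + 1 = f ⟨k, by omega⟩ := by
      intro k hk
      have := hadj ⟨k, hk⟩
      rwa [pathGraph_adj] at this
    have hinj' : ∀ k (hk : k + 2 < r + 1),
        (f ⟨k, by omega⟩ : ℕ) ≠ f ⟨k + 2, by omega⟩ := by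
      intro k hk h
      have := hinj (Fin.ext h)
      simp [Fin.ext_iff] at this
    rw [path_degree] at hdeg
    have h0 : (f 0 : ℕ) = 0 ∨ (f 0 : ℕ) = m + 1 := by
      by_contra hcon
      rw [not_or] at hcon
      rw [if_neg hcon.1, if_neg hcon.2] at hdeg
      omega
    simp only [Set.mem_insert_iff, Set.mem_singleton_iff, Subtype.mk.injEq]
    have h00 : f 0 = f ⟨0, by omega⟩ := rfl
    rw [h00] at h0
    rcases h0 with h0 | h0
    · left
      have key : ∀ k (hk : k < r), (f ⟨k, by omega⟩ : ℕ) = k ∧ (f ⟨k + 1, by omega⟩ : ℕ) = k + 1 := by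
        intro k
        induction k with
        | zero =>
          intro hk
          have := hadj' 0 hk
          simp only [zero_add] at *
          omega
        | succ k ih =>
          intro hk
          have h1 := ih (by omega)
          have h2 := hadj' (k + 1) hk
          have h3 := hinj' k (by omega)
          simp only [add_assoc, Nat.reduceAdd] at *
          omega
      funext i
      apply Fin.ext
      rcases i with ⟨k, hk⟩
      rcases k with _ | k
      · exact h0
      · exact (key k (by omega)).2
    · right
      have key : ∀ k (hk : k < r), (f ⟨k, by omega⟩ : ℕ) = m + 1 - k ∧
          (f ⟨k + 1, by omega⟩ : ℕ) = m + 1 - (k + 1) := by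
        intro k
        induction k with
        | zero =>
          intro hk
          have := hadj' 0 hk
          have := (f ⟨1, by omega⟩).2
          simp only [zero_add] at *
          omega
        | succ k ih =>
          intro hk
          have h1 := ih (by omega)
          have h2 := hadj' (k + 1) hk
          have h3 := hinj' k (by omega)
          simp only [add_assoc, Nat.reduceAdd] at *
          omega
      funext i
      apply Fin.ext
      rcases i with ⟨k, hk⟩
      rcases k with _ | k
      · exact h0
      · exact (key k (by omega)).2

lemma tree_path_iso (m : ℕ) (T : SimpleGraph (Fin (m + 2))) (hT : T.IsTree)
    (h : mostar T ≤ gSum m) : Nonempty (T ≃g pathGraph (m + 2)) := by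
  obtain ⟨u, v, huv⟩ := T.exists_dist_eq_diam
  obtain ⟨p, hp⟩ := hT.connected.exists_walk_length_eq_dist u v
  have hne := connected_iff_ediam_ne_top.mp hT.connected
  have hmax : ∀ x y, T.dist x y ≤ p.length := by
    intro x y
    rw [hp, huv]
    exact dist_le_diam hne
  have hd : 1 ≤ p.length := by
    have h1 := hT.connected.pos_dist_of_ne (u := (0 : Fin (m + 2))) (v := 1) (by simp)
    exact h1.trans_le (hmax _ _)
  obtain ⟨h1, h2⟩ := tree_bound hT p hp hd hmax
  rw [Fintype.card_fin] at h1 h2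
  have hA := getVert_dist_abs p hT.connected hp
  have hlen : p.length = m + 1 := by
    by_contra hcon
    obtain ⟨k, hk⟩ : ∃ k, m = p.length + k := ⟨m - p.length, by omega⟩
    have g1 := gSum_le p.length
    have g2 := gSum_le m
    generalize p.length = d at *
    subst hk
    rw [show d + k + 2 - (d + 1) = k + 1 by omega, show d + k + 2 - 1 = d + k + 1 by omega] at h1
    nlinarith
  have hinj : Function.Injective (fun i : Fin (m + 2) => p.getVert i) := by
    intro a b hab
    have := hA a b (by omega) (by omega)
    simp only at hab
    rw [hab, dist_self] at this
    exact Fin.ext (by omega)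
  have hbij := Finite.injective_iff_bijective.mp hinj
  refine ⟨(RelIso.symm ⟨Equiv.ofBijective _ hbij, ?_⟩ : T ≃g pathGraph (m + 2))⟩
  intro a b
  simp only [Equiv.ofBijective_apply]
  rw [← dist_eq_one_iff_adj, hA a b (by omega) (by omega), pathGraph_adj]
  omega

/-- the tree minimizing the Mostar index among trees of order n with exactly
two pendent paths of length r (1 ≤ r ≤ n-2) is the path P_n. -/
theorem min_mostar_two_pendent_paths (n r : ℕ) (hr : 1 ≤ r) (hrn : r ≤ n - 2) (hn : 2 ≤ n)
    (T : SimpleGraph (Fin n)) (hT : T.IsTree) (hpp : pendentPathCount T r = 2)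
    (hmin : ∀ T' : SimpleGraph (Fin n), T'.IsTree → pendentPathCount T' r = 2 →
      mostar T ≤ mostar T') :
    Nonempty (T ≃g SimpleGraph.pathGraph n) := by
  obtain ⟨m, rfl⟩ : ∃ m, n = m + 2 := ⟨n - 2, by omega⟩
  exact tree_path_iso m T hT
    ((hmin _ (path_isTree m) (path_count m r hr (by omega))).trans (path_mostar m))
end

section
/- Let n, r, k be integers with k ≥ 3 and 1 ≤ r ≤ (n−2)/k, and let T be a tree of order n with exactly k pendent paths of length r that has the minimum Mostar index among all such trees. Then T is isomorphic to A^r_{n,⌈k/2⌉,⌊k/2⌋}. -/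
open Finset SimpleGraph

open scoped Classical

namespace Mst

variable {V : Type*} [Fintype V]

/-- Vertices strictly closer to `u` than to `v`. -/
noncomputable def side (G : SimpleGraph V) (u v : V) : Finset V :=
  Finset.univ.filter fun w => G.dist w u < G.dist w v

/-- The smaller of the two sides of an edge. -/
noncomputable def sz (G : SimpleGraph V) : Sym2 V → ℕ :=
  Sym2.lift ⟨fun u v => min (side G u v).card (side G v u).card,
    fun _ _ => min_comm _ _⟩

/-- Number of edges with both sides of size at least `t`. -/
noncomputable def cnt (G : SimpleGraph V) (t : ℕ) : ℕ :=
  (G.edgeFinset.filter fun e => t ≤ sz G e).card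

lemma mem_side {G : SimpleGraph V} {u v w : V} :
    w ∈ side G u v ↔ G.dist w u < G.dist w v := by
  simp [side]

lemma cut_walk {G : SimpleGraph V} (hG : G.Connected) (S : Finset V) (u v : V)
    (hc : ∀ a b, a ∈ S → b ∉ S → G.Adj a b → a = u ∧ b = v) {w z : V} (p : G.Walk w z) :
    w ∈ S → z ∉ S → G.dist w u + 1 + G.dist v z ≤ p.length := by
  induction p with
  | nil => intro h1 h2; exact absurd h1 h2
  | @cons a b c h p ih =>
    intro h1 h2
    rw [Walk.length_cons]
    by_cases hb : b ∈ S
    · have := ih hb h2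
      have h3 : G.dist a u ≤ G.dist a b + G.dist b u := hG.dist_triangle
      have h4 : G.dist a b = 1 := SimpleGraph.dist_eq_one_iff_adj.2 h
      omega
    · obtain ⟨rfl, rfl⟩ := hc a b h1 hb h
      have := SimpleGraph.dist_le p
      simp
      omega

lemma cut_dist {G : SimpleGraph V} (hG : G.Connected) (S : Finset V) (u v : V)
    (hc : ∀ a b, a ∈ S → b ∉ S → G.Adj a b → a = u ∧ b = v) {w z : V} 
    (h1 : w ∈ S) (h2 : z ∉ S) : G.dist w u + 1 + G.dist v z ≤ G.dist w z := by
  obtain ⟨p, hp⟩ := hG.exists_walk_length_eq_dist w z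
  rw [← hp]
  exact cut_walk hG S u v hc p h1 h2

lemma side_of_cut {G : SimpleGraph V} (hG : G.Connected) (S : Finset V) (u v : V)
    (hc : ∀ a b, a ∈ S → b ∉ S → G.Adj a b → a = u ∧ b = v) (hu : u ∈ S) (hv : v ∉ S) :
    side G u v = S ∧ side G v u = Sᶜ := by
  have A : ∀ w ∈ S, G.dist w u < G.dist w v := fun w hw => by
    have := cut_dist hG S u v hc hw hv
    omega
  have B : ∀ w, w ∉ S → G.dist w v < G.dist w u := fun w hw => by
    have := cut_dist hG S u v hc hu hw
    rw [G.dist_comm (u := w) (v := v), G.dist_comm (u := w) (v := u)]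
    simp at this
    omega
  constructor
  · ext w
    rw [mem_side]
    by_cases h : w ∈ S
    · simp [h, A w h]
    · have := B w h
      simp [h]; omega
  · ext w
    rw [mem_side, Finset.mem_compl]
    by_cases h : w ∈ S
    · have := A w h
      simp [h]; omega
    · simp [h, B w h]

lemma tree_cut {G : SimpleGraph V} (hT : G.IsTree) {x y : V} (h : G.Adj x y) :
    ∃ S : Finset V, x ∈ S ∧ y ∉ S ∧ (∀ a b, a ∈ S → b ∉ S → G.Adj a b → a = x ∧ b = y) := by
  have hb : G.IsBridge s(x, y) := (SimpleGraph.isAcyclic_iff_forall_adj_isBridge.1 hT.isAcyclic) h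
  have hb := (SimpleGraph.isBridge_iff.1 hb)
  refine ⟨Finset.univ.filter fun w => (G.deleteEdges {s(x, y)}).Reachable x w, by simp, ?_, ?_⟩
  · simpa using hb
  · intro a b ha hb' hab
    simp only [Finset.mem_filter, Finset.mem_univ, true_and] at ha hb'
    by_cases he : s(a, b) = s(x, y)
    · rcases Sym2.eq_iff.1 he with ⟨h1, h2⟩ | ⟨h1, h2⟩
      · exact ⟨h1, h2⟩
      · subst h1; exact absurd ha (by simpa using hb)
    · exfalso
      apply hb'
      refine ha.trans (SimpleGraph.Adj.reachable ?_)
      rw [SimpleGraph.deleteEdges_adj]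
      exact ⟨hab, by simpa using he⟩

lemma side_cross {G : SimpleGraph V} (hT : G.IsTree) {x y a b : V} (h : G.Adj x y)
    (ha : a ∈ side G x y) (hb : b ∉ side G x y) (hab : G.Adj a b) : a = x ∧ b = y := by
  obtain ⟨S, h1, h2, h3⟩ := tree_cut hT h
  rw [(side_of_cut hT.connected S x y h3 h1 h2).1] at ha hb
  exact h3 a b ha hb hab

lemma side_compl {G : SimpleGraph V} (hT : G.IsTree) {x y : V} (h : G.Adj x y) :
    side G y x = (side G x y)ᶜ := by
  obtain ⟨S, h1, h2, h3⟩ := tree_cut hT h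
  obtain ⟨h4, h5⟩ := side_of_cut hT.connected S x y h3 h1 h2
  rw [h4, h5]

lemma side_dist {G : SimpleGraph V} (hT : G.IsTree) {x y w z : V} (h : G.Adj x y)
    (hw : w ∈ side G x y) (hz : z ∉ side G x y) :
    G.dist w x + 1 + G.dist y z ≤ G.dist w z :=
  cut_dist hT.connected _ x y (fun _ _ ha hb hab => side_cross hT h ha hb hab) hw hz

lemma left_mem_side {G : SimpleGraph V} {x y : V} (h : G.Adj x y) : x ∈ side G x y := by
  rw [mem_side, SimpleGraph.dist_self, SimpleGraph.dist_eq_one_iff_adj.2 h]; omega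

lemma right_notMem_side {G : SimpleGraph V} {x y : V} : y ∉ side G x y := by
  rw [mem_side, SimpleGraph.dist_self]; omega

lemma card_side_add {G : SimpleGraph V} (hT : G.IsTree) {x y : V} (h : G.Adj x y) :
    (side G x y).card + (side G y x).card = Fintype.card V := by
  rw [side_compl hT h, Finset.card_add_card_compl]

lemma exists_next {G : SimpleGraph V} (hG : G.Connected) {c w : V} (h : w ≠ c) :
    ∃ w', G.Adj w w' ∧ G.dist w c = G.dist w' c + 1 := by
  obtain ⟨p, hp⟩ := hG.exists_walk_length_eq_dist w c
  cases p with
  | nil => exact absurd rfl h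
  | @cons _ b _ hab q =>
    refine ⟨b, hab, ?_⟩
    have h1 := SimpleGraph.dist_le q
    have h3 : G.dist w c ≤ G.dist w b + G.dist b c := hG.dist_triangle
    have h4 : G.dist w b = 1 := SimpleGraph.dist_eq_one_iff_adj.2 hab
    rw [Walk.length_cons] at hp
    omega

lemma dist_adj {G : SimpleGraph V} (hT : G.IsTree) {c w w' : V} (h : G.Adj w w') :
    G.dist w c = G.dist w' c + 1 ∨ G.dist w' c = G.dist w c + 1 := by
  by_cases hc : c ∈ side G w w'
  · have := side_dist hT h hc right_notMem_side
    have h4 : G.dist w w' = 1 := SimpleGraph.dist_eq_one_iff_adj.2 h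
    have h3 : G.dist w' c ≤ G.dist w' w + G.dist w c := hT.connected.dist_triangle
    rw [G.dist_comm (u := w') (v := w), h4] at h3
    rw [SimpleGraph.dist_self, G.dist_comm (u := c), G.dist_comm (u := c)] at this
    right; omega
  · have := side_dist hT h (left_mem_side h) hc
    have h4 : G.dist w w' = 1 := SimpleGraph.dist_eq_one_iff_adj.2 h
    have h3 : G.dist w c ≤ G.dist w w' + G.dist w' c := hT.connected.dist_triangle
    rw [SimpleGraph.dist_self] at this
    left; omega

lemma next_unique {G : SimpleGraph V} (hT : G.IsTree) {c w a b : V} (ha : G.Adj w a)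
    (hb : G.Adj w b) (hda : G.dist a c < G.dist w c) (hdb : G.dist b c < G.dist w c) : a = b := by
  by_contra hne
  have hc : c ∉ side G w a := by
    rw [mem_side, G.dist_comm, G.dist_comm (u := c)]; omega
  have hbm : b ∈ side G w a := by
    by_contra h
    exact hne (side_cross hT ha (left_mem_side ha) h hb).2.symm
  have := side_dist hT ha hbm hc
  have h4 : G.dist w c ≤ G.dist w a + G.dist a c := hT.connected.dist_triangle
  have h5 : G.dist w a = 1 := SimpleGraph.dist_eq_one_iff_adj.2 ha
  omega

/-- If an edge is not inside a side, then that side lies on one side of the edge. -/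
lemma laminar {G : SimpleGraph V} (hT : G.IsTree) {u v x y : V} (h : G.Adj u v) (hxy : G.Adj x y)
    (hn : ¬ (x ∈ side G u v ∧ y ∈ side G u v)) :
    side G u v ⊆ side G x y ∨ side G u v ⊆ side G y x := by
  have key : ∀ d w, w ∈ side G u v → G.dist w u = d → (w ∈ side G x y ↔ u ∈ side G x y) := by
    intro d
    induction d with
    | zero =>
      intro w hw hd
      rw [hT.connected.dist_eq_zero_iff] at hd
      rw [hd]
    | succ d ih =>
      intro w hw hd
      have hne : w ≠ u := by rintro rfl; simp at hd
      obtain ⟨w', h1, h2⟩ := exists_next hT.connected hne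
      have hw' : w' ∈ side G u v := by
        by_contra h'
        exact hne (side_cross hT h hw h' h1).1
      rw [← ih w' hw' (by omega)]
      constructor
      · intro h3
        by_contra h4
        obtain ⟨rfl, rfl⟩ := side_cross hT hxy h3 h4 h1
        exact hn ⟨hw, hw'⟩
      · intro h3
        by_contra h4
        obtain ⟨rfl, rfl⟩ := side_cross hT hxy h3 h4 h1.symm
        exact hn ⟨hw', hw⟩
  by_cases hu : u ∈ side G x y
  · left
    intro w hw
    exact (key _ w hw rfl).2 hu
  · right
    intro w hw
    rw [side_compl hT hxy, Finset.mem_compl, key _ w hw rfl]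
    exact hu

lemma sz_mk {G : SimpleGraph V} (u v : V) :
    sz G s(u, v) = min (side G u v).card (side G v u).card := rfl

lemma psi_eq {G : SimpleGraph V} (hT : G.IsTree) (e : Sym2 V) (he : e ∈ G.edgeFinset) :
    mostarPsi G e + 2 * sz G e = Fintype.card V := by
  induction e with
  | _ u v =>
  have h : G.Adj u v := by simpa using he
  have := card_side_add hT h
  rw [sz_mk]
  change (((side G u v).card : ℤ) - ((side G v u).card : ℤ)).natAbs + _ = _
  omega

lemma sz_le {G : SimpleGraph V} (hT : G.IsTree) (e : Sym2 V) (he : e ∈ G.edgeFinset) :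
    sz G e ≤ Fintype.card V := by
  have := psi_eq hT e he
  omega

lemma sum_sz {G : SimpleGraph V} (hT : G.IsTree) :
    ∑ e ∈ G.edgeFinset, sz G e = ∑ t ∈ Finset.Icc 1 (Fintype.card V), cnt G t := by
  simp only [cnt, Finset.card_filter]
  rw [Finset.sum_comm]
  refine Finset.sum_congr rfl fun e he => ?_
  have h := sz_le hT e he
  rw [← Finset.card_filter]
  have : (Finset.Icc 1 (Fintype.card V)).filter (fun t => t ≤ sz G e) = Finset.Icc 1 (sz G e) := by
    ext t; simp; omega
  rw [this]; simp

lemma mostar_eq {G : SimpleGraph V} (hT : G.IsTree) :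
    mostar G + 2 * ∑ t ∈ Finset.Icc 1 (Fintype.card V), cnt G t =
      (Fintype.card V - 1) * Fintype.card V := by
  rw [← sum_sz hT, mostar, Finset.mul_sum, ← Finset.sum_add_distrib,
    Finset.sum_congr rfl (fun e he => psi_eq hT e he), Finset.sum_const, smul_eq_mul]
  have := hT.card_edgeFinset
  congr 1
  omega

/-- The neighbour of `w` towards `c`. -/
noncomputable def nxt (G : SimpleGraph V) (c w : V) : V :=
  if h : ∃ w', G.Adj w w' ∧ G.dist w c = G.dist w' c + 1 then h.choose else w

lemma nxt_spec {G : SimpleGraph V} (hG : G.Connected) {c w : V} (h : w ≠ c) :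
    G.Adj w (nxt G c w) ∧ G.dist w c = G.dist (nxt G c w) c + 1 := by
  have h1 := exists_next hG h
  rw [nxt, dif_pos h1]
  exact h1.choose_spec

lemma nxt_eq {G : SimpleGraph V} (hT : G.IsTree) {c w a : V} (h : w ≠ c) (ha : G.Adj w a)
    (hd : G.dist a c < G.dist w c) : nxt G c w = a := by
  have := nxt_spec hT.connected h
  exact next_unique hT this.1 ha (by omega) hd

lemma cnt_add {G : SimpleGraph V} (hT : G.IsTree) (c : V) (t : ℕ) :
    cnt G t + ((Finset.univ.erase c).filter fun w => ¬ t ≤ sz G s(w, nxt G c w)).card + 1 =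
      Fintype.card V := by
  have hinj : Set.InjOn (fun w => s(w, nxt G c w)) (Finset.univ.erase c : Finset V) := by
    intro a ha b hb hab
    simp only [Finset.coe_erase, Finset.coe_univ, Set.mem_sdiff, Set.mem_univ, true_and, Set.mem_singleton_iff] at ha hb
    rcases Sym2.eq_iff.1 hab with h | h
    · exact h.1
    · have h1 := (nxt_spec hT.connected ha).2
      have h2 := (nxt_spec hT.connected hb).2
      rw [h.2] at h1
      rw [← h.1] at h2
      omega
  have him : (Finset.univ.erase c).image (fun w => s(w, nxt G c w)) = G.edgeFinset := by
    apply Finset.eq_of_subset_of_card_le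
    · intro e he
      simp only [Finset.mem_image, Finset.mem_erase, Finset.mem_univ, and_true] at he
      obtain ⟨w, hw, rfl⟩ := he
      simpa using (nxt_spec hT.connected hw).1
    · rw [Finset.card_image_of_injOn hinj, Finset.card_erase_of_mem (Finset.mem_univ _)]
      have := hT.card_edgeFinset
      simp only [Finset.card_univ]
      omega
  have h1 : cnt G t = ((Finset.univ.erase c).filter fun w => t ≤ sz G s(w, nxt G c w)).card := by
    rw [cnt, ← him, Finset.filter_image, Finset.card_image_of_injOn]
    exact hinj.mono (by intro x; simp; tauto)
  have h2 := Finset.card_filter_add_card_filter_not (s := Finset.univ.erase c) (fun w => t ≤ sz G s(w, nxt G c w))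
  rw [Finset.card_erase_of_mem (Finset.mem_univ _), Finset.card_univ] at h2
  have : 0 < Fintype.card V := Fintype.card_pos_iff.2 ⟨c⟩
  omega

/-- Minimal good side inside `W`. -/
lemma exists_min_side {G : SimpleGraph V} (hT : G.IsTree) (t : ℕ) (W : Finset V)
    (h : ∃ u v, G.Adj u v ∧ t ≤ (side G u v).card ∧ t ≤ (side G v u).card ∧ side G u v ⊆ W) :
    ∃ u v, G.Adj u v ∧ t ≤ (side G u v).card ∧ t ≤ (side G v u).card ∧ side G u v ⊆ W ∧
      ∀ x y, G.Adj x y → x ∈ side G u v → y ∈ side G u v → ¬ t ≤ sz G s(x, y) := by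
  obtain ⟨u0, v0, h0⟩ := h
  let F : Finset (V × V) := Finset.univ.filter fun p =>
    G.Adj p.1 p.2 ∧ t ≤ (side G p.1 p.2).card ∧ t ≤ (side G p.2 p.1).card ∧ side G p.1 p.2 ⊆ W
  have hF : F.Nonempty := ⟨(u0, v0), by simpa [F] using h0⟩
  obtain ⟨⟨u, v⟩, hm, hmin⟩ := Finset.exists_min_image F (fun p => (side G p.1 p.2).card) hF
  simp only [F, Finset.mem_filter, Finset.mem_univ, true_and] at hm hmin
  obtain ⟨h1, h2, h3, h4⟩ := hm
  refine ⟨u, v, h1, h2, h3, h4, ?_⟩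
  have aux : ∀ x y, G.Adj x y → x ∈ side G u v → y ∈ side G u v → t ≤ sz G s(x, y) →
      side G v u ⊆ side G x y → False := by
    intro x y hxy hx hy ht hs
    rw [sz_mk, le_min_iff] at ht
    have hsub : side G y x ⊂ side G u v := by
      rw [Finset.ssubset_iff_of_subset]
      · exact ⟨x, hx, right_notMem_side⟩
      · rw [side_compl hT hxy, side_compl hT h1.symm]
        exact Finset.compl_subset_compl.2 hs
    have := hmin (y, x) ⟨hxy.symm, ht.2, ht.1, hsub.1.trans h4⟩
    have h5 := Finset.card_lt_card hsub
    simp only at this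
    omega
  intro x y hxy hx hy ht
  have hx' : x ∉ side G v u := by rw [side_compl hT h1]; simpa using hx
  rcases laminar hT h1.symm hxy (fun h => hx' h.1) with h | h
  · exact aux x y hxy hx hy ht h
  · exact aux y x hxy.symm hy hx (by rwa [Sym2.eq_swap]) h


end Mst

namespace Mst

variable {V : Type*} [Fintype V]

/-- A family of pendent paths of length `r`. -/
structure Legs {ι : Type*} (G : SimpleGraph V) (r : ℕ) (leg : ι → ℕ → V) : Prop where
  adj : ∀ P i, i < r → G.Adj (leg P i) (leg P (i + 1))
  inj : ∀ P i j, i ≤ r → j ≤ r → leg P i = leg P j → i = j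
  n0 : ∀ P b, G.Adj (leg P 0) b → b = leg P 1
  n2 : ∀ P i b, 0 < i → i < r → G.Adj (leg P i) b → b = leg P (i - 1) ∨ b = leg P (i + 1)
  det : ∀ P Q, leg P 0 = leg Q 0 → P = Q
  pos : 0 < r
  small : 2 * r < Fintype.card V

section
variable {ι : Type*} [Fintype ι] {G : SimpleGraph V} {r : ℕ} {leg : ι → ℕ → V}

/-- Initial segment of a leg. -/
noncomputable def lset (leg : ι → ℕ → V) (P : ι) (i : ℕ) : Finset V := (Finset.range i).image (leg P)

lemma mem_lset {P : ι} {i : ℕ} {v : V} : v ∈ lset leg P i ↔ ∃ j < i, leg P j = v := by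
  simp [lset]

lemma card_lset (L : Legs G r leg) (P : ι) {i : ℕ} (hi : i ≤ r) : (lset leg P i).card = i := by
  rw [lset, Finset.card_image_of_injOn, Finset.card_range]
  intro a ha b hb hab
  simp at ha hb
  exact L.inj P a b (by omega) (by omega) hab

lemma side_leg (hT : G.IsTree) (L : Legs G r leg) (P : ι) {i : ℕ} (hi : i < r) :
    side G (leg P i) (leg P (i + 1)) = lset leg P (i + 1) := by
  refine (side_of_cut hT.connected _ _ _ ?_ ?_ ?_).1
  · intro a b ha hb hab
    obtain ⟨j, hj, rfl⟩ := mem_lset.1 ha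
    have hb' : ∀ j' < i + 1, leg P j' ≠ b := fun j' h1 h2 => hb (mem_lset.2 ⟨j', h1, h2⟩)
    rcases Nat.eq_zero_or_pos j with rfl | hj0
    · have := L.n0 P b hab
      rcases Nat.eq_zero_or_pos i with rfl | hi0
      · exact ⟨rfl, this⟩
      · exact absurd this.symm (hb' 1 (by omega))
    · rcases L.n2 P j b hj0 (by omega) hab with h | h
      · exact absurd h.symm (hb' _ (by omega))
      · have : j = i := by
          by_contra hne
          exact absurd h.symm (hb' _ (by omega))
        subst this
        exact ⟨rfl, h⟩
  · exact mem_lset.2 ⟨i, by omega, rfl⟩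
  · intro h
    obtain ⟨j, hj, h⟩ := mem_lset.1 h
    have := L.inj P _ _ (by omega) (by omega) h
    omega

lemma side_leg_last (hT : G.IsTree) (L : Legs G r leg) (P : ι) :
    side G (leg P (r - 1)) (leg P r) = lset leg P r := by
  have := side_leg hT L P (i := r - 1) (by have := L.pos; omega)
  rwa [Nat.sub_add_cancel L.pos] at this

lemma adj_leg_last (L : Legs G r leg) (P : ι) : G.Adj (leg P (r - 1)) (leg P r) := by
  have := L.adj P (r - 1) (by have := L.pos; omega)
  rwa [Nat.sub_add_cancel L.pos] at this

/-- Either of the four alternatives for two sides. -/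
lemma four (hT : G.IsTree) {u v x y : V} (h : G.Adj u v) (hxy : G.Adj x y) :
    side G u v ⊆ side G x y ∨ side G x y ⊆ side G u v ∨ Disjoint (side G u v) (side G x y) ∨
      side G u v ∪ side G x y = Finset.univ := by
  by_cases hn : x ∈ side G u v ∧ y ∈ side G u v
  · have hn' : ¬ (x ∈ side G v u ∧ y ∈ side G v u) := by
      rw [side_compl hT h]; simp; tauto
    rcases laminar hT h.symm hxy hn' with h1 | h1
    · right; right; right
      rw [side_compl hT h] at h1
      ext w
      have := @h1 w
      simp at this ⊢
      tauto
    · right; left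
      rw [side_compl hT h, side_compl hT hxy] at h1
      exact Finset.compl_subset_compl.1 h1
  · rcases laminar hT h hxy hn with h1 | h1
    · left; exact h1
    · right; right; left
      rw [side_compl hT hxy] at h1
      rw [Finset.disjoint_left]
      intro w hw
      simpa using h1 hw

lemma leg_deg (L : Legs G r leg) (P Q : ι) (j : ℕ) (hj : j < r) (h : leg P 0 = leg Q j) :
    P = Q := by
  rcases Nat.eq_zero_or_pos j with rfl | h0
  · exact L.det P Q h
  · exfalso
    have h1 := L.adj Q j hj
    have h2 := (L.adj Q (j - 1) (by omega)).symm
    rw [Nat.sub_add_cancel h0] at h2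
    rw [← h] at h1 h2
    have := L.inj Q (j + 1) (j - 1) (by omega) (by omega) ((L.n0 P _ h1).trans (L.n0 P _ h2).symm)
    omega

lemma disj_legs (hT : G.IsTree) (L : Legs G r leg) {P Q : ι} (hPQ : P ≠ Q) :
    Disjoint (lset leg P r) (lset leg Q r) := by
  have key : ∀ P Q : ι, lset leg P r ⊆ lset leg Q r → P = Q := by
    intro P Q h
    have : leg P 0 ∈ lset leg Q r := h (mem_lset.2 ⟨0, L.pos, rfl⟩)
    obtain ⟨j, hj, h1⟩ := mem_lset.1 this
    exact leg_deg L P Q j hj h1.symm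
  rcases four hT (adj_leg_last L P) (adj_leg_last L Q) with h | h | h | h <;>
    rw [side_leg_last hT L, side_leg_last hT L] at h
  · exact absurd (key _ _ h) hPQ
  · exact absurd (key _ _ h).symm hPQ
  · exact h
  · exfalso
    have h1 := Finset.card_union_le (lset leg P r) (lset leg Q r)
    rw [h, card_lset L P le_rfl, card_lset L Q le_rfl, Finset.card_univ] at h1
    have := L.small
    omega

lemma attach_core (hT : G.IsTree) (L : Legs G r leg) (P Q : ι) : leg P r ∉ lset leg Q r := by
  intro h
  by_cases hPQ : P = Q
  · subst hPQ
    obtain ⟨j, hj, h⟩ := mem_lset.1 h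
    have := L.inj P _ _ (by omega) (by omega) h
    omega
  · have h1 : leg P (r - 1) ∈ lset leg P r := mem_lset.2 ⟨r - 1, by have := L.pos; omega, rfl⟩
    have h2 := Finset.disjoint_left.1 (disj_legs hT L hPQ) h1
    have hPa := adj_leg_last L P
    have hQa := adj_leg_last L Q
    have hs := side_leg_last hT L Q
    rw [← hs] at h h2
    obtain ⟨e1, e2⟩ := side_cross hT hQa h h2 hPa.symm
    have h3 := card_side_add hT hPa
    rw [side_leg_last hT L P, e1, e2, hs, card_lset L P le_rfl, card_lset L Q le_rfl] at h3
    have := L.small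
    omega

lemma sz_leg (hT : G.IsTree) (L : Legs G r leg) (P : ι) {i : ℕ} (hi : i < r) :
    sz G s(leg P i, leg P (i + 1)) ≤ i + 1 := by
  rw [sz_mk, side_leg hT L P hi, card_lset L P (by omega)]
  exact min_le_left _ _

lemma nxt_leg (hT : G.IsTree) (L : Legs G r leg) (P : ι) {i : ℕ} (hi : i < r) {c : V}
    (hc : c ∉ lset leg P r) : nxt G c (leg P i) = leg P (i + 1) := by
  have hc' : c ∉ lset leg P (i + 1) := by
    intro h
    obtain ⟨j, hj, h⟩ := mem_lset.1 h
    exact hc (mem_lset.2 ⟨j, by omega, h⟩)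
  apply nxt_eq hT
  · rintro rfl
    exact hc (mem_lset.2 ⟨i, hi, rfl⟩)
  · exact L.adj P i hi
  · rw [← side_leg hT L P hi] at hc'
    have := side_dist hT (L.adj P i hi) (left_mem_side (L.adj P i hi)) hc'
    omega

lemma cnt_bad (hT : G.IsTree) (c : V) (t : ℕ) (D : Finset V) (hc : c ∉ D)
    (hD : ∀ w ∈ D, ¬ t ≤ sz G s(w, nxt G c w)) : cnt G t + D.card + 1 ≤ Fintype.card V := by
  rw [← cnt_add hT c t]
  have : D ⊆ (Finset.univ.erase c).filter fun w => ¬ t ≤ sz G s(w, nxt G c w) := by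
    intro w hw
    simp only [Finset.mem_filter, Finset.mem_erase, Finset.mem_univ, and_true]
    refine ⟨?_, hD w hw⟩
    rintro rfl
    exact hc hw
  have := Finset.card_le_card this
  omega

lemma card_legs (hT : G.IsTree) (L : Legs G r leg) (I : Finset ι) {i : ℕ} (hi : i ≤ r) :
    (I.biUnion fun P => lset leg P i).card = I.card * i := by
  rw [Finset.card_biUnion]
  · rw [Finset.sum_congr rfl (fun P _ => card_lset L P hi), Finset.sum_const, smul_eq_mul]
  · intro P _ Q _ hPQ
    have hs : ∀ P : ι, lset leg P i ⊆ lset leg P r := fun P =>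
      Finset.image_subset_image (Finset.range_subset_range.2 hi)
    exact (disj_legs hT L hPQ).mono (hs P) (hs Q)

lemma bound1 (hT : G.IsTree) (L : Legs G r leg) (P0 : ι) (t s : ℕ) (hs : s ≤ r) (hst : s < t) :
    cnt G t + Fintype.card ι * s + 1 ≤ Fintype.card V := by
  have := cnt_bad hT (leg P0 r) t (Finset.univ.biUnion fun P => lset leg P s) ?_ ?_
  · rwa [card_legs hT L _ hs, Finset.card_univ] at this
  · simp only [Finset.mem_biUnion, Finset.mem_univ, true_and, not_exists]
    intro P h
    obtain ⟨j, hj, h⟩ := mem_lset.1 h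
    exact attach_core hT L P0 P (mem_lset.2 ⟨j, by omega, h⟩)
  · simp only [Finset.mem_biUnion, Finset.mem_univ, true_and]
    rintro w ⟨P, h⟩
    obtain ⟨j, hj, rfl⟩ := mem_lset.1 h
    rw [nxt_leg hT L P (by omega) (attach_core hT L P0 P)]
    have := sz_leg hT L P (i := j) (by omega)
    omega

lemma nxt_mem_side (hT : G.IsTree) {u v c w : V} (h : G.Adj u v)
    (hc : c ∉ side G u v ∨ c = u) (hw : w ∈ side G u v) (hwu : w ≠ u) :
    w ≠ c ∧ nxt G c w ∈ side G u v := by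
  have hwc : w ≠ c := by
    rintro rfl
    rcases hc with hc | hc
    · exact hc hw
    · exact hwu hc
  refine ⟨hwc, ?_⟩
  by_contra hn
  exact hwu (side_cross hT h hw hn (nxt_spec hT.connected hwc).1).1

lemma bound2 (hT : G.IsTree) (L : Legs G r leg) (t : ℕ) (ht : r < t) {u v : V} (h : G.Adj u v)
    (h1 : t ≤ (side G u v).card) (h2 : t ≤ (side G v u).card)
    (h3 : ∀ x y, G.Adj x y → x ∈ side G u v → y ∈ side G u v → ¬ t ≤ sz G s(x, y)) :
    cnt G t + t + (Finset.univ.filter fun P : ι => leg P 0 ∉ side G u v).card * r ≤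
      Fintype.card V := by
  set I := Finset.univ.filter fun P : ι => leg P 0 ∉ side G u v with hI
  have hdis : ∀ P ∈ I, Disjoint (side G u v) (lset leg P r) := by
    intro P hP
    simp only [hI, Finset.mem_filter, Finset.mem_univ, true_and] at hP
    have hcl := card_lset L P le_rfl
    rcases four hT h (adj_leg_last L P) with h4 | h4 | h4 | h4 <;> rw [side_leg_last hT L] at h4
    · have := Finset.card_le_card h4
      omega
    · exact absurd (h4 (mem_lset.2 ⟨0, L.pos, rfl⟩)) hP
    · exact h4
    · exfalso
      have : side G v u ⊆ lset leg P r := by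
        rw [side_compl hT h]
        intro w hw
        have : w ∈ side G u v ∪ lset leg P r := by rw [h4]; simp
        simp at hw this
        tauto
      have := Finset.card_le_card this
      omega
  have hu := left_mem_side h
  have hdis2 : Disjoint ((side G u v).erase u) (I.biUnion fun P => lset leg P r) := by
    rw [Finset.disjoint_biUnion_right]
    intro P hP
    exact (hdis P hP).mono_left (Finset.erase_subset _ _)
  have := cnt_bad hT u t ((side G u v).erase u ∪ I.biUnion fun P => lset leg P r) ?_ ?_
  · rw [Finset.card_union_of_disjoint hdis2, card_legs hT L _ le_rfl,
      Finset.card_erase_of_mem hu] at this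
    omega
  · simp only [Finset.mem_union, Finset.mem_erase, ne_eq, not_true_eq_false, false_and, false_or,
      Finset.mem_biUnion, not_exists, not_and]
    intro P hP
    exact Finset.disjoint_left.1 (hdis P hP) hu
  · intro w hw
    rw [Finset.mem_union] at hw
    rcases hw with hw | hw
    · rw [Finset.mem_erase] at hw
      obtain ⟨h5, h6⟩ := nxt_mem_side hT h (Or.inr rfl) hw.2 hw.1
      exact h3 _ _ (nxt_spec hT.connected h5).1 hw.2 h6
    · rw [Finset.mem_biUnion] at hw
      obtain ⟨P, hP, hw⟩ := hw
      obtain ⟨j, hj, rfl⟩ := mem_lset.1 hw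
      rw [nxt_leg hT L P hj (Finset.disjoint_left.1 (hdis P hP) hu)]
      have := sz_leg hT L P hj
      omega

lemma bound3 (hT : G.IsTree) (t : ℕ) {u v v' u' : V} (h : G.Adj u v) (h' : G.Adj v' u')
    (h1 : t ≤ (side G u v).card) (h2 : t ≤ (side G v' u').card)
    (hd : Disjoint (side G u v) (side G v' u'))
    (h3 : ∀ x y, G.Adj x y → x ∈ side G u v → y ∈ side G u v → ¬ t ≤ sz G s(x, y))
    (h4 : ∀ x y, G.Adj x y → x ∈ side G v' u' → y ∈ side G v' u' → ¬ t ≤ sz G s(x, y)) :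
    cnt G t + 2 * t ≤ Fintype.card V + 1 := by
  have hu := left_mem_side h
  have hv' := left_mem_side h'
  have hu' : u ∉ side G v' u' := Finset.disjoint_left.1 hd hu
  have hdis2 : Disjoint ((side G u v).erase u) ((side G v' u').erase v') :=
    hd.mono (Finset.erase_subset _ _) (Finset.erase_subset _ _)
  have := cnt_bad hT u t ((side G u v).erase u ∪ (side G v' u').erase v') ?_ ?_
  · rw [Finset.card_union_of_disjoint hdis2, Finset.card_erase_of_mem hu,
      Finset.card_erase_of_mem hv'] at this
    omega
  · simp [hu']
  · intro w hw
    rw [Finset.mem_union] at hw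
    rcases hw with hw | hw
    · rw [Finset.mem_erase] at hw
      obtain ⟨h5, h6⟩ := nxt_mem_side hT h (Or.inr rfl) hw.2 hw.1
      exact h3 _ _ (nxt_spec hT.connected h5).1 hw.2 h6
    · rw [Finset.mem_erase] at hw
      obtain ⟨h5, h6⟩ := nxt_mem_side hT h' (Or.inl hu') hw.2 hw.1
      exact h4 _ _ (nxt_spec hT.connected h5).1 hw.2 h6

/-- The combined upper bound. -/
lemma bound23 (hT : G.IsTree) (L : Legs G r leg) (t : ℕ) (ht : r < t) (hpos : 0 < cnt G t) :
    cnt G t + t + (Fintype.card ι - Fintype.card ι / 2) * r ≤ Fintype.card V ∧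
      cnt G t + 2 * t ≤ Fintype.card V + 1 := by
  obtain ⟨e, he⟩ := Finset.card_pos.1 hpos
  induction e with
  | _ x y =>
  rw [Finset.mem_filter, SimpleGraph.mem_edgeFinset, SimpleGraph.mem_edgeSet, sz_mk, le_min_iff] at he
  obtain ⟨hxy, hx, hy⟩ := he
  obtain ⟨u, v, huv, a1, a2, -, a3⟩ := exists_min_side hT t Finset.univ
    ⟨x, y, hxy, hx, hy, Finset.subset_univ _⟩
  obtain ⟨v', u', huv', b1, b2, b4, b3⟩ := exists_min_side hT t (side G v u)
    ⟨v, u, huv.symm, a2, a1, Finset.Subset.refl _⟩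
  have hd : Disjoint (side G u v) (side G v' u') := by
    rw [side_compl hT huv] at b4
    rw [Finset.disjoint_left]
    intro w hw hw'
    simpa [hw] using b4 hw'
  refine ⟨?_, bound3 hT t huv huv' a1 b1 hd a3 b3⟩
  have c1 := bound2 hT L t ht huv a1 a2 a3
  have c2 := bound2 hT L t ht huv' b1 b2 b3
  set I := Finset.univ.filter fun P : ι => leg P 0 ∉ side G u v
  set J := Finset.univ.filter fun P : ι => leg P 0 ∉ side G v' u'
  have hIJ : I ∪ J = Finset.univ := by
    ext P
    simp only [I, J, Finset.mem_union, Finset.mem_filter, Finset.mem_univ, true_and, iff_true]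
    by_contra! h
    exact Finset.disjoint_left.1 hd h.1 h.2
  have hc := Finset.card_union_le I J
  rw [hIJ, Finset.card_univ] at hc
  rcases (by omega : Fintype.card ι - Fintype.card ι / 2 ≤ I.card ∨
    Fintype.card ι - Fintype.card ι / 2 ≤ J.card) with h | h
  · have := Nat.mul_le_mul_right r h
    omega
  · have := Nat.mul_le_mul_right r h
    omega
end


end Mst

namespace Mst

variable {V : Type*} [Fintype V]

section
variable {ι : Type*} [Fintype ι] {G : SimpleGraph V} {r : ℕ} {leg : ι → ℕ → V}

/-- Vertices outside of all legs. -/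
noncomputable def core (leg : ι → ℕ → V) (r : ℕ) : Finset V :=
  (Finset.univ.biUnion fun P => lset leg P r)ᶜ

lemma mem_core {v : V} : v ∈ core leg r ↔ ∀ P, v ∉ lset leg P r := by
  simp [core]

lemma card_core (hT : G.IsTree) (L : Legs G r leg) :
    (core leg r).card + Fintype.card ι * r = Fintype.card V := by
  have := Finset.card_add_card_compl (Finset.univ.biUnion fun P => lset leg P r)
  rw [card_legs hT L _ le_rfl, Finset.card_univ] at this
  rw [core]; omega

lemma core_adj (hT : G.IsTree) (L : Legs G r leg) {x y : V} {P : ι} (hxy : G.Adj x y)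
    (hx : x ∈ core leg r) (hy : y ∈ lset leg P r) : y = leg P (r - 1) ∧ x = leg P r := by
  have hx' := mem_core.1 hx P
  rw [← side_leg_last hT L P] at hx' hy
  exact side_cross hT (adj_leg_last L P) hy hx' hxy.symm

lemma core_nxt (hT : G.IsTree) (L : Legs G r leg) {c w : V} (hc : c ∈ core leg r)
    (hw : w ∈ core leg r) (hne : w ≠ c) : nxt G c w ∈ core leg r := by
  rw [mem_core]
  intro P hP
  obtain ⟨h1, h2⟩ := nxt_spec hT.connected hne
  obtain ⟨h3, h4⟩ := core_adj hT L h1 hw hP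
  have h5 := mem_core.1 hc P
  rw [← side_leg_last hT L P, mem_side, ← h3, ← h4, G.dist_comm, G.dist_comm (u := c)] at h5
  omega

lemma core_bad (hT : G.IsTree) (L : Legs G r leg) {c : V} (hc : c ∈ core leg r) (t : ℕ)
    (ht : r < t) (E : Finset V) (hE : E ⊆ core leg r) (hcE : c ∉ E)
    (hb : ∀ w ∈ E, ¬ t ≤ sz G s(w, nxt G c w)) :
    cnt G t + Fintype.card ι * r + E.card + 1 ≤ Fintype.card V := by
  have hdis : Disjoint (Finset.univ.biUnion fun P => lset leg P r) E := by
    rw [Finset.disjoint_right]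
    intro w hw
    simpa [core] using hE hw
  have := cnt_bad hT c t ((Finset.univ.biUnion fun P => lset leg P r) ∪ E) ?_ ?_
  · rw [Finset.card_union_of_disjoint hdis, card_legs hT L _ le_rfl, Finset.card_univ] at this
    omega
  · rw [Finset.mem_union]
    rintro (h | h)
    · simp [core] at hc
      simp at h
      obtain ⟨P, h⟩ := h
      exact hc P h
    · exact hcE h
  · intro w hw
    rw [Finset.mem_union] at hw
    rcases hw with hw | hw
    · rw [Finset.mem_biUnion] at hw
      obtain ⟨P, hP, hw⟩ := hw
      obtain ⟨j, hj, rfl⟩ := mem_lset.1 hw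
      rw [nxt_leg hT L P hj (mem_core.1 hc P)]
      have := sz_leg hT L P hj
      omega
    · exact hb w hw

/-- number of legs at a vertex -/
noncomputable def nlegs (leg : ι → ℕ → V) (r : ℕ) (w : V) : ℕ :=
  (Finset.univ.filter fun P : ι => leg P r = w).card

lemma leaf_side (hT : G.IsTree) (L : Legs G r leg) {w w' : V} (hw : w ∈ core leg r)
    (hw' : w' ∈ core leg r) (h : G.Adj w w') (hl : ∀ z ∈ core leg r, G.Adj w z → z = w') :
    (side G w w').card ≤ nlegs leg r w * r + 1 := by
  set I := Finset.univ.filter fun P : ι => leg P r = w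
  have hside : side G w w' = insert w (I.biUnion fun P => lset leg P r) := by
    refine (side_of_cut hT.connected _ _ _ ?_ ?_ ?_).1
    · intro a b ha hb hab
      simp only [Finset.mem_insert, Finset.mem_biUnion, not_or, not_exists, not_and] at ha hb
      rcases ha with rfl | ⟨P, hP, ha⟩
      · refine ⟨rfl, ?_⟩
        by_cases hbc : b ∈ core leg r
        · exact hl b hbc hab
        · simp only [mem_core, not_forall, not_not] at hbc
          obtain ⟨P, hP⟩ := hbc
          exact absurd hP (hb.2 P (by simpa [I] using (core_adj hT L hab hw hP).2.symm))
      · exfalso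
        have hb' := hb.2 P hP
        rw [← side_leg_last hT L P] at hb' ha
        have := side_cross hT (adj_leg_last L P) ha hb' hab
        simp only [I, Finset.mem_filter, Finset.mem_univ, true_and] at hP
        exact hb.1 (this.2.trans hP)
    · simp
    · simp only [Finset.mem_insert, Finset.mem_biUnion, not_or, not_exists, not_and]
      exact ⟨h.ne', fun P _ => mem_core.1 hw' P⟩
  rw [hside]
  refine (Finset.card_insert_le _ _).trans ?_
  rw [card_legs hT L _ le_rfl]
  rfl

theorem struct_aux (hT : G.IsTree) (L : Legs G r leg) (hk : 3 ≤ Fintype.card ι)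
    (hn : Fintype.card ι * r + 2 ≤ Fintype.card V)
    (h1 : Fintype.card V ≤ cnt G (Fintype.card ι / 2 * r + 1) + Fintype.card ι * r + 1)
    (h2 : Fintype.card ι % 2 = 1 →
      Fintype.card V ≤ cnt G (Fintype.card ι / 2 * r + 2) + Fintype.card ι * r + 2) :
    ∃ x ∈ core leg r, ∃ y ∈ core leg r, x ≠ y ∧ 
      nlegs leg r x = (Fintype.card ι + 1) / 2 ∧ nlegs leg r y = Fintype.card ι / 2 ∧
      (∀ P, leg P r = x ∨ leg P r = y) ∧
      ∀ z ∈ core leg r, G.dist x z + G.dist z y = G.dist x y := by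
  set k := Fintype.card ι with hkdef
  have hpos := L.pos
  have hcc := card_core hT L
  rw [← hkdef] at hcc
  have hrk : r ≤ k / 2 * r := Nat.le_mul_of_pos_left r (by omega)
  obtain ⟨⟨x, y⟩, hm, hmax⟩ := Finset.exists_max_image ((core leg r) ×ˢ (core leg r))
    (fun p => G.dist p.1 p.2) (by
      rw [Finset.nonempty_product, and_self, ← Finset.card_pos]; omega)
  rw [Finset.mem_product] at hm
  obtain ⟨hx, hy⟩ := hm
  simp only at hx hy
  have hmax' : ∀ a ∈ core leg r, ∀ b ∈ core leg r, G.dist a b ≤ G.dist x y := fun a ha b hb =>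
    hmax (a, b) (Finset.mem_product.2 ⟨ha, hb⟩)
  have hxy : x ≠ y := by
    rintro rfl
    obtain ⟨a, ha, b, hb, hab⟩ := Finset.one_lt_card.1 (by omega : 1 < (core leg r).card)
    have := hmax' a ha b hb
    rw [SimpleGraph.dist_self, Nat.le_zero, hT.connected.dist_eq_zero_iff] at this
    exact hab this
  -- every core leaf has at least k / 2 legs
  have hleaf : ∀ w ∈ core leg r, ∀ c ∈ core leg r, w ≠ c →
      (∀ z ∈ core leg r, G.Adj w z → z = nxt G c w) → k / 2 ≤ nlegs leg r w := by
    intro w hw c hc hwc hl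
    have hs := nxt_spec hT.connected hwc
    have h3 := leaf_side hT L hw (core_nxt hT L hc hw hwc) hs.1 hl
    by_contra hlt
    push Not at hlt
    have h4 : ¬ (k / 2 * r + 1 ≤ sz G s(w, nxt G c w)) := by
      rw [sz_mk, le_min_iff]
      have : nlegs leg r w * r < k / 2 * r := Nat.mul_lt_mul_of_pos_right hlt hpos
      omega
    have := core_bad hT L hc (k / 2 * r + 1) (by omega) {w} (by simpa using hw)
      (by simpa using hwc.symm) (by simpa using h4)
    rw [Finset.card_singleton, ← hkdef] at this
    omega
  have hfar : ∀ c ∈ core leg r, ∀ w ∈ core leg r, w ≠ c → 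
      (∀ z ∈ core leg r, G.Adj w z → G.dist z c ≤ G.dist w c) → 
      (∀ z ∈ core leg r, G.Adj w z → z = nxt G c w) := by
    intro c hc w hw hwc h z hz hwz
    have h3 := h z hz hwz
    have h4 := dist_adj hT hwz (c := c)
    exact (nxt_eq hT hwc hwz (by omega)).symm
  have hly := hfar x hx y hy hxy.symm (fun z hz _ => by
    rw [G.dist_comm (u := y)]; exact (hmax' z hz x hx))
  have hlx := hfar y hy x hx hxy (fun z hz _ => hmax' z hz y hy)
  have hpy := hleaf y hy x hx hxy.symm hly
  have hpx := hleaf x hx y hy hxy hlx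
  have hdisj : Disjoint (Finset.univ.filter fun P : ι => leg P r = x)
      (Finset.univ.filter fun P : ι => leg P r = y) := by
    rw [Finset.disjoint_left]
    intro P hP hP'
    simp only [Finset.mem_filter, Finset.mem_univ, true_and] at hP hP'
    exact hxy (hP.symm.trans hP')
  have hun := Finset.card_union_of_disjoint hdisj
  have hle := Finset.card_le_univ ((Finset.univ.filter fun P : ι => leg P r = x) ∪
      (Finset.univ.filter fun P : ι => leg P r = y))
  change _ = nlegs leg r x + nlegs leg r y at hun
  have hsum : k ≤ nlegs leg r x + nlegs leg r y := by
    by_contra hlt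
    push Not at hlt
    have hodd : k % 2 = 1 := by omega
    have hex : nlegs leg r x = k / 2 := by omega
    have hey : nlegs leg r y = k / 2 := by omega
    have h2 := h2 hodd
    have hsx := nxt_spec hT.connected hxy
    have hsy := nxt_spec hT.connected hxy.symm
    have h3 := leaf_side hT L hx (core_nxt hT L hy hx hxy) hsx.1 hlx
    have h4 := leaf_side hT L hy (core_nxt hT L hx hy hxy.symm) hsy.1 hly
    rw [hex] at h3
    rw [hey] at h4
    by_cases hadj : nxt G y x = y
    · rw [hadj] at h3 hsx
      have h5 : nxt G x y = x := (hly x hx hsx.1.symm).symm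
      rw [h5] at h4
      have h6 := card_side_add hT hsx.1
      have h7 : k * r = k / 2 * r + k / 2 * r + r := by
        conv_lhs => rw [(by omega : k = k / 2 + k / 2 + 1)]
        ring
      omega
    · set c := nxt G y x with hcdef
      have hc : c ∈ core leg r := core_nxt hT L hy hx hxy
      have e1 : nxt G c x = c := nxt_eq hT hsx.1.ne hsx.1 (by
        rw [SimpleGraph.dist_self]
        exact hT.connected.pos_dist_of_ne hsx.1.ne)
      have hyc : y ≠ c := fun h => hadj h.symm
      have e2 : nxt G c y = nxt G x y := hly _ (core_nxt hT L hc hy hyc) (nxt_spec hT.connected hyc).1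
      have := core_bad hT L hc (k / 2 * r + 2) (by omega) {x, y} (by
          intro z hz; simp at hz; rcases hz with rfl | rfl <;> assumption)
        (by simp; exact ⟨hsx.1.ne', hadj⟩) (by
          intro z hz
          simp at hz
          rcases hz with rfl | rfl
          · rw [e1, sz_mk, le_min_iff]; omega
          · rw [e2, sz_mk, le_min_iff]; omega)
      rw [Finset.card_pair hxy, ← hkdef] at this
      omega
  have hall : ∀ P, leg P r = x ∨ leg P r = y := by
    have : (Finset.univ.filter fun P : ι => leg P r = x) ∪
      (Finset.univ.filter fun P : ι => leg P r = y) = Finset.univ := by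
      rw [← Finset.card_eq_iff_eq_univ]
      omega
    intro P
    have h : P ∈ (Finset.univ.filter fun P : ι => leg P r = x) ∪
      (Finset.univ.filter fun P : ι => leg P r = y) := by rw [this]; simp
    simpa using h
  have hgeo : ∀ z ∈ core leg r, G.dist x z + G.dist z y = G.dist x y := by
    by_contra! hex
    let F := (core leg r).filter fun z => G.dist x z + G.dist z y ≠ G.dist x y
    have hF : F.Nonempty := by
      obtain ⟨z, hz, h⟩ := hex
      exact ⟨z, by simp [F, hz, h]⟩
    obtain ⟨z, hz, hzmax⟩ := Finset.exists_max_image F (fun z => G.dist x z) hF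
    simp only [F, Finset.mem_filter] at hz hzmax
    obtain ⟨hz, hne⟩ := hz
    have hzx : z ≠ x := by rintro rfl; simp at hne
    have hzy : z ≠ y := by rintro rfl; simp at hne
    have h5 := hleaf z hz x hx hzx (hfar x hx z hz hzx (by
      intro z' hz' hzz'
      by_contra hlt
      push Not at hlt
      have h6 := dist_adj hT hzz' (c := x)
      rw [G.dist_comm (u := z'), G.dist_comm (u := z)] at h6 hlt
      by_cases hg : G.dist x z' + G.dist z' y = G.dist x y
      · have h7 : G.dist z y ≤ G.dist z z' + G.dist z' y := hT.connected.dist_triangle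
        have h8 : G.dist z z' = 1 := SimpleGraph.dist_eq_one_iff_adj.2 hzz'
        have h9 : G.dist x y ≤ G.dist x z + G.dist z y := hT.connected.dist_triangle
        omega
      · have := hzmax z' ⟨hz', hg⟩
        omega))
    have h6 : 0 < nlegs leg r z := by omega
    obtain ⟨P, hP⟩ := Finset.card_pos.1 h6
    simp only [Finset.mem_filter, Finset.mem_univ, true_and] at hP
    rcases hall P with h | h
    · exact hzx (hP.symm.trans h)
    · exact hzy (hP.symm.trans h)
  rcases le_total (nlegs leg r y) (nlegs leg r x) with hle' | hle'
  · exact ⟨x, hx, y, hy, hxy, by omega, by omega, hall, hgeo⟩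
  · refine ⟨y, hy, x, hx, hxy.symm, by omega, by omega, fun P => (hall P).symm, fun z hz => ?_⟩
    have := hgeo z hz
    rw [G.dist_comm (u := y) (v := z), G.dist_comm (u := z) (v := x), G.dist_comm (u := y) (v := x)]
    omega

theorem enum_core (hT : G.IsTree) (L : Legs G r leg) {x y : V} (hx : x ∈ core leg r)
    (hy : y ∈ core leg r) (hg : ∀ z ∈ core leg r, G.dist x z + G.dist z y = G.dist x y) :
    ∃ c : ℕ → V, c 0 = x ∧ c ((core leg r).card - 1) = y ∧
      (∀ i < (core leg r).card, c i ∈ core leg r) ∧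
      (∀ i j, i < (core leg r).card → j < (core leg r).card → c i = c j → i = j) ∧
      (∀ i, i + 1 < (core leg r).card → G.Adj (c i) (c (i + 1))) := by
  have hinj : ∀ d, ∀ z ∈ core leg r, ∀ z' ∈ core leg r, G.dist x z = d → G.dist x z' = d →
      z = z' := by
    intro d
    induction d with
    | zero =>
      intro z _ z' _ h1 h2
      rw [hT.connected.dist_eq_zero_iff] at h1 h2
      rw [← h1, ← h2]
    | succ d ih =>
      intro z hz z' hz' h1 h2
      have hzx : z ≠ x := by rintro rfl; simp at h1
      have hzx' : z' ≠ x := by rintro rfl; simp at h2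
      obtain ⟨a1, a2⟩ := nxt_spec hT.connected hzx
      obtain ⟨b1, b2⟩ := nxt_spec hT.connected hzx'
      have hc := core_nxt hT L hx hz hzx
      have hc' := core_nxt hT L hx hz' hzx'
      rw [G.dist_comm (v := x), G.dist_comm (v := x)] at a2 b2
      have heq := ih _ hc _ hc' (by omega) (by omega)
      rw [← heq] at b1
      have g1 := hg _ hc
      have g2 := hg _ hz
      have g3 := hg _ hz'
      exact next_unique hT (c := y) a1.symm b1.symm (by omega) (by omega)
  have hex : ∀ e, e ≤ G.dist x y → ∃ z ∈ core leg r, G.dist x z = G.dist x y - e := by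
    intro e
    induction e with
    | zero => intro _; exact ⟨y, hy, rfl⟩
    | succ e ih =>
      intro he
      obtain ⟨z, hz, h1⟩ := ih (by omega)
      have hzx : z ≠ x := by rintro rfl; simp at h1; omega
      obtain ⟨a1, a2⟩ := nxt_spec hT.connected hzx
      rw [G.dist_comm (v := x), G.dist_comm (v := x)] at a2
      exact ⟨_, core_nxt hT L hx hz hzx, by omega⟩
  have hcard : (core leg r).card = G.dist x y + 1 := by
    rw [← Finset.card_range (G.dist x y + 1), ← Finset.card_image_of_injOn (s := core leg r) (f := fun z => G.dist x z)]
    · congr 1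
      ext d
      simp only [Finset.mem_image, Finset.mem_range]
      constructor
      · rintro ⟨z, hz, rfl⟩
        have := hg z hz
        omega
      · intro hd
        obtain ⟨z, hz, h⟩ := hex (G.dist x y - d) (by omega)
        exact ⟨z, hz, by omega⟩
    · intro z hz z' hz' h
      exact hinj _ z hz z' hz' rfl h.symm
  have hex' : ∀ i, ∃ z, i ≤ G.dist x y → z ∈ core leg r ∧ G.dist x z = i := by
    intro i
    by_cases h : i ≤ G.dist x y
    · obtain ⟨z, hz, h1⟩ := hex (G.dist x y - i) (by omega)
      exact ⟨z, fun _ => ⟨hz, by omega⟩⟩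
    · exact ⟨x, fun h' => absurd h' h⟩
  choose c hc using hex'
  rw [hcard]
  refine ⟨c, ?_, ?_, ?_, ?_, ?_⟩
  · obtain ⟨h1, h2⟩ := hc 0 (by omega)
    exact hinj 0 _ h1 _ hx h2 (by simp)
  · obtain ⟨h1, h2⟩ := hc (G.dist x y) le_rfl
    exact hinj _ _ h1 _ hy h2 rfl
  · intro i hi
    exact (hc i (by omega)).1
  · intro i j hi hj h
    rw [← (hc i (by omega)).2, ← (hc j (by omega)).2, h]
  · intro i hi
    obtain ⟨h1, h2⟩ := hc (i + 1) (by omega)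
    obtain ⟨h3, h4⟩ := hc i (by omega)
    have hzx : c (i + 1) ≠ x := by intro h; rw [h] at h2; simp at h2
    obtain ⟨a1, a2⟩ := nxt_spec hT.connected hzx
    rw [G.dist_comm (v := x), G.dist_comm (v := x)] at a2
    rw [hinj i _ h3 _ (core_nxt hT L hx h1 hzx) h4 (by omega)]
    exact a1.symm

theorem enum_legs {x : V} {a : ℕ} (ha : a ≤ Fintype.card ι) (h : nlegs leg r x = a) :
    ∃ e : Fin (Fintype.card ι) ≃ ι, ∀ j, (leg (e j) r = x ↔ j.val < a) := by
  let e0 := (Fintype.equivFin ι).symm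
  have hcard : Fintype.card {j : Fin (Fintype.card ι) // j.val < a} =
      Fintype.card {j : Fin (Fintype.card ι) // leg (e0 j) r = x} := by
    have h1 : Fintype.card {j : Fin (Fintype.card ι) // leg (e0 j) r = x} = 
        Fintype.card {P : ι // leg P r = x} := by
      refine Fintype.card_congr (e0.subtypeEquiv fun _ => Iff.rfl)
    rw [h1, Fintype.card_subtype, Fintype.card_subtype]
    change _ = nlegs leg r x
    rw [h, Fin.card_filter_val_lt]
    omega
  let f := Fintype.equivOfCardEq hcard
  refine ⟨(f.extendSubtype).trans e0, fun j => ?_⟩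
  simp only [Equiv.trans_apply]
  constructor
  · intro h1
    by_contra h2
    exact f.extendSubtype_not_mem j h2 h1
  · intro h1
    exact f.extendSubtype_mem j h1
end


end Mst

namespace Mst

variable {V : Type*} [Fintype V]

lemma side_of_cut_card {G : SimpleGraph V} (hG : G.Connected) (S : Finset V) (u v : V)
    (hc : ∀ a b, a ∈ S → b ∉ S → G.Adj a b → a = u ∧ b = v) (hu : u ∈ S) (hv : v ∉ S) :
    (side G u v).card = S.card ∧ (side G v u).card + S.card = Fintype.card V := by
  obtain ⟨h1, h2⟩ := side_of_cut hG S u v hc hu hv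
  rw [h1, h2]
  exact ⟨rfl, Finset.card_compl_add_card S⟩

end Mst

namespace Mst
section parent
variable {n : ℕ} {p : ℕ → ℕ}

lemma pg_adj {x y : Fin n} : (parentGraph n p).Adj x y ↔ x ≠ y ∧ (p x = y ∨ p y = x) := by
  simp [parentGraph, SimpleGraph.fromRel_adj]

lemma pg_connected (hn : 0 < n) (hp : ∀ i, 0 < i → i < n → p i < i) :
    (parentGraph n p).Connected := by
  have : ∀ i (hi : i < n), (parentGraph n p).Reachable ⟨i, hi⟩ ⟨0, hn⟩ := by
    intro i
    induction i using Nat.strong_induction_on with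
    | _ i ih =>
      intro hi
      rcases Nat.eq_zero_or_pos i with rfl | h0
      · exact SimpleGraph.Reachable.refl _
      · have h1 := hp i h0 hi
        refine SimpleGraph.Reachable.trans (SimpleGraph.Adj.reachable ?_) (ih (p i) h1 (by omega))
        rw [pg_adj]
        refine ⟨?_, Or.inl rfl⟩
        rw [ne_eq, Fin.mk.injEq]
        omega
  have hne : Nonempty (Fin n) := ⟨⟨0, hn⟩⟩
  exact SimpleGraph.Connected.mk fun x y => (this x x.2).trans (this y y.2).symm

/-- the edge from a vertex to its parent -/
def pedge (hn : 0 < n) (p : ℕ → ℕ) (i : Fin n) : Sym2 (Fin n) :=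
  s(i, ⟨p i % n, Nat.mod_lt _ hn⟩)

lemma pedge_inj (hn : 0 < n) (hp : ∀ i, 0 < i → i < n → p i < i) :
    Set.InjOn (pedge hn p) {i : Fin n | 0 < i.val} := by
  intro i hi j hj h
  simp only [Set.mem_ofPred_eq] at hi hj
  have h1 := hp i hi i.2
  have h2 := hp j hj j.2
  rcases Sym2.eq_iff.1 h with h | h
  · exact h.1
  · have e1 := congrArg Fin.val h.1
    have e2 := congrArg Fin.val h.2
    simp only at e1 e2
    rw [Nat.mod_eq_of_lt (by omega)] at e1 e2
    omega

lemma pedge_mem (hn : 0 < n) (hp : ∀ i, 0 < i → i < n → p i < i) {i : Fin n} (hi : 0 < i.val) :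
    pedge hn p i ∈ (parentGraph n p).edgeFinset := by
  have h1 := hp i hi i.2
  rw [pedge, SimpleGraph.mem_edgeFinset, SimpleGraph.mem_edgeSet, pg_adj]
  refine ⟨?_, Or.inl ?_⟩
  · rw [ne_eq, Fin.ext_iff]
    simp only
    rw [Nat.mod_eq_of_lt (by omega)]
    omega
  · simp only
    rw [Nat.mod_eq_of_lt (by omega)]

lemma pg_edges (hn : 0 < n) (hp : ∀ i, 0 < i → i < n → p i < i) (hp0 : p 0 = 0) :
    (parentGraph n p).edgeFinset = (Finset.univ.filter fun i : Fin n => 0 < i.val).image (pedge hn p) := by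
  ext e
  constructor
  · intro he
    induction e with
    | _ x y =>
    rw [SimpleGraph.mem_edgeFinset, SimpleGraph.mem_edgeSet, pg_adj] at he
    obtain ⟨hne, h | h⟩ := he
    · rw [Finset.mem_image]
      refine ⟨x, ?_, ?_⟩
      · simp only [Finset.mem_filter, Finset.mem_univ, true_and]
        by_contra h0
        apply hne
        rw [Fin.ext_iff]
        rw [(by omega : x.val = 0), hp0] at h
        omega
      · rw [pedge]
        congr
        rw [h, Nat.mod_eq_of_lt y.2]
    · rw [Finset.mem_image]
      refine ⟨y, ?_, ?_⟩
      · simp only [Finset.mem_filter, Finset.mem_univ, true_and]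
        by_contra h0
        apply hne
        rw [Fin.ext_iff]
        rw [(by omega : y.val = 0), hp0] at h
        omega
      · rw [pedge, Sym2.eq_swap]
        congr
        rw [h, Nat.mod_eq_of_lt x.2]
  · intro he
    rw [Finset.mem_image] at he
    obtain ⟨i, hi, rfl⟩ := he
    exact pedge_mem hn hp (by simpa using hi)

lemma fin_card (P : ℕ → Prop) [DecidablePred P] :
    (Finset.univ.filter fun x : Fin n => P x.val).card = ((Finset.range n).filter P).card := by
  rw [Finset.card_filter, Finset.card_filter]
  exact Fin.sum_univ_eq_sum_range (fun i => if P i then 1 else 0) n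

lemma pg_tree (hn : 0 < n) (hp : ∀ i, 0 < i → i < n → p i < i) (hp0 : p 0 = 0) :
    (parentGraph n p).IsTree := by
  rw [SimpleGraph.isTree_iff_connected_and_card]
  refine ⟨pg_connected hn hp, ?_⟩
  have h1 : (parentGraph n p).edgeFinset.card = n - 1 := by
    rw [pg_edges hn hp hp0, Finset.card_image_of_injOn]
    · rw [fin_card (fun i => 0 < i)]
      have : (Finset.range n).filter (fun i => 0 < i) = Finset.Ico 1 n := by
        ext i; simp; omega
      rw [this, Nat.card_Ico]
    · intro i hi j hj h
      exact pedge_inj hn hp (by simpa using hi) (by simpa using hj) h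
  rw [Nat.card_eq_fintype_card, ← SimpleGraph.edgeFinset_card, h1, Nat.card_eq_fintype_card, Fintype.card_fin]
  omega

lemma pg_sz (hn : 0 < n) (hp : ∀ i, 0 < i → i < n → p i < i) (hp0 : p 0 = 0) (i : ℕ) (hi0 : 0 < i)
    (hi : i < n) (P : ℕ → Prop) (hiP : P i)
    (h1 : ∀ j, j < n → P j → ¬ P (p j) → j = i) (h2 : ∀ j, j < n → ¬ P j → ¬ P (p j))
    (h3 : ¬ P (p i)) (t : ℕ) (ht1 : t ≤ ((Finset.range n).filter P).card)
    (ht2 : t + ((Finset.range n).filter P).card ≤ n) :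
    t ≤ sz (parentGraph n p) (pedge hn p ⟨i, hi⟩) := by
  have hpi := hp i hi0 hi
  have hc := side_of_cut_card (pg_connected hn hp) (Finset.univ.filter fun x : Fin n => P x.val) ⟨i, hi⟩
    ⟨p i % n, Nat.mod_lt _ hn⟩ (by
      intro x y hx hy hxy
      simp only [Finset.mem_filter, Finset.mem_univ, true_and] at hx hy
      rw [pg_adj] at hxy
      obtain ⟨hne, h | h⟩ := hxy
      · rw [← h] at hy
        have := h1 x x.2 hx hy
        refine ⟨Fin.ext this, Fin.ext ?_⟩
        simp only
        rw [Nat.mod_eq_of_lt (by omega), ← this, h]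
      · rw [← h] at hx
        exact absurd hx (h2 y y.2 hy)) (by simpa using hiP) (by
      simp only [Finset.mem_filter, Finset.mem_univ, true_and]
      rw [Nat.mod_eq_of_lt (by omega)]; exact h3)
  rw [fin_card P, Fintype.card_fin] at hc
  rw [pedge, sz_mk, le_min_iff]
  exact ⟨le_of_le_of_eq ht1 hc.1.symm, Nat.le_of_add_le_add_right (ht2.trans hc.2.ge)⟩

lemma pg_cnt (hn : 0 < n) (hp : ∀ i, 0 < i → i < n → p i < i) (t : ℕ) (P : ℕ → Prop)
    (h : ∀ i (hi : i < n), P i → 0 < i ∧ t ≤ sz (parentGraph n p) (pedge hn p ⟨i, hi⟩)) :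
    ((Finset.range n).filter P).card ≤ cnt (parentGraph n p) t := by
  rw [← fin_card P, cnt, ← Finset.card_image_of_injOn (f := pedge hn p)]
  · apply Finset.card_le_card
    intro e he
    rw [Finset.mem_image] at he
    obtain ⟨i, hi, rfl⟩ := he
    simp only [Finset.mem_filter, Finset.mem_univ, true_and] at hi
    obtain ⟨h1, h2⟩ := h i i.2 hi
    rw [Finset.mem_filter]
    exact ⟨pedge_mem hn hp h1, h2⟩
  · intro i hi j hj hij
    simp only [Finset.coe_filter, Finset.mem_univ, true_and, Set.mem_ofPred_eq] at hi hj
    exact pedge_inj hn hp (h i i.2 hi).1 (h j j.2 hj).1 hij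

lemma pg_iso (hn : 0 < n) (hp : ∀ i, 0 < i → i < n → p i < i) (hp0 : p 0 = 0)
    {T : SimpleGraph (Fin n)} (hT : T.IsTree) (φ : ℕ → Fin n)
    (hφ : ∀ i j, i < n → j < n → φ i = φ j → i = j)
    (hadj : ∀ i, 0 < i → i < n → T.Adj (φ i) (φ (p i))) : Nonempty (T ≃g parentGraph n p) := by
  have hinj : Function.Injective (fun i : Fin n => φ i) := fun i j h =>
    Fin.ext (hφ i j i.2 j.2 h)
  have hom : ∀ x y, (parentGraph n p).Adj x y → T.Adj (φ x) (φ y) := by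
    have aux : ∀ x y : Fin n, x ≠ y → p x = y → T.Adj (φ x) (φ y) := by
      intro x y hne h
      rw [← h]
      apply hadj _ _ x.2
      by_contra h0
      apply hne
      rw [Fin.ext_iff]
      rw [(by omega : x.val = 0), hp0] at h
      omega
    intro x y h
    rw [pg_adj] at h
    obtain ⟨hne, h | h⟩ := h
    · exact aux x y hne h
    · exact (aux y x hne.symm h).symm
  have himg : (parentGraph n p).edgeFinset.image (Sym2.map fun i : Fin n => φ i) = T.edgeFinset := by
    apply Finset.eq_of_subset_of_card_le
    · intro e he
      rw [Finset.mem_image] at he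
      obtain ⟨e, he, rfl⟩ := he
      induction e with
      | _ x y =>
      rw [SimpleGraph.mem_edgeFinset, SimpleGraph.mem_edgeSet] at he
      rw [Sym2.map_mk, SimpleGraph.mem_edgeFinset, SimpleGraph.mem_edgeSet]
      exact hom x y he
    · rw [Finset.card_image_of_injective _ (Sym2.map.injective hinj)]
      have h1 := hT.card_edgeFinset
      have h2 := (pg_tree hn hp hp0).card_edgeFinset
      omega
  let e := Equiv.ofBijective _ (Finite.injective_iff_bijective.1 hinj)
  refine ⟨RelIso.symm ⟨e, ?_⟩⟩
  intro x y
  constructor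
  · intro h
    have : s(φ x, φ y) ∈ T.edgeFinset := by
      rw [SimpleGraph.mem_edgeFinset, SimpleGraph.mem_edgeSet]; exact h
    rw [← himg, Finset.mem_image] at this
    obtain ⟨e', he', h'⟩ := this
    have h'' : Sym2.map (fun i : Fin n => φ i) e' = Sym2.map (fun i : Fin n => φ i) s(x, y) := h'
    rw [Sym2.map.injective hinj h''] at he'
    simpa using he'
  · exact hom x y
end parent


end Mst

namespace Mst

variable {V : Type*} [Fintype V]

/-- The parent function of `treeA`. -/
def pA (n r a b : ℕ) : ℕ → ℕ := fun v =>
    if v < n - (a + b) * r then v - 1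
    else if v < n - b * r then (if (v - (n - (a + b) * r)) % r = 0 then 0 else v - 1)
    else (if (v - (n - b * r)) % r = 0 then n - (a + b) * r - 1 else v - 1)

lemma treeA_eq (n r a b : ℕ) : treeA n r a b = parentGraph n (pA n r a b) := rfl

/-- Abstract description of the parent function. -/
structure PA (p : ℕ → ℕ) (m r a b : ℕ) : Prop where
  hm : 2 ≤ m
  hr : 1 ≤ r
  hb : 1 ≤ b
  hab : b ≤ a
  core : ∀ v, v < m → p v = v - 1
  start0 : ∀ j, j < a → p (m + j * r) = 0
  start1 : ∀ j, a ≤ j → j < a + b → p (m + j * r) = m - 1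
  succ : ∀ j o, j < a + b → o + 1 < r → p (m + j * r + (o + 1)) = m + j * r + o

lemma pA_PA {m r a b : ℕ} (hm : 2 ≤ m) (hr : 1 ≤ r) (hb : 1 ≤ b) (hab : b ≤ a) :
    PA (pA (m + (a + b) * r) r a b) m r a b := by
  have e1 : m + (a + b) * r - (a + b) * r = m := by omega
  have e2 : m + (a + b) * r - b * r = m + a * r := by rw [Nat.add_mul]; omega
  refine ⟨hm, hr, hb, hab, ?_, ?_, ?_, ?_⟩
  · intro v hv
    simp only [pA, e1, e2]
    rw [if_pos hv]
  · intro j hj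
    simp only [pA, e1, e2]
    have : j * r < a * r := Nat.mul_lt_mul_of_pos_right hj hr
    rw [if_neg (by omega), if_pos (by omega), if_pos]
    rw [Nat.add_sub_cancel_left, Nat.mul_mod_left]
  · intro j hj hj2
    simp only [pA, e1, e2]
    have : a * r ≤ j * r := Nat.mul_le_mul_right r hj
    rw [if_neg (by omega), if_neg (by omega), if_pos]
    rw [Nat.add_sub_add_left, ← Nat.sub_mul, Nat.mul_mod_left]
  · intro j o hj ho
    simp only [pA, e1, e2]
    rw [if_neg (by omega)]
    by_cases hja : j < a
    · have : (j + 1) * r ≤ a * r := Nat.mul_le_mul_right r hja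
      rw [Nat.add_mul] at this
      rw [if_pos (by omega), if_neg]
      · omega
      · rw [(by omega : m + j * r + (o + 1) - m = (o + 1) + j * r), Nat.add_mul_mod_self_right,
          Nat.mod_eq_of_lt ho]
        omega
    · have h1 : a * r ≤ j * r := Nat.mul_le_mul_right r (by omega)
      rw [if_neg (by omega), if_neg]
      · omega
      · rw [(by omega : m + j * r + (o + 1) - (m + a * r) = (o + 1) + (j * r - a * r)), ← Nat.sub_mul,
          Nat.add_mul_mod_self_right, Nat.mod_eq_of_lt ho]
        omega

lemma decomp {m r k v : ℕ} (hr : 1 ≤ r) (h1 : m ≤ v) (h2 : v < m + k * r) :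
    ∃ j o, j < k ∧ o < r ∧ v = m + j * r + o := by
  refine ⟨(v - m) / r, (v - m) % r, ?_, Nat.mod_lt _ hr, ?_⟩
  · rw [Nat.div_lt_iff_lt_mul hr]; omega
  · have := Nat.div_add_mod (v - m) r
    rw [Nat.mul_comm] at this
    omega

lemma le_of_mul {r j j' o : ℕ} (ho : o < r) (h : j * r ≤ j' * r + o) : j ≤ j' := by
  by_contra hlt
  have : (j' + 1) * r ≤ j * r := Nat.mul_le_mul_right r (by omega)
  rw [Nat.add_mul] at this
  omega

lemma decomp_unique {r j o j' o' : ℕ} (ho : o < r) (ho' : o' < r)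
    (h : j * r + o = j' * r + o') : j = j' ∧ o = o' := by
  have h1 : j = j' := le_antisymm (le_of_mul ho' (by omega)) (le_of_mul ho (by omega))
  subst h1
  exact ⟨rfl, by omega⟩

lemma leg_lt {r k j o : ℕ} (hj : j < k) (ho : o < r) : j * r + o < k * r := by
  have : (j + 1) * r ≤ k * r := Nat.mul_le_mul_right r hj
  rw [Nat.add_mul] at this
  omega

section
variable {p : ℕ → ℕ} {m r a b : ℕ}

lemma PA.lt (h : PA p m r a b) : ∀ i, 0 < i → i < m + (a + b) * r → p i < i := by
  intro i h0 hi
  have := h.hm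
  rcases lt_or_ge i m with h1 | h1
  · rw [h.core i h1]; omega
  · obtain ⟨j, o, hj, ho, rfl⟩ := decomp h.hr h1 hi
    rcases Nat.eq_zero_or_pos o with rfl | h2
    · rw [Nat.add_zero]
      rcases lt_or_ge j a with h3 | h3
      · rw [h.start0 j h3]; omega
      · rw [h.start1 j h3 hj]; omega
    · obtain ⟨o, rfl⟩ := Nat.exists_eq_succ_of_ne_zero (by omega : o ≠ 0)
      rw [h.succ j o hj ho]; omega

lemma PA.zero (h : PA p m r a b) : p 0 = 0 := by
  rw [h.core 0 (by have := h.hm; omega)]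

lemma PA.npos (h : PA p m r a b) : 0 < m + (a + b) * r := by
  have := h.hm; omega

lemma PA.tree (h : PA p m r a b) : (parentGraph (m + (a + b) * r) p).IsTree :=
  pg_tree h.npos h.lt h.zero

lemma PA.sz_core (h : PA p m r a b) {i : ℕ} (h0 : 0 < i) (hi : i < m) (hin : i < m + (a + b) * r)
    {t : ℕ} (h1 : t ≤ a * r + i) (h2 : t + i ≤ b * r + m) :
    t ≤ sz (parentGraph (m + (a + b) * r) p) (pedge h.npos p ⟨i, hin⟩) := by
  have hm := h.hm
  have hcard : ((Finset.range (m + (a + b) * r)).filter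
      (fun x => (i ≤ x ∧ x < m) ∨ m + a * r ≤ x)).card = (m - i) + b * r := by
    have : (Finset.range (m + (a + b) * r)).filter (fun x => (i ≤ x ∧ x < m) ∨ m + a * r ≤ x) =
        Finset.Ico i m ∪ Finset.Ico (m + a * r) (m + (a + b) * r) := by
      ext x; simp only [Finset.mem_filter, Finset.mem_range, Finset.mem_union, Finset.mem_Ico]; omega
    rw [this, Finset.card_union_of_disjoint, Nat.card_Ico, Nat.card_Ico, Nat.add_mul]
    · omega
    · rw [Finset.disjoint_left]
      intro x
      simp only [Finset.mem_Ico]; omega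
  have key : ∀ x, x < m + (a + b) * r → x ≠ i → 
      (((i ≤ p x ∧ p x < m) ∨ m + a * r ≤ p x) ↔ ((i ≤ x ∧ x < m) ∨ m + a * r ≤ x)) := by
    intro x hx hxi
    rcases lt_or_ge x m with h1 | h1
    · rw [h.core x h1]; omega
    · obtain ⟨j, o, hj, ho, rfl⟩ := decomp h.hr h1 hx
      rcases Nat.eq_zero_or_pos o with rfl | h2
      · rw [Nat.add_zero]
        rcases lt_or_ge j a with h3 | h3
        · rw [h.start0 j h3]
          have := leg_lt h3 (by omega : 0 < r)
          omega
        · rw [h.start1 j h3 hj]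
          have := Nat.mul_le_mul_right r h3
          omega
      · obtain ⟨o, rfl⟩ := Nat.exists_eq_succ_of_ne_zero (by omega : o ≠ 0)
        rw [h.succ j o hj ho]
        rcases lt_or_ge j a with h3 | h3
        · have := leg_lt h3 ho
          omega
        · have := Nat.mul_le_mul_right r h3
          omega
  have hn : m + (a + b) * r = m + a * r + b * r := by rw [Nat.add_mul]; omega
  refine pg_sz h.npos h.lt h.zero i h0 hin (fun x => (i ≤ x ∧ x < m) ∨ m + a * r ≤ x) ?_ ?_ ?_ ?_ t ?_ ?_
  · omega
  · intro x hx hP hnP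
    by_contra hne
    exact hnP ((key x hx hne).2 hP)
  · intro x hx hP
    have hne : x ≠ i := by rintro rfl; omega
    exact fun h' => hP ((key x hx hne).1 h')
  · rw [h.core i hi]; omega
  · refine le_of_le_of_eq ?_ (Eq.symm (Eq.trans ?_ hcard))
    · omega
    · congr
  · refine le_trans (le_of_eq ?_) (?_ : t + ((m - i) + b * r) ≤ _)
    · rw [← hcard]; congr
    · omega

lemma PA.sz_leg (h : PA p m r a b) {j o : ℕ} (hj : j < a + b) (ho : o < r)
    (hin : m + j * r + o < m + (a + b) * r) {t : ℕ} (h1 : t + o ≤ r) :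
    t ≤ sz (parentGraph (m + (a + b) * r) p) (pedge h.npos p ⟨m + j * r + o, hin⟩) := by
  have hm := h.hm
  have hb := h.hb
  have hab := h.hab
  have hj1 : (j + 1) * r ≤ (a + b) * r := Nat.mul_le_mul_right r hj
  have h2r : 2 * r ≤ (a + b) * r := Nat.mul_le_mul_right r (by omega)
  rw [Nat.add_mul, Nat.one_mul] at hj1
  have hcard : ((Finset.range (m + (a + b) * r)).filter
      (fun x => m + j * r + o ≤ x ∧ x < m + j * r + r)).card = r - o := by
    have : (Finset.range (m + (a + b) * r)).filter (fun x => m + j * r + o ≤ x ∧ x < m + j * r + r) =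
        Finset.Ico (m + j * r + o) (m + j * r + r) := by
      ext x; simp only [Finset.mem_filter, Finset.mem_range, Finset.mem_Ico]; omega
    rw [this, Nat.card_Ico]
    omega
  have key : ∀ x, x < m + (a + b) * r → x ≠ m + j * r + o → 
      ((m + j * r + o ≤ p x ∧ p x < m + j * r + r) ↔ (m + j * r + o ≤ x ∧ x < m + j * r + r)) := by
    intro x hx hxi
    rcases lt_or_ge x m with h1 | h1
    · rw [h.core x h1]; omega
    · obtain ⟨j', o', hj', ho', rfl⟩ := decomp h.hr h1 hx
      have hlt : j < j' → j * r + r ≤ j' * r := fun h' => by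
        have : (j + 1) * r ≤ j' * r := Nat.mul_le_mul_right r h'
        rw [Nat.add_mul] at this; omega
      have hgt : j' < j → j' * r + r ≤ j * r := fun h' => by
        have : (j' + 1) * r ≤ j * r := Nat.mul_le_mul_right r h'
        rw [Nat.add_mul] at this; omega
      rcases Nat.eq_zero_or_pos o' with rfl | h2
      · rw [Nat.add_zero] at *
        have hne : ¬ (m + j * r + o ≤ m + j' * r ∧ m + j' * r < m + j * r + r) := by
          rcases lt_trichotomy j j' with h' | rfl | h'
          · have := hlt h'; omega
          · omega
          · have := hgt h'; omega
        rcases lt_or_ge j' a with h3 | h3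
        · rw [h.start0 j' h3]; omega
        · rw [h.start1 j' h3 hj']; omega
      · obtain ⟨o', rfl⟩ := Nat.exists_eq_succ_of_ne_zero (by omega : o' ≠ 0)
        rw [h.succ j' o' hj' ho']
        rcases lt_trichotomy j j' with h' | rfl | h'
        · have := hlt h'; omega
        · omega
        · have := hgt h'; omega
  refine pg_sz h.npos h.lt h.zero _ (by omega) hin
    (fun x => m + j * r + o ≤ x ∧ x < m + j * r + r) ?_ ?_ ?_ ?_ t ?_ ?_
  · omega
  · intro x hx hP hnP
    by_contra hne
    exact hnP ((key x hx hne).2 hP)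
  · intro x hx hP
    have hne : x ≠ m + j * r + o := by rintro rfl; omega
    exact fun h' => hP ((key x hx hne).1 h')
  · have := h.lt _ (by omega) hin
    omega
  · refine le_of_le_of_eq ?_ (Eq.symm (Eq.trans ?_ hcard))
    · omega
    · congr
  · refine le_trans (le_of_eq ?_) (?_ : t + (r - o) ≤ _)
    · rw [← hcard]; congr
    · omega

lemma PA.cnt_small (h : PA p m r a b) {t : ℕ} (h1 : 1 ≤ t) (htr : t ≤ r) :
    m + (a + b) * r ≤ cnt (parentGraph (m + (a + b) * r) p) t + (a + b) * (t - 1) + 1 := by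
  have hm := h.hm
  set Im : Finset ℕ := insert 0 (((Finset.range (a + b)) ×ˢ (Finset.range (t - 1))).image
    fun q => m + q.1 * r + (r - 1 - q.2)) with hIm
  have hc : Im.card ≤ (a + b) * (t - 1) + 1 := by
    refine (Finset.card_insert_le _ _).trans ?_
    refine Nat.add_le_add_right (Finset.card_image_le.trans ?_) 1
    rw [Finset.card_product, Finset.card_range, Finset.card_range]
  have := pg_cnt h.npos h.lt t (fun x => x ∉ Im) ?_
  · have h2 := Finset.card_filter_add_card_filter_not (s := Finset.range (m + (a + b) * r)) (fun x => x ∉ Im)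
    have h3 : ((Finset.range (m + (a + b) * r)).filter (fun x => ¬ x ∉ Im)).card ≤ Im.card :=
      Finset.card_le_card (by intro x; simp)
    rw [Finset.card_range] at h2
    have h4 : ((Finset.range (m + (a + b) * r)).filter (fun x => x ∉ Im)).card ≤
      cnt (parentGraph (m + (a + b) * r) p) t := le_trans (le_of_eq (by congr)) this
    omega
  · intro i hi hP
    have h0 : 0 < i := by
      by_contra h0
      apply hP
      rw [hIm, (by omega : i = 0)]
      exact Finset.mem_insert_self _ _
    refine ⟨h0, ?_⟩
    have har : r ≤ a * r := Nat.le_mul_of_pos_left r (by have := h.hb; have := h.hab; omega)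
    have hbr : r ≤ b * r := Nat.le_mul_of_pos_left r (by have := h.hb; have := h.hab; omega)
    rcases lt_or_ge i m with h2 | h2
    · exact h.sz_core h0 h2 hi (by omega) (by omega)
    · obtain ⟨j, o, hj, ho, rfl⟩ := decomp h.hr h2 hi
      apply h.sz_leg hj ho
      by_contra hlt
      apply hP
      rw [hIm]
      apply Finset.mem_insert_of_mem
      rw [Finset.mem_image]
      refine ⟨(j, r - 1 - o), ?_, ?_⟩
      · simp only [Finset.mem_product, Finset.mem_range]; omega
      · simp only; omega

lemma PA.cnt_large (h : PA p m r a b) {t N : ℕ} (h1 : N + 1 ≤ m) 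
    (h2 : N + t ≤ m + b * r) (h3 : N + 2 * t ≤ m + (a + b) * r + 1) :
    N ≤ cnt (parentGraph (m + (a + b) * r) p) t := by
  have hm := h.hm
  have hba : b * r ≤ a * r := Nat.mul_le_mul_right r h.hab
  have hn : m + (a + b) * r = m + a * r + b * r := by rw [Nat.add_mul]; omega
  obtain ⟨lo, hlo⟩ : ∃ lo, lo = max 1 (t - a * r) := ⟨_, rfl⟩
  rcases Nat.eq_zero_or_pos N with rfl | hN
  · exact Nat.zero_le _
  have := pg_cnt h.npos h.lt t (fun x => lo ≤ x ∧ x < lo + N) ?_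
  · refine le_trans (le_of_eq ?_) this
    have h4 : (Finset.range (m + (a + b) * r)).filter (fun x => lo ≤ x ∧ x < lo + N) = Finset.Ico lo (lo + N) := by
      ext x; simp only [Finset.mem_filter, Finset.mem_range, Finset.mem_Ico]; omega
    have h5 := congrArg Finset.card h4
    rw [Nat.card_Ico, Nat.add_sub_cancel_left] at h5
    refine Eq.trans h5.symm ?_
    congr
  · rintro i hi ⟨h4, h5⟩
    refine ⟨by omega, h.sz_core (by omega) (by omega) hi (by omega) (by omega)⟩
end


end Mst

namespace Mst

variable {V : Type*} [Fintype V]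


/-- The pendent path condition. -/
def PPath (G : SimpleGraph V) (r : ℕ) (u : Fin (r + 1) → V) : Prop :=
    Function.Injective u ∧
    (∀ i : Fin r, G.Adj (u i.castSucc) (u i.succ)) ∧
    G.degree (u 0) = 1 ∧ 2 ≤ G.degree (u (Fin.last r)) ∧
    ∀ i : Fin (r + 1), i ≠ 0 → i ≠ Fin.last r → G.degree (u i) = 2

lemma ppc_eq (G : SimpleGraph V) (r : ℕ) :
    pendentPathCount G r = Nat.card {u : Fin (r + 1) → V // PPath G r u} := rfl

lemma deg_one_of {G : SimpleGraph V} {v a : V} (h : ∀ w, G.Adj v w ↔ w = a) : G.degree v = 1 := by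
  rw [degree_eq_one_iff_existsUnique_adj]
  exact ⟨a, (h a).2 rfl, fun w hw => (h w).1 hw⟩

lemma deg_one {G : SimpleGraph V} {v a b : V} (h : G.degree v = 1) (ha : G.Adj v a)
    (hb : G.Adj v b) : b = a := by
  rw [degree_eq_one_iff_existsUnique_adj] at h
  exact h.unique hb ha

lemma deg_two_of {G : SimpleGraph V} {v a b : V} (hab : a ≠ b)
    (h : ∀ w, G.Adj v w ↔ (w = a ∨ w = b)) : G.degree v = 2 := by
  rw [← card_neighborFinset_eq_degree]
  have : G.neighborFinset v = {a, b} := by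
    ext w
    rw [mem_neighborFinset, h w, Finset.mem_insert, Finset.mem_singleton]
  rw [this, Finset.card_pair hab]

lemma deg_ge_two {G : SimpleGraph V} {v a b : V} (hab : a ≠ b)
    (ha : G.Adj v a) (hb : G.Adj v b) : 2 ≤ G.degree v := by
  rw [← card_neighborFinset_eq_degree, ← Finset.card_pair hab]
  apply Finset.card_le_card
  intro w hw
  rw [Finset.mem_insert, Finset.mem_singleton] at hw
  rw [mem_neighborFinset]
  rcases hw with rfl | rfl <;> assumption

lemma deg_two {G : SimpleGraph V} {v a b c : V} (h : G.degree v = 2) (hab : a ≠ b)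
    (ha : G.Adj v a) (hb : G.Adj v b) (hc : G.Adj v c) : c = a ∨ c = b := by
  have hs : ({a, b} : Finset V) ⊆ G.neighborFinset v := by
    intro w hw
    rw [Finset.mem_insert, Finset.mem_singleton] at hw
    rw [mem_neighborFinset]
    rcases hw with rfl | rfl <;> assumption
  have := Finset.eq_of_subset_of_card_le hs
    (by rw [card_neighborFinset_eq_degree, h, Finset.card_pair hab])
  have hc' : c ∈ ({a, b} : Finset V) := by rw [this, mem_neighborFinset]; exact hc
  rw [Finset.mem_insert, Finset.mem_singleton] at hc'
  exact hc'

/-- Extend a finite path to a function on `ℕ`. -/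
def ext {r : ℕ} (u : Fin (r + 1) → V) (i : ℕ) : V := u ⟨min i r, by omega⟩

lemma ext_val {r : ℕ} (u : Fin (r + 1) → V) (i : Fin (r + 1)) : ext u i.val = u i := by
  unfold ext
  congr 1
  apply Fin.ext
  simp only
  omega

lemma PPath.adj {G : SimpleGraph V} {r : ℕ} {u : Fin (r + 1) → V} (h : PPath G r u) {i : ℕ}
    (hi : i < r) : G.Adj (ext u i) (ext u (i + 1)) := by
  have := h.2.1 ⟨i, hi⟩
  rw [← ext_val u, ← ext_val u] at this
  exact this

lemma PPath.inj {G : SimpleGraph V} {r : ℕ} {u : Fin (r + 1) → V} (h : PPath G r u) {i j : ℕ}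
    (hi : i ≤ r) (hj : j ≤ r) (he : ext u i = ext u j) : i = j := by
  have := h.1 he
  rw [Fin.mk.injEq] at this
  omega

lemma PPath.n0 {G : SimpleGraph V} {r : ℕ} (hr : 0 < r) {u : Fin (r + 1) → V} (h : PPath G r u) {b : V}
    (hb : G.Adj (ext u 0) b) : b = ext u 1 := by
  have h1 := h.2.2.1
  rw [← ext_val u] at h1
  exact deg_one h1 (h.adj hr) hb

lemma PPath.n2 {G : SimpleGraph V} {r : ℕ} {u : Fin (r + 1) → V} (h : PPath G r u) {i : ℕ} {b : V}
    (h0 : 0 < i) (hi : i < r)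
    (hb : G.Adj (ext u i) b) : b = ext u (i - 1) ∨ b = ext u (i + 1) := by
  have h1 := h.2.2.2.2 ⟨i, by omega⟩ (by rw [Ne, Fin.ext_iff]; simp; omega)
    (by rw [Ne, Fin.ext_iff]; simp; omega)
  rw [← ext_val u] at h1
  refine deg_two h1 ?_ ?_ (h.adj hi) hb
  · intro he
    have := h.inj (by omega) (by omega) he
    omega
  · have := h.adj (i := i - 1) (by omega)
    rw [Nat.sub_add_cancel h0] at this
    exact this.symm

lemma PPath.det {G : SimpleGraph V} {r : ℕ} (hr : 0 < r) {u w : Fin (r + 1) → V} (h : PPath G r u)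
    (h' : PPath G r w) (h0 : ext u 0 = ext w 0) : u = w := by
  have key : ∀ i, i ≤ r → ext u i = ext w i := by
    intro i
    induction i using Nat.strong_induction_on with
    | _ i ih =>
      intro hi
      rcases i with _ | _ | i
      · exact h0
      · have := h'.adj hr
        rw [← h0] at this
        exact (h.n0 hr this).symm
      · have e1 := ih (i + 1) (by omega) (by omega)
        have e2 := ih i (by omega) (by omega)
        have := h'.adj (i := i + 1) (by omega)
        rw [← e1] at this
        rcases h.n2 (by omega) (by omega) this with h3 | h3
        · rw [Nat.add_sub_cancel, e2] at h3
          have := h'.inj (by omega) (by omega) h3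
          omega
        · exact h3.symm
  funext i
  rw [← ext_val u, ← ext_val w]
  exact key i (by omega)

lemma legs_of {G : SimpleGraph V} {r : ℕ} (hr : 0 < r) (hs : 2 * r < Fintype.card V) :
    Legs G r (fun (P : {u : Fin (r + 1) → V // PPath G r u}) => ext P.1) where
  adj := fun P i hi => P.2.adj hi
  inj := fun P i j hi hj he => P.2.inj hi hj he
  n0 := fun P b hb => P.2.n0 hr hb
  n2 := fun P i b h0 hi hb => P.2.n2 h0 hi hb
  det := fun P Q h => Subtype.ext (P.2.det hr Q.2 h)
  pos := hr
  small := hs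

end Mst

namespace Mst

variable {V : Type*} [Fintype V]


section
variable {p : ℕ → ℕ} {m r a b : ℕ}

lemma PA.att_lt (h : PA p m r a b) {j : ℕ} (hj : j < a + b) : p (m + j * r) < m := by
  have hm := h.hm
  rcases lt_or_ge j a with h3 | h3
  · rw [h.start0 j h3]; omega
  · rw [h.start1 j h3 hj]; omega

lemma PA.child_leg (h : PA p m r a b) {x j o : ℕ} (hx : x < m + (a + b) * r) (ho : o < r)
    (he : p x = m + j * r + o) : o + 1 < r ∧ x = m + j * r + (o + 1) := by
  have hm := h.hm
  rcases lt_or_ge x m with h1 | h1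
  · rw [h.core x h1] at he; omega
  · obtain ⟨j', o', hj', ho', rfl⟩ := decomp h.hr h1 hx
    rcases o' with _ | o'
    · rw [Nat.add_zero] at he
      have := h.att_lt hj'
      omega
    · rw [h.succ j' o' hj' ho'] at he
      obtain ⟨rfl, rfl⟩ := decomp_unique (r := r) (by omega : o' < r) ho
        (by omega : j' * r + o' = j * r + o)
      exact ⟨ho', rfl⟩

lemma PA.adj_par (h : PA p m r a b) {v w : Fin (m + (a + b) * r)} (h0 : 0 < v.val)
    (hp : p v.val = w.val) : (parentGraph (m + (a + b) * r) p).Adj v w := by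
  rw [pg_adj]
  refine ⟨?_, Or.inl hp⟩
  rintro rfl
  have := h.lt _ h0 v.2
  omega

lemma PA.leg_adj (h : PA p m r a b) {j o : ℕ} (hj : j < a + b) (ho : o < r)
    {v w : Fin (m + (a + b) * r)} (hv : v.val = m + j * r + o) :
    (parentGraph (m + (a + b) * r) p).Adj v w ↔
      (w.val = p v.val ∨ (o + 1 < r ∧ w.val = m + j * r + (o + 1))) := by
  have hm := h.hm
  constructor
  · intro hadj
    rw [pg_adj] at hadj
    rcases hadj.2 with h1 | h1
    · exact Or.inl h1.symm
    · rw [hv] at h1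
      exact Or.inr (h.child_leg w.2 ho h1)
  · rintro (h1 | ⟨h1, h2⟩)
    · exact h.adj_par (by omega) h1.symm
    · refine (h.adj_par (by omega) ?_).symm
      rw [h2, h.succ j o hj h1, hv]

lemma PA.in_lt (_h : PA p m r a b) {j o : ℕ} (hj : j < a + b) (ho : o < r) :
    m + j * r + o < m + (a + b) * r := by
  have := leg_lt hj ho
  omega

lemma PA.leaf (h : PA p m r a b) {v : Fin (m + (a + b) * r)}
    (hd : (parentGraph (m + (a + b) * r) p).degree v = 1) :
    ∃ j, j < a + b ∧ v.val = m + j * r + (r - 1) := by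
  have hm := h.hm
  have hr := h.hr
  have hb := h.hb
  have hab := h.hab
  have two : ∀ x y : Fin (m + (a + b) * r), (parentGraph (m + (a + b) * r) p).Adj v x →
      (parentGraph (m + (a + b) * r) p).Adj v y → y.val = x.val := by
    intro x y hx hy
    exact congrArg Fin.val (deg_one hd hx hy)
  rcases lt_or_ge v.val m with h1 | h1
  · exfalso
    -- a smaller or leg neighbour, and a larger one
    have hA : ∃ x : Fin (m + (a + b) * r), (parentGraph (m + (a + b) * r) p).Adj v x ∧
        (x.val = v.val - 1 ∧ 0 < v.val ∨ v.val = 0 ∧ x.val = m) := by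
      rcases Nat.eq_zero_or_pos v.val with h0 | h0
      · have hlt := h.in_lt (j := 0) (o := 0) (by omega) (by omega)
        rw [Nat.zero_mul, Nat.add_zero] at hlt
        refine ⟨⟨m, hlt⟩, (h.adj_par ?_ ?_).symm, Or.inr ⟨h0, rfl⟩⟩
        · simp only; omega
        · have := h.start0 0 (by omega)
          rw [Nat.zero_mul, Nat.add_zero] at this
          simp only
          omega
      · exact ⟨⟨v.val - 1, by omega⟩, h.adj_par h0 (h.core _ h1), Or.inl ⟨rfl, h0⟩⟩
    have hB : ∃ x : Fin (m + (a + b) * r), (parentGraph (m + (a + b) * r) p).Adj v x ∧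
        (x.val = v.val + 1 ∧ v.val + 1 < m ∨ v.val = m - 1 ∧ m ≤ x.val) := by
      rcases lt_or_ge (v.val + 1) m with h0 | h0
      · refine ⟨⟨v.val + 1, by omega⟩, (h.adj_par ?_ ?_).symm, Or.inl ⟨rfl, h0⟩⟩
        · simp only; omega
        · simp only
          rw [h.core _ h0]; omega
      · have hlt := h.in_lt (j := a) (o := 0) (by omega) (by omega)
        rw [Nat.add_zero] at hlt
        refine ⟨⟨m + a * r, hlt⟩, (h.adj_par ?_ ?_).symm, Or.inr ⟨by omega, ?_⟩⟩
        · simp only; omega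
        · simp only
          rw [h.start1 a le_rfl (by omega)]
          omega
        · simp only; omega
    obtain ⟨x, hx, hx'⟩ := hA
    obtain ⟨y, hy, hy'⟩ := hB
    have := two x y hx hy
    omega
  · obtain ⟨j, o, hj, ho, hv⟩ := decomp hr h1 v.2
    refine ⟨j, hj, ?_⟩
    by_contra hne
    have ho' : o + 1 < r := by omega
    have hplt := h.lt v.val (by omega) v.2
    have e1 := (h.leg_adj hj ho (w := ⟨p v.val, by omega⟩) hv).2 (Or.inl rfl)
    have e2 := (h.leg_adj hj ho (w := ⟨m + j * r + (o + 1), h.in_lt hj ho'⟩) hv).2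
      (Or.inr ⟨ho', rfl⟩)
    have := two _ _ e1 e2
    simp only at this
    omega

/-- The explicit pendent paths of `treeA`. -/
def apath (h : PA p m r a b) (j : Fin (a + b)) : Fin (r + 1) → Fin (m + (a + b) * r) :=
  fun s => if s.val < r then ⟨m + j.val * r + (r - 1 - s.val),
    h.in_lt j.2 (by have := h.hr; omega)⟩ else ⟨p (m + j.val * r), by
      have := h.att_lt j.2; omega⟩

lemma apath_lt (h : PA p m r a b) (j : Fin (a + b)) {s : Fin (r + 1)} (hs : s.val < r) :
    (apath h j s).val = m + j.val * r + (r - 1 - s.val) := by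
  unfold apath
  rw [if_pos hs]

lemma apath_last (h : PA p m r a b) (j : Fin (a + b)) {s : Fin (r + 1)} (hs : ¬ s.val < r) :
    (apath h j s).val = p (m + j.val * r) := by
  unfold apath
  rw [if_neg hs]

lemma PA.p_leg (h : PA p m r a b) {j o : ℕ} (hj : j < a + b) (ho : o < r) :
    p (m + j * r + o) < m ∧ o = 0 ∨ (0 < o ∧ p (m + j * r + o) = m + j * r + (o - 1)) := by
  rcases o with _ | o
  · exact Or.inl ⟨h.att_lt hj, rfl⟩
  · exact Or.inr ⟨by omega, h.succ j o hj ho⟩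

lemma apath_ppath (h : PA p m r a b) (j : Fin (a + b)) :
    PPath (parentGraph (m + (a + b) * r) p) r (apath h j) := by
  have hm := h.hm
  have hr := h.hr
  have hatt := h.att_lt j.2
  refine ⟨?_, ?_, ?_, ?_, ?_⟩
  · intro s t hst
    have hst' := congrArg Fin.val hst
    apply Fin.ext
    have h1 := s.2
    have h2 := t.2
    by_cases hs : s.val < r <;> by_cases ht : t.val < r
    · rw [apath_lt h j hs, apath_lt h j ht] at hst'; omega
    · rw [apath_lt h j hs, apath_last h j ht] at hst'; omega
    · rw [apath_last h j hs, apath_lt h j ht] at hst'; omega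
    · omega
  · intro i
    have hi : (i.castSucc : Fin (r + 1)).val < r := i.2
    have e1 := apath_lt h j hi
    rw [Fin.val_castSucc] at e1
    refine (h.leg_adj j.2 (by omega) e1).2 (Or.inl ?_)
    rw [e1]
    by_cases hs : i.val + 1 < r
    · rw [apath_lt h j (by simpa using hs)]
      rcases h.p_leg j.2 (by omega : r - 1 - i.val < r) with h1 | h1
      · omega
      · rw [h1.2, Fin.val_succ]; omega
    · rw [apath_last h j (by simpa using hs), (by omega : r - 1 - i.val = 0), Nat.add_zero]
  · have e1 := apath_lt h j (s := 0) (by simp; omega)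
    rw [Fin.val_zero] at e1
    have hplt := h.lt (apath h j 0).val (by omega) (apath h j 0).2
    refine deg_one_of (a := ⟨p (apath h j 0).val, by omega⟩) ?_
    intro w
    rw [h.leg_adj j.2 (by omega) e1, Fin.ext_iff]
    constructor
    · rintro (h1 | h1)
      · exact h1
      · omega
    · exact Or.inl
  · have e1 := apath_last h j (s := Fin.last r) (by simp)
    have hlt := h.in_lt j.2 (o := 0) (by omega)
    rw [Nat.add_zero] at hlt
    rcases lt_or_ge j.val a with h3 | h3
    · rw [h.start0 _ h3] at e1
      refine deg_ge_two (a := ⟨1, by omega⟩) (b := ⟨m + j.val * r, hlt⟩) ?_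
        (h.adj_par ?_ ?_).symm (h.adj_par ?_ ?_).symm
      · rw [Ne, Fin.mk.injEq]; omega
      · simp only; omega
      · simp only; rw [e1, h.core 1 (by omega)]
      · simp only; omega
      · simp only; rw [e1, h.start0 _ h3]
    · rw [h.start1 _ h3 j.2] at e1
      refine deg_ge_two (a := ⟨m - 2, by omega⟩) (b := ⟨m + j.val * r, hlt⟩) ?_
        (h.adj_par ?_ ?_) (h.adj_par ?_ ?_).symm
      · rw [Ne, Fin.mk.injEq]; omega
      · omega
      · simp only; rw [e1, h.core _ (by omega)]; omega
      · simp only; omega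
      · simp only; rw [e1, h.start1 _ h3 j.2]
  · intro s hs0 hsr
    have h0 : s.val ≠ 0 := fun hh => hs0 (Fin.ext hh)
    have h1 : s.val ≠ r := fun hh => hsr (Fin.ext hh)
    have h2 := s.2
    have e1 := apath_lt h j (s := s) (by omega)
    have hplt := h.lt (apath h j s).val (by omega) (apath h j s).2
    refine deg_two_of (a := ⟨p (apath h j s).val, by omega⟩)
      (b := ⟨m + j.val * r + (r - 1 - s.val + 1), h.in_lt j.2 (by omega)⟩) ?_ ?_
    · rw [Ne, Fin.mk.injEq]; omega
    · intro w
      rw [h.leg_adj j.2 (by omega) e1, Fin.ext_iff, Fin.ext_iff]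
      constructor
      · rintro (h3 | h3)
        · exact Or.inl h3
        · exact Or.inr h3.2
      · rintro (h3 | h3)
        · exact Or.inl h3
        · exact Or.inr ⟨by omega, h3⟩

lemma PA.count (h : PA p m r a b) :
    pendentPathCount (parentGraph (m + (a + b) * r) p) r = a + b := by
  have hr := h.hr
  rw [ppc_eq]
  apply le_antisymm
  · have hc : ∀ P : {u : Fin (r + 1) → Fin (m + (a + b) * r) //
        PPath (parentGraph (m + (a + b) * r) p) r u}, ∃ j : Fin (a + b),
        (P.1 0).val = m + j.val * r + (r - 1) := by
      intro P
      obtain ⟨j, hj, e⟩ := h.leaf P.2.2.2.1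
      exact ⟨⟨j, hj⟩, e⟩
    choose f hf using hc
    have := Nat.card_le_card_of_injective f ?_
    · rwa [Nat.card_fin] at this
    · intro P Q hPQ
      apply Subtype.ext
      refine P.2.det hr Q.2 ?_
      have e1 := hf P
      rw [hPQ, ← hf Q] at e1
      have e2 : P.1 0 = Q.1 0 := Fin.ext e1
      rw [← ext_val P.1, ← ext_val Q.1] at e2
      exact e2
  · have := Nat.card_le_card_of_injective (fun j : Fin (a + b) =>
      (⟨apath h j, apath_ppath h j⟩ : {u : Fin (r + 1) → Fin (m + (a + b) * r) //
        PPath (parentGraph (m + (a + b) * r) p) r u})) ?_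
    · rwa [Nat.card_fin] at this
    · intro j j' hjj
      have e := congrArg (fun P => (P.1 0).val) hjj
      simp only at e
      rw [apath_lt h j (by simp; omega), apath_lt h j' (by simp; omega)] at e
      rw [Fin.val_zero] at e
      exact Fin.ext (decomp_unique (by omega : r - 1 - 0 < r) (by omega : r - 1 - 0 < r)
        (by omega : j.val * r + (r - 1 - 0) = j'.val * r + (r - 1 - 0))).1
end

end Mst

namespace Mst

variable {V : Type*} [Fintype V]


section
variable {p : ℕ → ℕ} {m r a b k : ℕ} {ι : Type*} [Fintype ι]

lemma cnt_le (h : PA p m r a b) {T : SimpleGraph (Fin (m + (a + b) * r))} (hT : T.IsTree)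
    {leg : ι → ℕ → Fin (m + (a + b) * r)} (L : Legs T r leg) (P0 : ι)
    (hk : Fintype.card ι = a + b) (hb : (a + b) / 2 = b) {t : ℕ} (ht : 1 ≤ t) :
    cnt T t ≤ cnt (parentGraph (m + (a + b) * r) p) t := by
  rcases Nat.lt_or_ge r t with h1 | h1
  · rcases Nat.eq_zero_or_pos (cnt T t) with h0 | h0
    · omega
    · have e1 := bound1 hT L P0 t r le_rfl h1
      obtain ⟨e2, e3⟩ := bound23 hT L t h1 h0
      rw [hk, Fintype.card_fin] at e1
      rw [hk, Fintype.card_fin, hb, Nat.add_sub_cancel] at e2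
      rw [Fintype.card_fin] at e3
      have hn : (a + b) * r = a * r + b * r := Nat.add_mul _ _ _
      exact h.cnt_large (by omega) (by omega) e3
  · have e1 := bound1 hT L P0 t (t - 1) (by omega) (by omega)
    have e2 := h.cnt_small ht h1
    rw [hk, Fintype.card_fin] at e1
    omega

lemma cnt_eq (h : PA p m r a b) {T : SimpleGraph (Fin (m + (a + b) * r))} (hT : T.IsTree)
    {leg : ι → ℕ → Fin (m + (a + b) * r)} (L : Legs T r leg) (P0 : ι)
    (hk : Fintype.card ι = a + b) (hb : (a + b) / 2 = b)
    (hmin : mostar T ≤ mostar (parentGraph (m + (a + b) * r) p))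
    {t : ℕ} (ht : 1 ≤ t) (htn : t ≤ m + (a + b) * r) :
    cnt T t = cnt (parentGraph (m + (a + b) * r) p) t := by
  have e1 := mostar_eq hT
  have e2 := mostar_eq h.tree
  have hle : ∀ s ∈ Icc 1 (Fintype.card (Fin (m + (a + b) * r))),
      cnt T s ≤ cnt (parentGraph (m + (a + b) * r) p) s := by
    intro s hs
    exact cnt_le h hT L P0 hk hb (Finset.mem_Icc.1 hs).1
  have hs := Finset.sum_le_sum hle
  have heq : ∑ s ∈ Icc 1 (Fintype.card (Fin (m + (a + b) * r))), cnt T s =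
      ∑ s ∈ Icc 1 (Fintype.card (Fin (m + (a + b) * r))),
        cnt (parentGraph (m + (a + b) * r) p) s := by omega
  refine (Finset.sum_eq_sum_iff_of_le hle).1 heq t ?_
  rw [Finset.mem_Icc, Fintype.card_fin]
  exact ⟨ht, htn⟩

lemma iso_of (h : PA p m r a b) {T : SimpleGraph (Fin (m + (a + b) * r))} (hT : T.IsTree)
    {leg : ι → ℕ → Fin (m + (a + b) * r)} (L : Legs T r leg)
    (hk3 : 3 ≤ a + b)
    (hk : Fintype.card ι = a + b) (hb : (a + b) / 2 = b)
    (hmin : mostar T ≤ mostar (parentGraph (m + (a + b) * r) p)) :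
    Nonempty (T ≃g parentGraph (m + (a + b) * r) p) := by
  have hm := h.hm
  have hr := h.hr
  obtain ⟨P0⟩ : Nonempty ι := Fintype.card_pos_iff.1 (by omega)
  have hn : (a + b) * r = a * r + b * r := Nat.add_mul _ _ _
  have hba : b * r ≤ a * r := Nat.mul_le_mul_right r h.hab
  obtain ⟨x, hx, y, hy, hxy, hnx, hny, hat, hg⟩ := struct_aux hT L (by omega)
    (by rw [hk, Fintype.card_fin]; omega)
    (by
      rw [hk, hb, Fintype.card_fin, cnt_eq h hT L P0 hk hb hmin (by omega) (by omega)]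
      have := h.cnt_large (N := m - 1) (t := b * r + 1) (by omega) (by omega) (by omega)
      omega)
    (by
      intro hodd
      rw [hk] at hodd
      have hba' : (b + 1) * r ≤ a * r := Nat.mul_le_mul_right r (by omega)
      rw [Nat.add_mul] at hba'
      rw [hk, hb, Fintype.card_fin, cnt_eq h hT L P0 hk hb hmin (by omega) (by omega)]
      have := h.cnt_large (N := m - 2) (t := b * r + 2) (by omega) (by omega) (by omega)
      omega)
  have hcc := card_core hT L
  rw [hk, Fintype.card_fin] at hcc
  have hcm : (core leg r).card = m := by omega
  obtain ⟨c, c0, c1, cmem, cinj, cadj⟩ := enum_core hT L hx hy hg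
  rw [hcm] at c1 cmem cinj cadj
  have ha : (Fintype.card ι + 1) / 2 = a := by
    have := h.hab
    rw [hk]; omega
  obtain ⟨e, he⟩ := enum_legs (leg := leg) (r := r) (x := x) (a := a) (by omega) (by rw [hnx, ha])
  obtain ⟨E, Einj, hE⟩ : ∃ E : ℕ → ι, (∀ i j, i < a + b → j < a + b → E i = E j → i = j) ∧
      ∀ j, j < a + b → (leg (E j) r = x ↔ j < a) := by
    refine ⟨fun j => if hj : j < Fintype.card ι then e ⟨j, hj⟩ else P0, ?_, ?_⟩
    · intro i j hi hj hij
      simp only at hij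
      rw [dif_pos (by omega), dif_pos (by omega)] at hij
      have := e.injective hij
      rwa [Fin.mk.injEq] at this
    · intro j hj
      simp only
      rw [dif_pos (by omega), he]
  obtain ⟨φ, φc, φl⟩ : ∃ φ : ℕ → Fin (m + (a + b) * r), (∀ v, v < m → φ v = c v) ∧
      ∀ j o, o < r → φ (m + j * r + o) = leg (E j) (r - 1 - o) := by
    refine ⟨fun v => if v < m then c v else leg (E ((v - m) / r)) (r - 1 - (v - m) % r), ?_, ?_⟩
    · intro v hv
      simp only
      rw [if_pos hv]
    · intro j o ho
      simp only
      rw [if_neg (by omega), (by omega : m + j * r + o - m = o + j * r),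
        Nat.add_mul_mod_self_right, Nat.mod_eq_of_lt ho, Nat.add_mul_div_right _ _ hr,
        Nat.div_eq_of_lt ho, Nat.zero_add]
  have hcl : ∀ v j o, v < m → o < r → φ v ≠ φ (m + j * r + o) := by
    intro v j o hv ho heq
    rw [φc v hv, φl j o ho] at heq
    exact mem_core.1 (cmem v hv) (E j) (mem_lset.2 ⟨r - 1 - o, by omega, heq.symm⟩)
  refine pg_iso h.npos h.lt h.zero hT φ ?_ ?_
  · intro i j hi hj hij
    rcases lt_or_ge i m with h1 | h1 <;> rcases lt_or_ge j m with h2 | h2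
    · rw [φc i h1, φc j h2] at hij
      exact cinj i j h1 h2 hij
    · obtain ⟨j, o, hj', ho, rfl⟩ := decomp hr h2 hj
      exact absurd hij (hcl _ _ _ h1 ho)
    · obtain ⟨i, o, hj', ho, rfl⟩ := decomp hr h1 hi
      exact absurd hij.symm (hcl _ _ _ h2 ho)
    · obtain ⟨i, o, hi', ho, rfl⟩ := decomp hr h1 hi
      obtain ⟨j, o', hj', ho', rfl⟩ := decomp hr h2 hj
      rw [φl i o ho, φl j o' ho'] at hij
      have hEE : E i = E j := by
        by_contra hne
        exact Finset.disjoint_left.1 (disj_legs hT L hne)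
          (mem_lset.2 ⟨r - 1 - o, by omega, rfl⟩) (mem_lset.2 ⟨r - 1 - o', by omega, hij.symm⟩)
      rw [hEE] at hij
      have e1 := L.inj _ _ _ (by omega) (by omega) hij
      have e2 := Einj i j hi' hj' hEE
      subst e2
      omega
  · intro i h0 hi
    rcases lt_or_ge i m with h1 | h1
    · rw [h.core i h1, φc i h1, φc (i - 1) (by omega)]
      have := cadj (i - 1) (by omega)
      rw [Nat.sub_add_cancel h0] at this
      exact this.symm
    · obtain ⟨j, o, hj, ho, rfl⟩ := decomp hr h1 hi
      rw [φl j o ho]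
      rcases o with _ | o
      · rw [Nat.add_zero, Nat.sub_zero]
        have hA := L.adj (E j) (r - 1) (by omega)
        rw [Nat.sub_add_cancel hr] at hA
        rcases lt_or_ge j a with h3 | h3
        · rw [h.start0 j h3, φc 0 (by omega), c0, ← (hE j hj).2 h3]
          exact hA
        · rw [h.start1 j h3 hj, φc _ (by omega), c1]
          rcases hat (E j) with h4 | h4
          · have := (hE j hj).1 h4
            omega
          · rw [← h4]; exact hA
      · rw [h.succ j o hj ho, φl j o (by omega)]
        have hA := L.adj (E j) (r - 1 - (o + 1)) (by omega)
        rw [(by omega : r - 1 - (o + 1) + 1 = r - 1 - o)] at hA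
        exact hA
end

end Mst

/-- for k ≥ 3 and 1 ≤ r ≤ (n-2)/k, the tree minimizing the Mostar index among
trees of order n with exactly k pendent paths of length r is A^r_{n,⌈k/2⌉,⌊k/2⌋}. -/
theorem min_mostar_k_pendent_paths (n r k : ℕ) (hk : 3 ≤ k) (hr : 1 ≤ r)
    (hrn : k * r ≤ n - 2) (hn : 2 ≤ n)
    (T : SimpleGraph (Fin n)) (hT : T.IsTree) (hpp : pendentPathCount T r = k)
    (hmin : ∀ T' : SimpleGraph (Fin n), T'.IsTree → pendentPathCount T' r = k →
      mostar T ≤ mostar T') :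
    Nonempty (T ≃g treeA n r ((k + 1) / 2) (k / 2)) := by
  have hkr : 3 * r ≤ k * r := Nat.mul_le_mul_right r hk
  obtain ⟨a, ha⟩ : ∃ a, a = (k + 1) / 2 := ⟨_, rfl⟩
  obtain ⟨b, hb⟩ : ∃ b, b = k / 2 := ⟨_, rfl⟩
  obtain ⟨m, hm⟩ : ∃ m, m = n - k * r := ⟨_, rfl⟩
  rw [← ha, ← hb]
  have hab : a + b = k := by omega
  have hn' : n = m + (a + b) * r := by rw [hab]; omega
  have hm2 : 2 ≤ m := by omega
  have hb2 : (a + b) / 2 = b := by omega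
  have hb1 : 1 ≤ b := by omega
  have hba : b ≤ a := by omega
  clear ha hb hm
  subst hab
  subst hn'
  have h := Mst.pA_PA hm2 hr hb1 hba
  rw [Mst.treeA_eq]
  have L := Mst.legs_of (G := T) (r := r) hr (by rw [Fintype.card_fin]; omega)
  rw [Mst.ppc_eq, Nat.card_eq_fintype_card] at hpp
  exact Mst.iso_of h hT L hk hpp hb2 (hmin _ h.tree h.count)
end
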